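/- If a finite group G acts freely and continuously on a finite CW complex X that is homotopy equivalent to a product of two spheres S^{n₁} × S^{n₂} (for some n₁, n₂ ≥ 1), then G contains no subgroup isomorphic to (ℤ/p)³ for any prime p; that is, the rank of G is at most 2. -/

import Mathlib

open Metric

/-- `Sph n` is the unit sphere `S^n`, i.e. the set of unit vectors in `ℝ^{n+1}`. -/
abbrev Sph (n : ℕ) : Type := Metric.sphere (0 : EuclideanSpace ℝ (Fin (n + 1))) 1

/-- The self-homeomorphisms of a topological space form a group under composition.
A continuous action of a group `G` on `X` (every element acting by a homeomorphism)
is then precisely a group homomorphism `G →* (X ≃ₜ X)`. -/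
instance homeoGroup (X : Type*) [TopologicalSpace X] : Group (X ≃ₜ X) where
  mul e f := f.trans e
  one := Homeomorph.refl X
  inv := Homeomorph.symm
  mul_assoc _ _ _ := Homeomorph.ext fun _ => rfl
  one_mul _ := Homeomorph.ext fun _ => rfl
  mul_one _ := Homeomorph.ext fun _ => rfl
  inv_mul_cancel e := Homeomorph.ext fun x => e.symm_apply_apply x

/-- The boundary sphere `S^{n-1}` of an `n`-cell: the unit sphere in `ℝ^n`. -/
abbrev CellBoundary (n : ℕ) : Type := Metric.sphere (0 : EuclideanSpace ℝ (Fin n)) 1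

/-- A closed `n`-cell: the closed unit ball `D^n` in `ℝ^n`. -/
abbrev Cell (n : ℕ) : Type := Metric.closedBall (0 : EuclideanSpace ℝ (Fin n)) 1

/-- The space obtained from `X` by attaching `k` cells of dimension `n` along the attaching
maps `f i : S^{n-1} → X`: the quotient of the disjoint union `X ⊔ (Fin k × D^n)` obtained by
identifying each boundary point of each disk with its image under the corresponding
attaching map, endowed with the quotient topology. -/
abbrev AttachCells (n k : ℕ) (X : Type) [TopologicalSpace X]
    (f : Fin k → C(CellBoundary n, X)) : Type :=
  Quot (fun a b : X ⊕ (Σ _ : Fin k, Cell n) =>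
    ∃ (i : Fin k) (s : CellBoundary n),
      a = Sum.inl (f i s) ∧ b = Sum.inr ⟨i, ⟨s.1, Metric.sphere_subset_closedBall s.2⟩⟩)

/-- `IsFiniteCWAtMost n X` : the space `X` is a finite CW complex of dimension at most `n`,
i.e. it is built from the empty space by attaching, for each dimension `0, 1, …, n` in
increasing order, finitely many cells of that dimension (and it is allowed to skip
dimensions, and to replace the space by a homeomorphic copy). -/
inductive IsFiniteCWAtMost : (n : ℕ) → (X : Type) → [TopologicalSpace X] → Prop
  | base (k : ℕ) (f : Fin k → C(CellBoundary 0, Empty)) :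
      IsFiniteCWAtMost 0 (AttachCells 0 k Empty f)
  | up {n : ℕ} {X : Type} [TopologicalSpace X] :
      IsFiniteCWAtMost n X → IsFiniteCWAtMost (n + 1) X
  | attach {n : ℕ} {X : Type} [TopologicalSpace X] (hX : IsFiniteCWAtMost n X)
      (k : ℕ) (f : Fin k → C(CellBoundary (n + 1), X)) :
      IsFiniteCWAtMost (n + 1) (AttachCells (n + 1) k X f)
  | homeo {n : ℕ} {X Y : Type} [TopologicalSpace X] [TopologicalSpace Y]
      (hX : IsFiniteCWAtMost n X) (e : X ≃ₜ Y) : IsFiniteCWAtMost n Y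

/-- `X` is a finite CW complex: it can be built from finitely many cells, attached in
order of increasing dimension. -/
def IsFiniteCW (X : Type) [TopologicalSpace X] : Prop :=
  ∃ n, IsFiniteCWAtMost n X

section Endgame

open MvPolynomial

variable {k : Type} [Field k]

/-- The algebra endomorphism of `k[X₀, X₁, X₂]` killing the variables of index `< n`. -/
noncomputable def killBelow (k : Type) [Field k] (n : ℕ) :
    MvPolynomial (Fin 3) k →ₐ[k] MvPolynomial (Fin 3) k :=
  aeval fun i => if (i : ℕ) < n then 0 else X i

instance isPrime_ker_killBelow (n : ℕ) : (RingHom.ker (killBelow k n)).IsPrime :=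
  RingHom.ker_isPrime (killBelow k n).toRingHom

lemma ker_killBelow_lt (n : ℕ) (hn : n < 3) :
    RingHom.ker (killBelow k n) < RingHom.ker (killBelow k (n + 1)) := by
  rw [SetLike.lt_iff_le_and_exists]
  constructor
  · have h : (killBelow k (n + 1)) = (killBelow k (n + 1)).comp (killBelow k n) := by
      apply MvPolynomial.algHom_ext
      intro i
      simp only [killBelow, AlgHom.comp_apply, aeval_X]
      by_cases h : (i : ℕ) < n
      · simp [h, Nat.lt_succ_of_lt h]
      · simp [h]
    intro f hf
    rw [RingHom.mem_ker] at hf ⊢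
    rw [h, AlgHom.comp_apply, hf, map_zero]
  · refine ⟨X ⟨n, hn⟩, ?_, ?_⟩ <;> simp [RingHom.mem_ker, killBelow]

lemma three_le_height_ker_killBelow : (3 : ℕ∞) ≤ (RingHom.ker (killBelow k 3)).height := by
  have h (n : ℕ) (hn : n < 3) := Ideal.height_add_one_le_of_lt_of_isPrime
    (I := RingHom.ker (killBelow k n)) (J := RingHom.ker (killBelow k (n + 1)))
    (ker_killBelow_lt n hn)
  have h0 := h 0 (by norm_num)
  have h1 := h 1 (by norm_num)
  have h2 := h 2 (by norm_num)
  calc (3 : ℕ∞) = 0 + 1 + 1 + 1 := by norm_num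
    _ ≤ (RingHom.ker (killBelow k 0)).height + 1 + 1 + 1 := by gcongr; exact zero_le
    _ ≤ _ := (add_le_add (add_le_add h0 le_rfl) le_rfl).trans
      ((add_le_add h1 le_rfl).trans h2)

/-- Two polynomials in three variables without constant term have a common nonzero zero over
some field extension. -/
lemma exists_common_zero (f g : MvPolynomial (Fin 3) k)
    (hf : aeval (0 : Fin 3 → k) f = 0) (hg : aeval (0 : Fin 3 → k) g = 0) :
    ∃ (K : Type) (_ : Field K) (_ : Algebra k K) (a : Fin 3 → K), a ≠ 0 ∧
      aeval a f = 0 ∧ aeval a g = 0 := by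
  classical
  have hkill (q : MvPolynomial (Fin 3) k) (hq : aeval (0 : Fin 3 → k) q = 0) :
      q ∈ RingHom.ker (killBelow k 3) := by
    have h : killBelow k 3 =
        (Algebra.ofId k (MvPolynomial (Fin 3) k)).comp (aeval (0 : Fin 3 → k)) := by
      apply MvPolynomial.algHom_ext
      intro i
      simp [killBelow]
    rw [RingHom.mem_ker, h, AlgHom.comp_apply, hq, map_zero]
  have hle : Ideal.span (({f, g} : Finset _) : Set (MvPolynomial (Fin 3) k)) ≤
      RingHom.ker (killBelow k 3) := by
    rw [Ideal.span_le]
    intro q hq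
    simp only [Finset.coe_insert, Finset.coe_singleton, Set.mem_insert_iff,
      Set.mem_singleton_iff] at hq
    rcases hq with rfl | rfl
    · exact hkill _ hf
    · exact hkill _ hg
  obtain ⟨P, hP, hPle⟩ := Ideal.exists_minimalPrimes_le hle
  have hPprime : P.IsPrime := hP.1.1
  have hht : P.height ≤ 2 :=
    (Ideal.height_le_card_of_mem_minimalPrimes_span_finset hP).trans (by
      exact_mod_cast Finset.card_le_two)
  have hfg := hP.1.2
  let K := FractionRing (MvPolynomial (Fin 3) k ⧸ P)
  let ev : MvPolynomial (Fin 3) k →ₐ[k] K :=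
    (IsScalarTower.toAlgHom k (MvPolynomial (Fin 3) k ⧸ P) K).comp (Ideal.Quotient.mkₐ k P)
  have hev (q : MvPolynomial (Fin 3) k) : ev q = 0 ↔ q ∈ P := by
    have : ev q = algebraMap (MvPolynomial (Fin 3) k ⧸ P) K (Ideal.Quotient.mk P q) := rfl
    rw [this, FaithfulSMul.algebraMap_eq_zero_iff, Ideal.Quotient.eq_zero_iff_mem]
  have haeval : aeval (fun i => ev (X i)) = ev := by
    apply MvPolynomial.algHom_ext
    intro i
    simp
  refine ⟨K, inferInstance, inferInstance, fun i => ev (X i), ?_, ?_, ?_⟩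
  · intro h0
    have h3 : RingHom.ker (killBelow k 3) ≤ P := by
      intro q hq
      rw [← hev, ← haeval, h0]
      have h : aeval (0 : Fin 3 → K) = (aeval (0 : Fin 3 → K)).comp (killBelow k 3) := by
        apply MvPolynomial.algHom_ext
        intro i
        simp [killBelow]
      rw [h, AlgHom.comp_apply, show killBelow k 3 q = 0 from hq, map_zero]
    have := (three_le_height_ker_killBelow (k := k)).trans ((Ideal.height_mono h3).trans hht)
    exact absurd this (by decide)
  · rw [haeval, hev]
    exact hfg (Ideal.subset_span (by simp))
  · rw [haeval, hev]
    exact hfg (Ideal.subset_span (by simp))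

/-- A `ZMod 2`-graded pair of matrices over `k[X₀, X₁, X₂]` becoming exact at every nonzero
point. -/
def ExactOffZero {n : Type} [Fintype n] (d e : Matrix n n (MvPolynomial (Fin 3) k)) : Prop :=
  ∀ (K : Type) [Field K] [Algebra k K] (a : Fin 3 → K), a ≠ 0 → ∀ v : n → K,
    (d.map (aeval a)).mulVec v = 0 → ∃ w, (e.map (aeval a)).mulVec w = v

lemma false_of_corner_eq_zero {d e : Matrix (Fin 4) (Fin 4) (MvPolynomial (Fin 3) k)}
    (hd : ∀ i j, j ≤ i → d i j = 0) (he : ∀ i j, j ≤ i → e i j = 0)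
    (hd0 : ∀ i j, aeval (0 : Fin 3 → k) (d i j) = 0)
    (hde : d * e = 0)
    (h1 : ExactOffZero d e) (h2 : ExactOffZero e d) (hu : d 1 2 = 0) : False := by
  obtain ⟨K, _, _, a, ha, hx, hy⟩ := exists_common_zero (d 0 1) (d 0 2) (hd0 _ _) (hd0 _ _)
  have hm (i j) : aeval a ((d * e) i j) = 0 := by simp [hde]
  obtain ⟨w, hw⟩ := h2 K a ha ![1, 0, 0, 0] (by
    ext i; fin_cases i <;> simp [Matrix.mulVec, dotProduct, Fin.sum_univ_four, he])
  have hw0 := congrFun hw 0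
  have hw1 := congrFun hw 1
  have hw2 := congrFun hw 2
  simp [Matrix.mulVec, dotProduct, Fin.sum_univ_four, hd, hx, hy, hu] at hw0 hw1 hw2
  have hw3 : w 3 ≠ 0 := by
    rintro h
    simp [h] at hw0
  have hv : aeval a (d 1 3) = 0 := hw1.resolve_right hw3
  have hww : aeval a (d 2 3) = 0 := hw2.resolve_right hw3
  obtain ⟨s, hs⟩ := h1 K a ha ![0, 1, 0, 0] (by
    ext i; fin_cases i <;> simp [Matrix.mulVec, dotProduct, Fin.sum_univ_four, hd, hx])
  obtain ⟨t, ht⟩ := h1 K a ha ![0, 0, 1, 0] (by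
    ext i; fin_cases i <;> simp [Matrix.mulVec, dotProduct, Fin.sum_univ_four, hd, hy, hu])
  have ht1 := congrFun ht 1
  have ht2 := congrFun ht 2
  have ht3 := congrFun ht 3
  have hs1 := congrFun hs 1
  have hs2 := congrFun hs 2
  simp [Matrix.mulVec, dotProduct, Fin.sum_univ_four, he] at ht1 ht2 hs1 hs2
  have hw' : e 2 3 ≠ 0 := by
    intro h; simp [h] at ht2
  have hw'K : aeval a (e 2 3) ≠ 0 := by
    intro h; simp [h] at ht2
  have hu' : e 1 2 ≠ 0 := by
    intro h
    have : s 3 = 0 := hs2.resolve_left hw'K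
    simp [h, this] at hs1
  have hm' (i j) : (d * e) i j = 0 := by simp [hde]
  have e02 := hm' 0 2
  have e03 := hm' 0 3
  simp [Matrix.mul_apply, Fin.sum_univ_four, hd, he] at e02 e03
  have hx0 : d 0 1 = 0 := e02.resolve_right hu'
  have hy0 : d 0 2 = 0 := by
    simpa [hx0, hw'] using e03
  -- now `d` has nonzero entries at most in the last column
  obtain ⟨L, _, _, b, hb, hz, hv'⟩ := exists_common_zero (d 0 3) (d 1 3) (hd0 _ _) (hd0 _ _)
  obtain ⟨w, hw⟩ := h2 L b hb ![1, 0, 0, 0] (by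
    ext i; fin_cases i <;> simp [Matrix.mulVec, dotProduct, Fin.sum_univ_four, he])
  have hw0 := congrFun hw 0
  simp [Matrix.mulVec, dotProduct, Fin.sum_univ_four, hd, hz, hx0, hy0] at hw0

lemma false_of_exactOffZero_four {d e : Matrix (Fin 4) (Fin 4) (MvPolynomial (Fin 3) k)}
    (hd : ∀ i j, j ≤ i → d i j = 0) (he : ∀ i j, j ≤ i → e i j = 0)
    (hd0 : ∀ i j, aeval (0 : Fin 3 → k) (d i j) = 0)
    (he0 : ∀ i j, aeval (0 : Fin 3 → k) (e i j) = 0)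
    (hde : d * e = 0) (hed : e * d = 0)
    (h1 : ExactOffZero d e) (h2 : ExactOffZero e d) : False := by
  by_cases hu : d 1 2 = 0
  · exact false_of_corner_eq_zero hd he hd0 hde h1 h2 hu
  by_cases hu' : e 1 2 = 0
  · exact false_of_corner_eq_zero he hd he0 hed h2 h1 hu'
  have hm (i j) : (d * e) i j = 0 := by simp [hde]
  have hm' (i j) : (e * d) i j = 0 := by simp [hed]
  have a02 := hm 0 2
  have a13 := hm 1 3
  have b02 := hm' 0 2
  have b13 := hm' 1 3
  simp [Matrix.mul_apply, Fin.sum_univ_four, hd, he, hu, hu'] at a02 a13 b02 b13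
  obtain ⟨K, _, _, a, ha, hx, -⟩ := exists_common_zero
    (d 0 2 * d 1 3 - d 0 3 * d 1 2) 0
    (by rw [map_sub, map_mul, map_mul, hd0 0 2, hd0 0 3]; simp) (by simp)
  have key : ∃ β γ : K, (β, γ) ≠ 0 ∧ aeval a (d 0 2) * β + aeval a (d 0 3) * γ = 0 ∧
      aeval a (d 1 2) * β + aeval a (d 1 3) * γ = 0 := by
    simp only [map_sub, map_mul] at hx
    by_cases h : aeval a (d 1 2) = 0 ∧ aeval a (d 1 3) = 0
    · by_cases h' : aeval a (d 0 2) = 0 ∧ aeval a (d 0 3) = 0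
      · exact ⟨1, 0, by simp, by simp [h'], by simp [h]⟩
      · refine ⟨aeval a (d 0 3), - aeval a (d 0 2), ?_, by ring, by simp [h]⟩
        simp only [ne_eq, Prod.mk_eq_zero, neg_eq_zero]
        tauto
    · refine ⟨aeval a (d 1 3), - aeval a (d 1 2), ?_, by linear_combination hx, by ring⟩
      simp only [ne_eq, Prod.mk_eq_zero, neg_eq_zero]
      tauto
  obtain ⟨β, γ, hne, e1, e2⟩ := key
  obtain ⟨w, hw⟩ := h1 K a ha ![0, 0, β, γ] (by
    ext i
    fin_cases i <;> simp [Matrix.mulVec, dotProduct, Fin.sum_univ_four, hd, e1, e2, b13])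
  have hw2 := congrFun hw 2
  have hw3 := congrFun hw 3
  simp [Matrix.mulVec, dotProduct, Fin.sum_univ_four, he, a13] at hw2 hw3
  exact hne (by simp [← hw2, ← hw3])

/-- A strictly triangular `ZMod 2`-graded complex of rank between `1` and `4` over
`k[X₀, X₁, X₂]`, minimal at the origin, is not exact away from the origin. -/
lemma false_of_exactOffZero {r : ℕ} (hr : 1 ≤ r) (hr4 : r ≤ 4)
    {d e : Matrix (Fin r) (Fin r) (MvPolynomial (Fin 3) k)}
    (hd : ∀ i j, j ≤ i → d i j = 0) (he : ∀ i j, j ≤ i → e i j = 0)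
    (hd0 : ∀ i j, aeval (0 : Fin 3 → k) (d i j) = 0)
    (he0 : ∀ i j, aeval (0 : Fin 3 → k) (e i j) = 0)
    (hde : d * e = 0) (hed : e * d = 0)
    (h1 : ExactOffZero d e) (h2 : ExactOffZero e d) : False := by
  obtain rfl | hr3 := hr4.eq_or_lt
  · exact false_of_exactOffZero_four hd he hd0 he0 hde hed h1 h2
  obtain ⟨f, g, hf, hg, hfg⟩ : ∃ f g : MvPolynomial (Fin 3) k, aeval (0 : Fin 3 → k) f = 0 ∧
      aeval (0 : Fin 3 → k) g = 0 ∧ ∀ j, d ⟨0, hr⟩ j = 0 ∨ d ⟨0, hr⟩ j = f ∨ d ⟨0, hr⟩ j = g := by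
    interval_cases r
    · exact ⟨0, 0, by simp, by simp, fun j => by fin_cases j; simp [hd]⟩
    · exact ⟨d 0 1, 0, hd0 _ _, by simp, fun j => by fin_cases j <;> simp [hd]⟩
    · exact ⟨d 0 1, d 0 2, hd0 _ _, hd0 _ _, fun j => by fin_cases j <;> simp [hd]⟩
  obtain ⟨K, _, _, a, ha, hx, hy⟩ := exists_common_zero f g hf hg
  have hrow (j) : aeval a (d ⟨0, hr⟩ j) = 0 := by
    rcases hfg j with h | h | h <;> simp [h, hx, hy]
  obtain ⟨w, hw⟩ := h2 K a ha (Pi.single ⟨0, hr⟩ 1) (by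
    ext i
    simp [he i ⟨0, hr⟩ (Nat.zero_le _)])
  have := congrFun hw ⟨0, hr⟩
  simp [Matrix.mulVec, dotProduct, hrow] at this

end Endgame

section Perturbation

/-- The harmonic projection. -/
def harm {A : Type*} [Ring A] (D h : A) : A := 1 - D * h - h * D

/-- The differential induced by the perturbation `t` on the harmonic part, where `u` is an
inverse of `1 + h * t`. -/
def transferred {A : Type*} [Ring A] (D h t u : A) : A := harm D h * t * u * harm D h

/-- A strong deformation retract datum in a ring, with a perturbation `t₀, t₁` of the
differential `D` for which the perturbed complex is `2`-periodic, and inverses of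
`1 + h * tᵢ`. -/
structure PerturbationData {A : Type*} [Ring A] (D h t₀ t₁ u₀ u₁ : A) : Prop where
  hh : h * h = 0
  DD : D * D = 0
  DhD : D * h * D = D
  hDh : h * D * h = h
  D_t₀ : D * t₀ = - (t₁ * D)
  D_t₁ : D * t₁ = - (t₀ * D)
  t₁_t₀ : t₁ * t₀ = 0
  t₀_t₁ : t₀ * t₁ = 0
  left₀ : u₀ * (1 + h * t₀) = 1
  right₀ : (1 + h * t₀) * u₀ = 1
  left₁ : u₁ * (1 + h * t₁) = 1
  right₁ : (1 + h * t₁) * u₁ = 1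

namespace PerturbationData

variable {A : Type*} [Ring A] {D h t₀ t₁ u₀ u₁ : A}

lemma symm (H : PerturbationData D h t₀ t₁ u₀ u₁) : PerturbationData D h t₁ t₀ u₁ u₀ :=
  ⟨H.hh, H.DD, H.DhD, H.hDh, H.D_t₁, H.D_t₀, H.t₀_t₁, H.t₁_t₀, H.left₁, H.right₁, H.left₀,
    H.right₀⟩

variable (H : PerturbationData D h t₀ t₁ u₀ u₁)
include H

lemma D_harm : D * harm D h = 0 := by
  have : D * harm D h = D - D * D * h - D * h * D := by simp only [harm]; noncomm_ring
  rw [this, H.DD, H.DhD]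
  simp

lemma harm_D : harm D h * D = 0 := by
  have : harm D h * D = D - D * h * D - h * (D * D) := by simp only [harm]; noncomm_ring
  rw [this, H.DD, H.DhD]
  simp

lemma h_harm : h * harm D h = 0 := by
  have : h * harm D h = h - h * D * h - h * h * D := by simp only [harm]; noncomm_ring
  rw [this, H.hh, H.hDh]
  simp

lemma harm_h : harm D h * h = 0 := by
  have : harm D h * h = h - h * D * h - D * (h * h) := by simp only [harm]; noncomm_ring
  rw [this, H.hh, H.hDh]
  simp

lemma harm_harm : harm D h * harm D h = harm D h := by
  have : harm D h * harm D h = harm D h - harm D h * D * h - harm D h * h * D := by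
    conv_lhs => rw [harm.eq_1 D h, ← harm.eq_1 D h]
    nth_rewrite 2 [harm]
    noncomm_ring
  rw [this, H.harm_D, H.harm_h]
  simp

lemma perturbed_sq : (D + t₁) * (D + t₀) = 0 := by
  have : (D + t₁) * (D + t₀) = D * D + D * t₀ + t₁ * D + t₁ * t₀ := by noncomm_ring
  rw [this, H.DD, H.D_t₀, H.t₁_t₀]
  simp

lemma perturbed_incl :
    (D + t₀) * (u₀ * harm D h) = u₁ * harm D h * transferred D h t₀ u₀ := by
  have e1 : (1 + h * t₁) * (D + t₀) = D * (1 + h * t₀) + harm D h * t₀ := by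
    have : (1 + h * t₁) * (D + t₀) = D + t₀ + h * (t₁ * D) + h * (t₁ * t₀) := by noncomm_ring
    rw [this, H.t₁_t₀]
    have : t₁ * D = - (D * t₀) := by rw [H.D_t₀, neg_neg]
    rw [this]
    simp only [harm]
    noncomm_ring
  have e2 : (D + t₀) * u₀ = u₁ * (D + harm D h * t₀ * u₀) := by
    calc (D + t₀) * u₀ = (u₁ * (1 + h * t₁)) * (D + t₀) * u₀ := by rw [H.left₁, one_mul]
      _ = u₁ * ((1 + h * t₁) * (D + t₀)) * u₀ := by noncomm_ring
      _ = u₁ * (D * ((1 + h * t₀) * u₀) + harm D h * t₀ * u₀) := by rw [e1]; noncomm_ring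
      _ = _ := by rw [H.right₀, mul_one]
  calc (D + t₀) * (u₀ * harm D h) = (D + t₀) * u₀ * harm D h := by noncomm_ring
    _ = u₁ * (D * harm D h) + u₁ * (harm D h * t₀ * u₀ * harm D h) := by
      rw [e2]; noncomm_ring
    _ = u₁ * (D * harm D h) + u₁ * (harm D h * harm D h * t₀ * u₀ * harm D h) := by
      rw [H.harm_harm]
    _ = _ := by rw [H.D_harm, transferred]; noncomm_ring

lemma proj_perturbed :
    harm D h * (1 - t₀ * u₀ * h) * (D + t₀) =
      transferred D h t₀ u₀ * (harm D h * (1 - t₁ * u₁ * h)) := by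
  have e1 : (D + t₀) * (1 + t₁ * h) = (1 + t₀ * h) * D + t₀ * harm D h := by
    have : (D + t₀) * (1 + t₁ * h) = D + t₀ + D * t₁ * h + t₀ * t₁ * h := by noncomm_ring
    rw [this, H.t₀_t₁, H.D_t₁]
    simp only [harm]
    noncomm_ring
  have e2 : (1 - t₀ * u₀ * h) * (1 + t₀ * h) = 1 := by
    have : (1 - t₀ * u₀ * h) * (1 + t₀ * h) = 1 + t₀ * (1 - u₀ * (1 + h * t₀)) * h := by
      noncomm_ring
    rw [this, H.left₀]
    simp
  have e3 : (1 - t₀ * u₀ * h) * t₀ = t₀ * u₀ := by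
    have : (1 - t₀ * u₀ * h) * t₀ = t₀ * (1 - u₀ * (1 + h * t₀)) + t₀ * u₀ := by noncomm_ring
    rw [this, H.left₀]
    simp
  have e4 : (1 + t₁ * h) * (1 - t₁ * u₁ * h) = 1 := by
    have : (1 + t₁ * h) * (1 - t₁ * u₁ * h) = 1 + t₁ * (1 - (1 + h * t₁) * u₁) * h := by
      noncomm_ring
    rw [this, H.right₁]
    simp
  have e5 : harm D h * (1 - t₀ * u₀ * h) * (D + t₀) * (1 + t₁ * h) =
      transferred D h t₀ u₀ := by
    calc _ = harm D h * (1 - t₀ * u₀ * h) * ((D + t₀) * (1 + t₁ * h)) := by noncomm_ring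
      _ = harm D h * (((1 - t₀ * u₀ * h) * (1 + t₀ * h)) * D +
          ((1 - t₀ * u₀ * h) * t₀) * harm D h) := by rw [e1]; noncomm_ring
      _ = harm D h * D + harm D h * t₀ * u₀ * harm D h := by rw [e2, e3]; noncomm_ring
      _ = _ := by rw [H.harm_D, zero_add, transferred]
  calc _ = harm D h * (1 - t₀ * u₀ * h) * (D + t₀) * ((1 + t₁ * h) * (1 - t₁ * u₁ * h)) := by
        rw [e4, mul_one]
    _ = transferred D h t₀ u₀ * (1 - t₁ * u₁ * h) := by rw [← e5]; noncomm_ring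
    _ = harm D h * t₀ * u₀ * (harm D h * harm D h) * (1 - t₁ * u₁ * h) := by
        rw [H.harm_harm, transferred]
    _ = _ := by rw [transferred]; noncomm_ring

lemma proj_incl : harm D h * (1 - t₁ * u₁ * h) * (u₀ * harm D h) = harm D h := by
  have e1 : h * u₀ = h := by
    have : h * u₀ = h * ((1 + h * t₀) * u₀) - h * h * t₀ * u₀ := by noncomm_ring
    rw [this, H.right₀, H.hh]
    simp
  have e2 : harm D h * u₀ = harm D h := by
    have : harm D h * u₀ = harm D h * ((1 + h * t₀) * u₀) - harm D h * h * t₀ * u₀ := by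
      noncomm_ring
    rw [this, H.right₀, H.harm_h]
    simp
  calc _ = harm D h * u₀ * harm D h - harm D h * t₁ * u₁ * (h * u₀ * harm D h) := by
        noncomm_ring
    _ = _ := by rw [e1, e2, H.h_harm, H.harm_harm]; simp

lemma transferred_sq : transferred D h t₁ u₁ * transferred D h t₀ u₀ = 0 := by
  have h0 : transferred D h t₀ u₀ =
      harm D h * (1 - t₀ * u₀ * h) * (D + t₀) * (u₀ * harm D h) := by
    rw [H.proj_perturbed, mul_assoc (transferred _ _ _ _), H.proj_incl, transferred,
      mul_assoc _ (harm D h), H.harm_harm]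
  calc _ = transferred D h t₁ u₁ * (harm D h * (1 - t₀ * u₀ * h)) * (D + t₀) *
        (u₀ * harm D h) := by rw [h0]; noncomm_ring
    _ = harm D h * (1 - t₁ * u₁ * h) * ((D + t₁) * (D + t₀)) * (u₀ * harm D h) := by
        rw [← H.symm.proj_perturbed]; noncomm_ring
    _ = 0 := by rw [H.perturbed_sq]; simp

end PerturbationData

/-- The transferred differential is exact if the perturbed differential is. -/
lemma PerturbationData.exact {R M : Type*} [CommRing R] [AddCommGroup M] [Module R M]
    {D h t₀ t₁ u₀ u₁ : Module.End R M} (H : PerturbationData D h t₀ t₁ u₀ u₁)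
    (hex : ∀ c, (D + t₀) c = 0 → ∃ w, (D + t₁) w = c)
    {v : M} (hv : harm D h v = v) (hdv : transferred D h t₀ u₀ v = 0) :
    ∃ w, harm D h w = w ∧ transferred D h t₁ u₁ w = v := by
  have h1 := LinearMap.congr_fun H.perturbed_incl v
  simp only [Module.End.mul_apply, hdv, map_zero] at h1
  obtain ⟨w, hw⟩ := hex _ h1
  refine ⟨(harm D h * (1 - t₀ * u₀ * h)) w, ?_, ?_⟩
  · rw [← Module.End.mul_apply, ← mul_assoc, H.harm_harm]
  · rw [← Module.End.mul_apply, ← H.symm.proj_perturbed, Module.End.mul_apply, hw,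
      ← Module.End.mul_apply u₀, ← Module.End.mul_apply, H.proj_incl, hv]

end Perturbation

section Filtered

variable {R M : Type*} [CommRing R] [AddCommGroup M] [Module R M] {F : ℕ → Submodule R M}
  {N : Module.End R M}

lemma isUnit_one_add_of_filtered (h0 : F 0 = ⊥) (hF : ∀ z, ∃ n, z ∈ F n)
    (hN : ∀ n, ∀ z ∈ F (n + 1), N z ∈ F n) : IsUnit (1 + N) := by
  rw [Module.End.isUnit_iff]
  constructor
  · rw [injective_iff_map_eq_zero]
    intro z hz
    have hz' : z = - N z := by
      rw [eq_neg_iff_add_eq_zero]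
      simpa using hz
    obtain ⟨n, hn⟩ := hF z
    induction n with
    | zero => simpa [h0] using hn
    | succ n ih => exact ih (by rw [hz']; exact neg_mem (hN n z hn))
  · intro z
    obtain ⟨n, hn⟩ := hF z
    induction n generalizing z with
    | zero => exact ⟨0, by simpa [h0, eq_comm] using hn⟩
    | succ n ih =>
      obtain ⟨y, hy⟩ := ih (- N z) (neg_mem (hN n z hn))
      refine ⟨z + y, ?_⟩
      rw [map_add, hy]
      simp

lemma mem_of_one_add_apply_mem (hmono : Monotone F) (hF : ∀ z, ∃ n, z ∈ F n)
    (hN : ∀ n, ∀ z ∈ F (n + 1), N z ∈ F n) {z : M} {n : ℕ} (hz : (1 + N) z ∈ F n) :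
    z ∈ F n := by
  obtain ⟨m, hm⟩ := hF z
  induction m with
  | zero => exact hmono (Nat.zero_le n) hm
  | succ m ih =>
    rcases le_or_gt (m + 1) n with h | h
    · exact hmono h hm
    · apply ih
      have : z = (1 + N) z - N z := by simp
      rw [this]
      exact sub_mem (hmono (Nat.lt_succ_iff.mp h) hz) (hN m z hm)

end Filtered

section Basis

variable {k E : Type*} [Field k] [AddCommGroup E] [Module k E] [FiniteDimensional k E]

lemma exists_basis_of_step (Q : Submodule k E → Prop) (S : Submodule k E → E → Prop)
    (h0 : Q ⊥) (hstep : ∀ V, Q V → V ≠ ⊤ → ∃ v, v ∉ V ∧ S V v ∧ Q (V ⊔ Submodule.span k {v})) :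
    ∃ b : Module.Basis (Fin (Module.finrank k E)) k E,
      ∀ j, S (Submodule.span k (b '' Set.Iio j)) (b j) := by
  have key : ∀ n ≤ Module.finrank k E, ∃ v : Fin n → E, LinearIndependent k v ∧
      Q (Submodule.span k (Set.range v)) ∧
      ∀ j, S (Submodule.span k (v '' Set.Iio j)) (v j) := by
    intro n
    induction n with
    | zero => exact fun _ => ⟨Fin.elim0, linearIndependent_empty_type, by simpa using h0,
        fun j => j.elim0⟩
    | succ n ih =>
      intro hn
      obtain ⟨v, hv, hQ, hS⟩ := ih (by omega)
      have hne : Submodule.span k (Set.range v) ≠ ⊤ := by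
        intro h
        have h1 := finrank_span_eq_card hv
        rw [h, finrank_top, Fintype.card_fin] at h1
        omega
      obtain ⟨w, hw, hSw, hQw⟩ := hstep _ hQ hne
      have hrange : Set.range (Fin.snoc v w : Fin (n + 1) → E) = insert w (Set.range v) := by
        ext y
        simp [eq_comm]
      refine ⟨Fin.snoc v w, ?_, ?_, ?_⟩
      · exact (linearIndependent_finSnoc).2 ⟨hv, hw⟩
      · rwa [hrange, Set.insert_eq, Set.union_comm, Submodule.span_union]
      · intro j
        induction j using Fin.lastCases with
        | last =>
          have : (Fin.snoc v w : Fin (n + 1) → E) '' Set.Iio (Fin.last n) = Set.range v := by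
            ext y
            simp [Fin.exists_fin_succ', Fin.castSucc_lt_last]
          rw [this]
          simpa using hSw
        | cast j =>
          have : (Fin.snoc v w : Fin (n + 1) → E) '' Set.Iio j.castSucc = v '' Set.Iio j := by
            ext y
            simp [Fin.exists_fin_succ', (Fin.castSucc_lt_last j).le]
          rw [this]
          simpa using hS j
  obtain ⟨v, hv, -, hS⟩ := key _ le_rfl
  let b := basisOfLinearIndependentOfCardEqFinrank' v hv (Fintype.card_fin _)
  exact ⟨b, fun j => by simpa [b] using hS j⟩

end Basis

open TensorProduct

/-- A graded cochain complex `C` over `k`, with the grading recorded by the action `m` of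
functions of the degree, and commuting endomorphisms `x i` with `x i ^ p = 0`. -/
structure TComplex (k : Type) [Field k] (p : ℕ) (C : Type) [AddCommGroup C] [Module k C] where
  D : Module.End k C
  m : (ℕ → k) →ₐ[k] Module.End k C
  x : Fin 3 → Module.End k C
  D_sq : D * D = 0
  m_D : ∀ φ, m φ * D = D * m (fun n => φ (n + 1))
  bdd : ∀ c, ∃ n, m (fun i => if i < n then 1 else 0) c = c
  x_m : ∀ i φ, x i * m φ = m φ * x i
  x_D : ∀ i, x i * D = D * x i
  x_comm : ∀ i j, x i * x j = x j * x i
  x_pow : ∀ i, x i ^ p = 0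

namespace TComplex

variable {k : Type} [Field k] {p : ℕ} {C : Type} [AddCommGroup C] [Module k C]
  (T : TComplex k p C)

section Homotopy

/-- Functions of the degree which are indicators. -/
def ind (k : Type) [Field k] (P : ℕ → Prop) [DecidablePred P] : ℕ → k :=
  fun i => if P i then 1 else 0

/-- The elements of degree `< n`. -/
def Fil (n : ℕ) : Submodule k C := LinearMap.ker (T.m (ind k (fun i => n ≤ i)))

lemma Fil_zero : T.Fil 0 = ⊥ := by
  have : (ind k (fun i => 0 ≤ i)) = 1 := by ext; simp [ind]
  rw [Fil, this, map_one]
  exact LinearMap.ker_id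

lemma Fil_mono : Monotone T.Fil := by
  intro a b hab c hc
  have : ind k (fun i => b ≤ i) = ind k (fun i => b ≤ i) * ind k (fun i => a ≤ i) := by
    ext i
    by_cases h : b ≤ i
    · simp [ind, h, hab.trans h]
    · simp [ind, h]
  rw [Fil, LinearMap.mem_ker] at hc ⊢
  rw [this, map_mul, Module.End.mul_apply, hc, map_zero]

lemma exists_mem_Fil (c : C) : ∃ n, c ∈ T.Fil n := by
  obtain ⟨n, hn⟩ := T.bdd c
  refine ⟨n, ?_⟩
  rw [Fil, LinearMap.mem_ker, ← hn, ← Module.End.mul_apply, ← map_mul]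
  have : ind k (fun i => n ≤ i) * (fun i => if i < n then 1 else 0) = 0 := by
    ext i
    by_cases h : i < n <;> simp [ind, h]
  rw [this]
  simp

lemma m_mem_Fil {n : ℕ} (φ : ℕ → k) {c : C} (hc : c ∈ T.Fil n) : T.m φ c ∈ T.Fil n := by
  rw [Fil, LinearMap.mem_ker] at hc ⊢
  rw [← Module.End.mul_apply, ← map_mul, mul_comm, map_mul, Module.End.mul_apply, hc, map_zero]

lemma x_mem_Fil {n : ℕ} (i : Fin 3) {c : C} (hc : c ∈ T.Fil n) : T.x i c ∈ T.Fil n := by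
  rw [Fil, LinearMap.mem_ker] at hc ⊢
  rw [← Module.End.mul_apply, ← T.x_m, Module.End.mul_apply, hc, map_zero]

lemma m_single_eq_zero {n q : ℕ} (h : n ≤ q) {c : C} (hc : c ∈ T.Fil n) :
    T.m (Pi.single q 1) c = 0 := by
  have : (Pi.single q 1 : ℕ → k) = Pi.single q 1 * ind k (fun i => n ≤ i) := by
    ext i
    by_cases h' : i = q
    · subst h'; simp [ind, h]
    · simp [h']
  rw [Fil, LinearMap.mem_ker] at hc
  rw [this, map_mul, Module.End.mul_apply, hc, map_zero]

lemma sum_m_single {n : ℕ} {c : C} (hc : c ∈ T.Fil n) :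
    ∑ q ∈ Finset.range n, T.m (Pi.single q 1) c = c := by
  have h1 : (1 : ℕ → k) = ∑ q ∈ Finset.range n, Pi.single q 1 + ind k (fun i => n ≤ i) := by
    ext i
    by_cases h' : n ≤ i <;> simp [ind, h', Pi.single_apply]
  rw [Fil, LinearMap.mem_ker] at hc
  conv_rhs => rw [← Module.End.one_apply (R := k) c, ← map_one T.m, h1, map_add,
    LinearMap.add_apply, hc, add_zero, map_sum, LinearMap.sum_apply]

lemma m_apply_of_homogeneous {q : ℕ} {c : C} (hc : T.m (Pi.single q 1) c = c) (φ : ℕ → k) :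
    T.m φ c = φ q • c := by
  have : φ * Pi.single q 1 = φ q • (Pi.single q 1 : ℕ → k) := by
    ext i
    by_cases h' : i = q
    · subst h'; simp
    · simp [h']
  conv_lhs => rw [← hc, ← Module.End.mul_apply, ← map_mul, this, map_smul,
    LinearMap.smul_apply, hc]

/-- The part of degree `-1` of an endomorphism. -/
noncomputable def lower (g : Module.End k C) : Module.End k C where
  toFun c := ∑ᶠ q, T.m (Pi.single q 1) (g (T.m (Pi.single (q + 1) 1) c))
  map_add' c d := by
    obtain ⟨n, hn⟩ := T.exists_mem_Fil c
    obtain ⟨l, hl⟩ := T.exists_mem_Fil d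
    simp only [map_add]
    have hfin (e : C) : (Function.support fun q =>
        T.m (Pi.single q 1) (g (T.m (Pi.single (q + 1) 1) e))).Finite := by
      obtain ⟨n, hn⟩ := T.exists_mem_Fil e
      refine (Set.finite_Iio n).subset fun q hq => ?_
      by_contra h
      exact hq (by simp [T.m_single_eq_zero (q := q + 1)
        (by simp only [Set.mem_Iio, not_lt] at h; omega) hn])
    exact finsum_add_distrib (hfin c) (hfin d)
  map_smul' r c := by
    simp only [map_smul, RingHom.id_apply]
    exact (smul_finsum r _).symm

lemma lower_apply (g : Module.End k C) {n : ℕ} {c : C} (hc : c ∈ T.Fil n) :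
    T.lower g c = ∑ q ∈ Finset.range n, T.m (Pi.single q 1) (g (T.m (Pi.single (q + 1) 1) c)) := by
  change ∑ᶠ q, _ = _
  apply finsum_eq_sum_of_support_subset
  intro q hq
  by_contra h
  exact hq (by simp [T.m_single_eq_zero (q := q + 1)
    (by simp only [Finset.coe_range, Set.mem_Iio, not_lt] at h; omega) hc])

lemma lower_m (g : Module.End k C) (φ : ℕ → k) :
    T.lower g * T.m φ = T.m (fun n => φ (n + 1)) * T.lower g := by
  ext c
  obtain ⟨n, hn⟩ := T.exists_mem_Fil c
  simp only [Module.End.mul_apply]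
  rw [T.lower_apply g hn, T.lower_apply g (T.m_mem_Fil φ hn), map_sum]
  refine Finset.sum_congr rfl fun q _ => ?_
  have h1 : Pi.single (q + 1) 1 * φ = φ (q + 1) • (Pi.single (q + 1) 1 : ℕ → k) := by
    ext i
    by_cases h' : i = q + 1
    · subst h'; simp
    · simp [h']
  have h2 : (fun n => φ (n + 1)) * Pi.single q 1 = φ (q + 1) • (Pi.single q 1 : ℕ → k) := by
    ext i
    by_cases h' : i = q
    · subst h'; simp
    · simp [h']
  have e1 : T.m (Pi.single (q + 1) 1) (T.m φ c) = φ (q + 1) • T.m (Pi.single (q + 1) 1) c := by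
    rw [← Module.End.mul_apply, ← map_mul, h1, map_smul, LinearMap.smul_apply]
  have e2 (d : C) : T.m (fun n => φ (n + 1)) (T.m (Pi.single q 1) d) =
      φ (q + 1) • T.m (Pi.single q 1) d := by
    rw [← Module.End.mul_apply, ← map_mul, h2, map_smul, LinearMap.smul_apply]
  rw [e1, e2]
  simp

lemma D_mem_Fil {n : ℕ} {c : C} (hc : c ∈ T.Fil n) : T.D c ∈ T.Fil (n + 1) := by
  rw [Fil, LinearMap.mem_ker] at hc ⊢
  rw [← Module.End.mul_apply, T.m_D]
  have : (fun i => ind k (fun i => n + 1 ≤ i) (i + 1)) = ind k (fun i => n ≤ i) := by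
    ext i; simp [ind]
  rw [this, Module.End.mul_apply, hc, map_zero]

lemma m_single_zero_D (c : C) : T.m (Pi.single 0 1) (T.D c) = 0 := by
  rw [← Module.End.mul_apply, T.m_D]
  have : (fun n => (Pi.single 0 1 : ℕ → k) (n + 1)) = 0 := by ext i; simp
  rw [this]
  simp

lemma m_single_succ_D (q : ℕ) (c : C) :
    T.m (Pi.single (q + 1) 1) (T.D c) = T.D (T.m (Pi.single q 1) c) := by
  rw [← Module.End.mul_apply, T.m_D]
  have : (fun n => (Pi.single (q + 1) 1 : ℕ → k) (n + 1)) = Pi.single q 1 := by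
    ext i; simp [Pi.single_apply]
  rw [this]
  simp

/-- A contracting homotopy onto harmonic elements. -/
structure IsSplitting (h : Module.End k C) : Prop where
  hh : h * h = 0
  DhD : T.D * h * T.D = T.D
  hDh : h * T.D * h = h
  h_m : ∀ φ, h * T.m φ = T.m (fun n => φ (n + 1)) * h

lemma exists_isSplitting : ∃ h, T.IsSplitting h := by
  obtain ⟨g₀, hg₀⟩ : ∃ g₀ : Module.End k C, ∀ c, T.D (g₀ (T.D c)) = T.D c := by
    obtain ⟨s, hs⟩ := T.D.rangeRestrict.exists_rightInverse_of_surjective (by simp)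
    obtain ⟨g₀, hg₀⟩ := LinearMap.exists_extend s
    refine ⟨g₀, fun c => ?_⟩
    have h1 : g₀ (T.D c) = s ⟨T.D c, LinearMap.mem_range_self _ _⟩ := by
      rw [← hg₀]; rfl
    have h2 := LinearMap.congr_fun hs ⟨T.D c, LinearMap.mem_range_self _ _⟩
    rw [h1]
    exact congrArg Subtype.val h2
  let g := T.lower g₀
  have hg : T.D * g * T.D = T.D := by
    ext c
    obtain ⟨n, hn⟩ := T.exists_mem_Fil c
    simp only [Module.End.mul_apply, g]
    rw [T.lower_apply g₀ (T.D_mem_Fil hn), map_sum]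
    have h1 (q : ℕ) : T.D (T.m (Pi.single q 1) (g₀ (T.m (Pi.single (q + 1) 1) (T.D c)))) =
        T.m (Pi.single (q + 1) 1) (T.D c) := by
      rw [← m_single_succ_D, m_single_succ_D T q c, hg₀, ← m_single_succ_D,
        ← Module.End.mul_apply, ← map_mul, ← Pi.single_mul, one_mul]
    simp only [h1]
    have h2 := T.sum_m_single (T.Fil_mono (Nat.le_succ (n + 1)) (T.D_mem_Fil hn))
    rwa [Finset.sum_range_succ', m_single_zero_D, add_zero] at h2
  have hgm := T.lower_m g₀
  obtain ⟨h₁, hh₁⟩ : ∃ h₁, h₁ = g * T.D * g := ⟨_, rfl⟩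
  have e1 : T.D * h₁ * T.D = T.D := by
    calc T.D * h₁ * T.D = (T.D * g * T.D) * g * T.D := by simp only [hh₁]; noncomm_ring
      _ = _ := by rw [hg, hg]
  have e2 : h₁ * T.D * h₁ = h₁ := by
    calc h₁ * T.D * h₁ = g * (T.D * g * T.D) * g * T.D * g := by simp only [hh₁]; noncomm_ring
      _ = g * T.D * g * T.D * g := by rw [hg]
      _ = g * (T.D * g * T.D) * g := by noncomm_ring
      _ = _ := by rw [hg, hh₁]
  have e3 (φ) : h₁ * T.m φ = T.m (fun n => φ (n + 1)) * h₁ := by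
    have hD : T.D * T.m (fun n => φ (n + 1)) = T.m φ * T.D := (T.m_D φ).symm
    calc h₁ * T.m φ = g * T.D * (g * T.m φ) := by simp only [hh₁]; noncomm_ring
      _ = g * (T.D * T.m (fun n => φ (n + 1))) * g := by rw [hgm φ]; noncomm_ring
      _ = (g * T.m φ) * T.D * g := by rw [hD]; noncomm_ring
      _ = _ := by rw [hgm φ]; simp only [hh₁, g]; noncomm_ring
  have hDD := T.D_sq
  refine ⟨h₁ - h₁ * h₁ * T.D, ?_, ?_, ?_, ?_⟩
  · calc _ = h₁ * h₁ - h₁ * h₁ * h₁ * T.D - h₁ * (h₁ * T.D * h₁) +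
          h₁ * (h₁ * T.D * h₁) * h₁ * T.D := by noncomm_ring
      _ = 0 := by rw [e2]; noncomm_ring
  · calc _ = T.D * h₁ * T.D - T.D * h₁ * h₁ * (T.D * T.D) := by noncomm_ring
      _ = _ := by rw [hDD, e1]; simp
  · calc _ = h₁ * T.D * h₁ - (h₁ * T.D * h₁) * h₁ * T.D - h₁ * h₁ * (T.D * T.D) * h₁ +
          h₁ * h₁ * (T.D * T.D) * h₁ * h₁ * T.D := by noncomm_ring
      _ = _ := by rw [hDD, e2]; noncomm_ring
  · intro φ
    have hD : T.D * T.m φ = T.m (fun n => if n = 0 then 0 else φ (n - 1)) * T.D := by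
      rw [T.m_D]; simp
    calc _ = h₁ * T.m φ - h₁ * h₁ * (T.D * T.m φ) := by noncomm_ring
      _ = h₁ * T.m φ - h₁ * (h₁ * T.m (fun n => if n = 0 then 0 else φ (n - 1))) * T.D := by
        rw [hD]; noncomm_ring
      _ = h₁ * T.m φ - (h₁ * T.m φ) * h₁ * T.D := by
        rw [e3 (fun n => if n = 0 then 0 else φ (n - 1))]; simp [mul_assoc]
      _ = _ := by rw [e3 φ]; noncomm_ring

end Homotopy

end TComplex

section

open TensorProduct

namespace TComplex

variable {k : Type} [Field k] {p : ℕ} {C : Type} [AddCommGroup C] [Module k C]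
  (T : TComplex k p C)

lemma D_x (l : Fin 3) {c : C} (hc : T.D c = 0) : T.D (T.x l c) = 0 := by
  rw [← Module.End.mul_apply, ← T.x_D, Module.End.mul_apply, hc, map_zero]

section BaseChange

variable {R : Type} [CommRing R] [Algebra k R] (a : Fin 3 → R)

/-- The action of `1 + X` for the shifted cyclic subgroup determined by `a`. -/
noncomputable def shift : Module.End R (R ⊗[k] C) := ∑ i, a i • (T.x i).baseChange R

lemma commute_x (i j : Fin 3) : Commute ((T.x i).baseChange R) ((T.x j).baseChange R) := by
  rw [Commute, SemiconjBy, ← LinearMap.baseChange_mul, T.x_comm, LinearMap.baseChange_mul]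

lemma commute_shift {f : Module.End k C} (h : ∀ i, T.x i * f = f * T.x i) :
    Commute (T.shift a) (f.baseChange R) := by
  refine Commute.sum_left _ _ _ fun i _ => Commute.smul_left ?_ _
  rw [Commute, SemiconjBy, ← LinearMap.baseChange_mul, h, LinearMap.baseChange_mul]

lemma shift_pow [Fact p.Prime] [CharP k p] : T.shift a ^ p = 0 := by
  have hp := (Fact.out : p.Prime)
  have hp0 : (p : Module.End R (R ⊗[k] C)) = 0 := by
    have : ((p : k) : k) = 0 := CharP.cast_eq_zero k p
    rw [← map_natCast (algebraMap k (Module.End R (R ⊗[k] C))), this, map_zero]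
  have key (u v : Module.End R (R ⊗[k] C)) (h : Commute u v) (hu : u ^ p = 0) (hv : v ^ p = 0) :
      (u + v) ^ p = 0 := by
    obtain ⟨r, hr⟩ := h.exists_add_pow_prime_eq hp
    rw [hr, hu, hv, hp0]
    simp
  have hx (i) : (a i • (T.x i).baseChange R) ^ p = 0 := by
    rw [smul_pow, ← LinearMap.baseChange_pow, T.x_pow, LinearMap.baseChange_zero, smul_zero]
  have hc (i j) : Commute (a i • (T.x i).baseChange R) (a j • (T.x j).baseChange R) :=
    ((T.commute_x i j).smul_left _).smul_right _
  rw [shift, Fin.sum_univ_three]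
  exact key _ _ ((hc 0 2).add_left (hc 1 2)) (key _ _ (hc 0 1) (hx 0) (hx 1)) (hx 2)

/-- The projection to the even part. -/
def even : Module.End k C := T.m (ind k Even)

/-- The projection to the odd part. -/
def odd : Module.End k C := T.m (ind k (fun n => ¬ Even n))

lemma even_mul_D : T.even * T.D = T.D * T.odd := by
  rw [even, odd, T.m_D]
  congr 2
  ext n
  simp [ind, Nat.even_add_one]

lemma odd_mul_D : T.odd * T.D = T.D * T.even := by
  rw [even, odd, T.m_D]
  congr 2
  ext n
  simp [ind, Nat.even_add_one]

lemma even_mul_odd : T.even * T.odd = 0 := by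
  rw [even, odd, ← map_mul]
  convert map_zero T.m
  ext n
  simp [ind]

lemma odd_mul_even : T.odd * T.even = 0 := by
  rw [even, odd, ← map_mul, mul_comm, map_mul]
  exact T.even_mul_odd

lemma even_add_odd : T.even + T.odd = 1 := by
  rw [even, odd, ← map_add]
  convert map_one T.m
  ext n
  by_cases h : Even n <;> simp [ind, h]

lemma even_mul_even : T.even * T.even = T.even := by
  have := congrArg (T.even * ·) T.even_add_odd
  simpa [mul_add, even_mul_odd] using this

lemma odd_mul_odd : T.odd * T.odd = T.odd := by
  have := congrArg (T.odd * ·) T.even_add_odd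
  simpa [mul_add, odd_mul_even] using this

/-- The perturbation of the differential in the Tate complex, on even places. -/
noncomputable def pert₀ : Module.End R (R ⊗[k] C) :=
  T.shift a * T.even.baseChange R - T.shift a ^ (p - 1) * T.odd.baseChange R

/-- The perturbation of the differential in the Tate complex, on odd places. -/
noncomputable def pert₁ : Module.End R (R ⊗[k] C) :=
  T.shift a ^ (p - 1) * T.even.baseChange R - T.shift a * T.odd.baseChange R

/-- Exactness of the `2`-periodic complex determined by `a`. -/
def Acyclic : Prop :=
  (∀ c, (T.D.baseChange R + T.pert₀ a) c = 0 → ∃ w, (T.D.baseChange R + T.pert₁ a) w = c) ∧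
  (∀ c, (T.D.baseChange R + T.pert₁ a) c = 0 → ∃ w, (T.D.baseChange R + T.pert₀ a) w = c)

lemma shift_D : Commute (T.shift a) (T.D.baseChange R) := T.commute_shift a T.x_D

lemma shift_even : Commute (T.shift a) (T.even.baseChange R) :=
  T.commute_shift a fun i => T.x_m i _

lemma shift_odd : Commute (T.shift a) (T.odd.baseChange R) :=
  T.commute_shift a fun i => T.x_m i _

/-- The relations between `D`, a shift `X`, its power `Y = X ^ (p - 1)` and the parity
projections, in any ring. -/
lemma perturbation_relations {A : Type*} [Ring A] {D X Y e o : A}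
    (hDX : Commute X D) (hDY : Commute Y D) (hXe : Commute X e) (hXo : Commute X o)
    (hYe : Commute Y e) (hYo : Commute Y o) (hXY : X * Y = 0) (hYX : Y * X = 0)
    (heD : e * D = D * o) (hoD : o * D = D * e) (heo : e * o = 0) (hoe : o * e = 0) :
    D * (X * e - Y * o) = - ((Y * e - X * o) * D) ∧
    D * (Y * e - X * o) = - ((X * e - Y * o) * D) ∧
    (Y * e - X * o) * (X * e - Y * o) = 0 ∧ (X * e - Y * o) * (Y * e - X * o) = 0 := by
  refine ⟨?_, ?_, ?_, ?_⟩
  · calc _ = (D * X) * e - (D * Y) * o := by noncomm_ring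
      _ = X * (D * e) - Y * (D * o) := by rw [← hDX.eq, ← hDY.eq]; noncomm_ring
      _ = _ := by rw [← heD, ← hoD]; noncomm_ring
  · calc _ = (D * Y) * e - (D * X) * o := by noncomm_ring
      _ = Y * (D * e) - X * (D * o) := by rw [← hDX.eq, ← hDY.eq]; noncomm_ring
      _ = _ := by rw [← heD, ← hoD]; noncomm_ring
  · calc _ = Y * (e * X) * e - Y * (e * Y) * o - X * (o * X) * e + X * (o * Y) * o := by
          noncomm_ring
      _ = (Y * X) * e * e - Y * Y * (e * o) - X * X * (o * e) + (X * Y) * o * o := by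
          rw [← hXe.eq, ← hYe.eq, ← hXo.eq, ← hYo.eq]; noncomm_ring
      _ = 0 := by rw [hXY, hYX, heo, hoe]; simp
  · calc _ = X * (e * Y) * e - X * (e * X) * o - Y * (o * Y) * e + Y * (o * X) * o := by
          noncomm_ring
      _ = (X * Y) * e * e - X * X * (e * o) - Y * Y * (o * e) + (Y * X) * o * o := by
          rw [← hXe.eq, ← hYe.eq, ← hXo.eq, ← hYo.eq]; noncomm_ring
      _ = 0 := by rw [hXY, hYX, heo, hoe]; simp

lemma pert_relations [Fact p.Prime] [CharP k p] :
    T.D.baseChange R * T.pert₀ a = - (T.pert₁ a * T.D.baseChange R) ∧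
    T.D.baseChange R * T.pert₁ a = - (T.pert₀ a * T.D.baseChange R) ∧
    T.pert₁ a * T.pert₀ a = 0 ∧ T.pert₀ a * T.pert₁ a = 0 := by
  have hp := (Fact.out : p.Prime).pos
  refine perturbation_relations (A := Module.End R (R ⊗[k] C)) (D := T.D.baseChange R)
    (X := T.shift a) (Y := T.shift a ^ (p - 1)) (e := T.even.baseChange R)
    (o := T.odd.baseChange R) ?_ ?_ ?_ ?_ ?_ ?_ ?_ ?_ ?_ ?_ ?_ ?_
  · exact T.shift_D a
  · exact (T.shift_D a).pow_left _
  · exact T.shift_even a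
  · exact T.shift_odd a
  · exact (T.shift_even a).pow_left _
  · exact (T.shift_odd a).pow_left _
  · rw [← pow_succ', Nat.sub_add_cancel hp, shift_pow]
  · rw [← pow_succ, Nat.sub_add_cancel hp, shift_pow]
  · rw [← LinearMap.baseChange_mul, even_mul_D, LinearMap.baseChange_mul]
  · rw [← LinearMap.baseChange_mul, odd_mul_D, LinearMap.baseChange_mul]
  · rw [← LinearMap.baseChange_mul, even_mul_odd, LinearMap.baseChange_zero]
  · rw [← LinearMap.baseChange_mul, odd_mul_even, LinearMap.baseChange_zero]

lemma baseChange_mem {M N : Submodule k C} {f : Module.End k C} (hf : ∀ c ∈ M, f c ∈ N)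
    {z : R ⊗[k] C} (hz : z ∈ M.baseChange R) : f.baseChange R z ∈ N.baseChange R := by
  obtain ⟨w, rfl⟩ := hz
  induction w with
  | zero => simp
  | add u v hu hv => rw [map_add, map_add]; exact add_mem hu hv
  | tmul r c => exact Submodule.tmul_mem_baseChange_of_mem r (hf _ c.2)

lemma shift_mem {M : Submodule k C} (hM : ∀ i, ∀ c ∈ M, T.x i c ∈ M) {z : R ⊗[k] C}
    (hz : z ∈ M.baseChange R) : T.shift a z ∈ M.baseChange R := by
  rw [shift, LinearMap.sum_apply]
  exact sum_mem fun i _ => Submodule.smul_mem _ _ (baseChange_mem (hM i) hz)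

lemma shift_pow_mem {M : Submodule k C} (hM : ∀ i, ∀ c ∈ M, T.x i c ∈ M) (n : ℕ)
    {z : R ⊗[k] C} (hz : z ∈ M.baseChange R) : (T.shift a ^ n) z ∈ M.baseChange R := by
  induction n with
  | zero => simpa using hz
  | succ n ih =>
    rw [pow_succ', Module.End.mul_apply]
    exact T.shift_mem a hM ih

lemma pert₀_mem {M : Submodule k C} (hM : ∀ i, ∀ c ∈ M, T.x i c ∈ M)
    (hm : ∀ φ, ∀ c ∈ M, T.m φ c ∈ M) {z : R ⊗[k] C} (hz : z ∈ M.baseChange R) :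
    T.pert₀ a z ∈ M.baseChange R :=
  sub_mem (T.shift_mem a hM (baseChange_mem (hm _) hz))
    (T.shift_pow_mem a hM _ (baseChange_mem (hm _) hz))

lemma pert₁_mem {M : Submodule k C} (hM : ∀ i, ∀ c ∈ M, T.x i c ∈ M)
    (hm : ∀ φ, ∀ c ∈ M, T.m φ c ∈ M) {z : R ⊗[k] C} (hz : z ∈ M.baseChange R) :
    T.pert₁ a z ∈ M.baseChange R :=
  sub_mem (T.shift_pow_mem a hM _ (baseChange_mem (hm _) hz))
    (T.shift_mem a hM (baseChange_mem (hm _) hz))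

lemma exists_mem_Fil_baseChange (z : R ⊗[k] C) : ∃ n, z ∈ (T.Fil n).baseChange R := by
  induction z with
  | zero => exact ⟨0, zero_mem _⟩
  | tmul r c =>
    obtain ⟨n, hn⟩ := T.exists_mem_Fil c
    exact ⟨n, Submodule.tmul_mem_baseChange_of_mem r hn⟩
  | add u v hu hv =>
    obtain ⟨n, hn⟩ := hu
    obtain ⟨l, hl⟩ := hv
    exact ⟨max n l, add_mem (Submodule.baseChange_mono R (T.Fil_mono (le_max_left _ _)) hn)
      (Submodule.baseChange_mono R (T.Fil_mono (le_max_right _ _)) hl)⟩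

lemma Fil_baseChange_mono : Monotone fun n => (T.Fil n).baseChange R :=
  fun _ _ h => Submodule.baseChange_mono R (T.Fil_mono h)

variable {h : Module.End k C} (hh : T.IsSplitting h)

namespace IsSplitting
include hh

lemma mem_Fil {n : ℕ} {c : C} (hc : c ∈ T.Fil (n + 1)) : h c ∈ T.Fil n := by
  rw [Fil, LinearMap.mem_ker] at hc ⊢
  have : ind k (fun i => n ≤ i) = fun i => ind k (fun i => n + 1 ≤ i) (i + 1) := by
    ext i; simp [ind]
  rw [this, ← Module.End.mul_apply, ← hh.h_m, Module.End.mul_apply, hc, map_zero]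

lemma mul_mem_Fil {t : Module.End R (R ⊗[k] C)}
    (ht : ∀ n, ∀ z ∈ (T.Fil n).baseChange R, t z ∈ (T.Fil n).baseChange R) (n : ℕ)
    (z : R ⊗[k] C) (hz : z ∈ (T.Fil (n + 1)).baseChange R) :
    (h.baseChange R * t) z ∈ (T.Fil n).baseChange R :=
  baseChange_mem (fun _ => hh.mem_Fil) (ht _ z hz)

lemma isUnit {t : Module.End R (R ⊗[k] C)}
    (ht : ∀ n, ∀ z ∈ (T.Fil n).baseChange R, t z ∈ (T.Fil n).baseChange R) :
    IsUnit (1 + h.baseChange R * t) :=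
  isUnit_one_add_of_filtered (F := fun n => (T.Fil n).baseChange R)
    (by simp [Fil_zero]) T.exists_mem_Fil_baseChange (hh.mul_mem_Fil T ht)

end IsSplitting

lemma pert₀_mem_Fil (n : ℕ) (z : R ⊗[k] C) (hz : z ∈ (T.Fil n).baseChange R) :
    T.pert₀ a z ∈ (T.Fil n).baseChange R :=
  T.pert₀_mem a (fun i _ => T.x_mem_Fil i) (fun φ _ => T.m_mem_Fil φ) hz

lemma pert₁_mem_Fil (n : ℕ) (z : R ⊗[k] C) (hz : z ∈ (T.Fil n).baseChange R) :
    T.pert₁ a z ∈ (T.Fil n).baseChange R :=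
  T.pert₁_mem a (fun i _ => T.x_mem_Fil i) (fun φ _ => T.m_mem_Fil φ) hz

/-- The inverse of `1 + h * t`, when it exists. -/
noncomputable def inv (h : Module.End k C) (t : Module.End R (R ⊗[k] C)) :
    Module.End R (R ⊗[k] C) := Ring.inverse (1 + h.baseChange R * t)

include hh in
lemma perturbationData [Fact p.Prime] [CharP k p] :
    PerturbationData (T.D.baseChange R) (h.baseChange R) (T.pert₀ a) (T.pert₁ a)
      (inv h (T.pert₀ a)) (inv h (T.pert₁ a)) where
  hh := by rw [← LinearMap.baseChange_mul, hh.hh, LinearMap.baseChange_zero]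
  DD := by rw [← LinearMap.baseChange_mul, T.D_sq, LinearMap.baseChange_zero]
  DhD := by rw [← LinearMap.baseChange_mul, ← LinearMap.baseChange_mul, hh.DhD]
  hDh := by rw [← LinearMap.baseChange_mul, ← LinearMap.baseChange_mul, hh.hDh]
  D_t₀ := (T.pert_relations a).1
  D_t₁ := (T.pert_relations a).2.1
  t₁_t₀ := (T.pert_relations a).2.2.1
  t₀_t₁ := (T.pert_relations a).2.2.2
  left₀ := Ring.inverse_mul_cancel _ (hh.isUnit T (T.pert₀_mem_Fil a))
  right₀ := Ring.mul_inverse_cancel _ (hh.isUnit T (T.pert₀_mem_Fil a))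
  left₁ := Ring.inverse_mul_cancel _ (hh.isUnit T (T.pert₁_mem_Fil a))
  right₁ := Ring.mul_inverse_cancel _ (hh.isUnit T (T.pert₁_mem_Fil a))

end BaseChange

end TComplex

end

section

open TensorProduct

lemma exists_pow_not_mem {k E : Type*} [Field k] [AddCommGroup E] [Module k E] {V : Submodule k E}
    {y : Module.End k E} {p : ℕ} (hy : y ^ p = 0) {u : E} (hu : u ∉ V) :
    ∃ s, (y ^ s) u ∉ V ∧ y ((y ^ s) u) ∈ V := by
  classical
  have hex : ∃ s, (y ^ s) u ∈ V := ⟨p, by simp [hy]⟩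
  obtain ⟨s, hs⟩ : ∃ s, Nat.find hex = s + 1 := by
    refine Nat.exists_eq_succ_of_ne_zero fun h => hu ?_
    simpa [h] using Nat.find_spec hex
  refine ⟨s, Nat.find_min hex (by omega), ?_⟩
  have := Nat.find_spec hex
  rwa [hs, pow_succ', Module.End.mul_apply] at this

namespace TComplex

variable {k : Type} [Field k] {p : ℕ} {C : Type} [AddCommGroup C] [Module k C]
  (T : TComplex k p C) {h : Module.End k C}

/-- A basis of the space of harmonic elements, adapted to the grading and to the action. -/
structure Frame (h : Module.End k C) (r : ℕ) where
  v : Fin r → C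
  lam : Fin r → C →ₗ[k] k
  harm_eq : ∀ c, harm T.D h c = ∑ j, lam j c • v j
  lam_v : ∀ i j, lam i (v j) = if i = j then 1 else 0
  lam_harm : ∀ i c, lam i (harm T.D h c) = lam i c
  harm_v : ∀ j, harm T.D h (v j) = v j
  homogeneous : ∀ j, ∃ q, T.m (Pi.single q 1) (v j) = v j ∧
    ∀ c ∈ T.Fil q, ∀ i, j ≤ i → lam i c = 0
  lam_x : ∀ l i j, j ≤ i → lam i (T.x l (v j)) = 0

namespace IsSplitting

variable {T} (hh : T.IsSplitting h)
include hh

lemma data : PerturbationData T.D h 0 0 1 1 :=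
  ⟨hh.hh, T.D_sq, hh.DhD, hh.hDh, by simp, by simp, by simp, by simp, by simp, by simp, by simp,
    by simp⟩

lemma harm_m (φ : ℕ → k) : harm T.D h * T.m φ = T.m φ * harm T.D h := by
  have h1 := hh.h_m φ
  have h2 := T.m_D φ
  obtain ⟨ψ, rfl⟩ : ∃ ψ : ℕ → k, φ = fun n => ψ (n + 1) :=
    ⟨fun n => φ (n - 1), by simp⟩
  have h3 := hh.h_m ψ
  have h4 := T.m_D ψ
  calc harm T.D h * T.m (fun n => ψ (n + 1)) = T.m (fun n => ψ (n + 1)) -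
        T.D * (h * T.m (fun n => ψ (n + 1))) - h * (T.D * T.m (fun n => ψ (n + 1))) := by
        simp only [harm]; noncomm_ring
    _ = T.m (fun n => ψ (n + 1)) - (T.D * T.m (fun n => ψ (n + 1 + 1))) * h -
        (h * T.m ψ) * T.D := by
        rw [h1, ← h4]; noncomm_ring
    _ = _ := by rw [h3, ← h2]; simp only [harm]; noncomm_ring

lemma harm_x_harm (l : Fin 3) {c : C} (hc : T.D c = 0) :
    harm T.D h (T.x l (harm T.D h c)) = harm T.D h (T.x l c) := by
  have h1 : harm T.D h c = c - T.D (h c) := by simp [harm, hc]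
  have h2 : T.x l (T.D (h c)) = T.D (T.x l (h c)) := by
    rw [← Module.End.mul_apply, T.x_D, Module.End.mul_apply]
  have h3 (d : C) : harm T.D h (T.D d) = 0 := by
    rw [← Module.End.mul_apply, hh.data.harm_D, LinearMap.zero_apply]
  rw [h1, map_sub, map_sub, h2, h3, sub_zero]

lemma D_harm_apply (c : C) : T.D (harm T.D h c) = 0 := by
  rw [← Module.End.mul_apply, hh.data.D_harm, LinearMap.zero_apply]

lemma harm_harm_apply (c : C) : harm T.D h (harm T.D h c) = harm T.D h c := by
  rw [← Module.End.mul_apply, hh.data.harm_harm]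

/-- The action on harmonic elements. -/
def harmX (_ : T.IsSplitting h) (l : Fin 3) : Module.End k (LinearMap.range (harm T.D h)) :=
  (harm T.D h).rangeRestrict ∘ₗ T.x l ∘ₗ Submodule.subtype _

lemma coe_harmX (l : Fin 3) (w : LinearMap.range (harm T.D h)) :
    (hh.harmX l w : C) = harm T.D h (T.x l w) := rfl

lemma D_coe (w : LinearMap.range (harm T.D h)) : T.D w = 0 := by
  obtain ⟨w, c, rfl⟩ := w
  exact hh.D_harm_apply c

lemma harmX_pow (l : Fin 3) (n : ℕ) (w : LinearMap.range (harm T.D h)) :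
    ((hh.harmX l ^ n) w : C) = harm T.D h ((T.x l ^ n) w) := by
  have hD (n : ℕ) : T.D ((T.x l ^ n) w) = 0 := by
    induction n with
    | zero => simpa using hh.D_coe w
    | succ n ih => rw [pow_succ', Module.End.mul_apply]; exact T.D_x l ih
  induction n with
  | zero =>
    obtain ⟨w, c, rfl⟩ := w
    simp [hh.harm_harm_apply]
  | succ n ih =>
    rw [pow_succ', Module.End.mul_apply, coe_harmX, ih, hh.harm_x_harm l (hD n), pow_succ',
      Module.End.mul_apply]

lemma harmX_comm (l l' : Fin 3) : Commute (hh.harmX l) (hh.harmX l') := by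
  ext w
  simp only [Module.End.mul_apply, coe_harmX]
  rw [hh.harm_x_harm _ (T.D_x _ (hh.D_coe w)), hh.harm_x_harm _ (T.D_x _ (hh.D_coe w)),
    ← Module.End.mul_apply (T.x l), T.x_comm, Module.End.mul_apply]

lemma exists_frame [FiniteDimensional k (LinearMap.range (harm T.D h))] :
    Nonempty (T.Frame h (Module.finrank k (LinearMap.range (harm T.D h)))) := by
  classical
  set E := LinearMap.range (harm T.D h) with hE
  let P : C →ₗ[k] E := (harm T.D h).rangeRestrict
  have hPE (w : E) : P w = w := by
    obtain ⟨w, c, rfl⟩ := w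
    exact Subtype.ext (hh.harm_harm_apply c)
  obtain ⟨b, hb⟩ := exists_basis_of_step (k := k) (E := E)
    (fun V => ∀ w ∈ V, ∀ l, hh.harmX l w ∈ V)
    (fun V w => (∃ q, T.m (Pi.single q 1) w = w ∧ ∀ c ∈ T.Fil q, P c ∈ V) ∧
      ∀ l, hh.harmX l w ∈ V) (by simp) (by
    intro V hV hne
    have hex : ∃ n, ∃ c ∈ T.Fil n, P c ∉ V := by
      by_contra! hcon
      refine hne (Submodule.eq_top_iff'.2 fun w => ?_)
      obtain ⟨n, hn⟩ := T.exists_mem_Fil (w : C)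
      rw [← hPE w]
      exact hcon n _ hn
    obtain ⟨q, hq⟩ : ∃ q, Nat.find hex = q + 1 := by
      refine Nat.exists_eq_succ_of_ne_zero fun h0 => ?_
      obtain ⟨c, hc, hcV⟩ := Nat.find_spec hex
      rw [h0, Fil_zero, Submodule.mem_bot] at hc
      exact hcV (by simp [hc])
    have hlow : ∀ c ∈ T.Fil q, P c ∈ V := by
      intro c hc
      by_contra hcV
      exact Nat.find_min hex (m := q) (by omega) ⟨c, hc, hcV⟩
    obtain ⟨c, hc, hcV⟩ := Nat.find_spec hex
    rw [hq] at hc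
    have hu : P (T.m (Pi.single q 1) c) ∉ V := by
      intro hmem
      apply hcV
      have hs := T.sum_m_single hc
      rw [Finset.sum_range_succ] at hs
      rw [← hs, map_add, map_sum]
      refine add_mem (sum_mem fun i hi => hlow _ ?_) hmem
      rw [Fil, LinearMap.mem_ker, ← Module.End.mul_apply, ← map_mul]
      have : ind k (fun i => q ≤ i) * Pi.single i 1 = 0 := by
        ext j
        by_cases hj : j = i
        · subst hj; simp [ind, Finset.mem_range.1 hi]
        · simp [hj]
      rw [this]
      simp
    have hhom : T.m (Pi.single q 1) (P (T.m (Pi.single q 1) c) : C) =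
        P (T.m (Pi.single q 1) c) := by
      change T.m (Pi.single q 1) (harm T.D h _) = harm T.D h _
      rw [← Module.End.mul_apply, ← hh.harm_m, Module.End.mul_apply, ← Module.End.mul_apply,
        ← Module.End.mul_apply, ← Module.End.mul_apply]
      congr 1
      rw [mul_assoc, ← map_mul, ← Pi.single_mul, one_mul]
    have hhomX (l : Fin 3) (w : E) (hw : T.m (Pi.single q 1) (w : C) = w) :
        T.m (Pi.single q 1) (hh.harmX l w : C) = hh.harmX l w := by
      rw [coe_harmX, ← Module.End.mul_apply, ← hh.harm_m, Module.End.mul_apply,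
        ← Module.End.mul_apply (T.m _), ← T.x_m, Module.End.mul_apply, hw]
    have hhomX' (l : Fin 3) (s : ℕ) (w : E) (hw : T.m (Pi.single q 1) (w : C) = w) :
        T.m (Pi.single q 1) ((hh.harmX l ^ s) w : C) = (hh.harmX l ^ s) w := by
      induction s with
      | zero => simpa using hw
      | succ s ih => rw [pow_succ', Module.End.mul_apply]; exact hhomX l _ ih
    have hVpow (l : Fin 3) (s : ℕ) (w : E) (hw : w ∈ V) : (hh.harmX l ^ s) w ∈ V := by
      induction s with
      | zero => simpa using hw
      | succ s ih => rw [pow_succ', Module.End.mul_apply]; exact hV _ ih l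
    have hpow (l : Fin 3) : hh.harmX l ^ p = 0 := by
      ext w
      rw [hh.harmX_pow, T.x_pow]
      simp
    have hswap (l l' : Fin 3) (s : ℕ) (w : E) : hh.harmX l ((hh.harmX l' ^ s) w) =
        (hh.harmX l' ^ s) (hh.harmX l w) := by
      rw [← Module.End.mul_apply, ((hh.harmX_comm l l').pow_right s).eq, Module.End.mul_apply]
    obtain ⟨s₀, h₀, h₀'⟩ := exists_pow_not_mem (hpow 0) hu
    obtain ⟨s₁, h₁, h₁'⟩ := exists_pow_not_mem (hpow 1) h₀
    obtain ⟨s₂, h₂, h₂'⟩ := exists_pow_not_mem (hpow 2) h₁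
    have hfin : ∀ l, hh.harmX l ((hh.harmX 2 ^ s₂) ((hh.harmX 1 ^ s₁) ((hh.harmX 0 ^ s₀)
        (P (T.m (Pi.single q 1) c))))) ∈ V := by
      intro l
      fin_cases l
      · change hh.harmX 0 _ ∈ V
        rw [hswap, hswap]
        exact hVpow _ _ _ (hVpow _ _ _ h₀')
      · change hh.harmX 1 _ ∈ V
        rw [hswap]
        exact hVpow _ _ _ h₁'
      · exact h₂'
    refine ⟨_, h₂, ⟨⟨q, hhomX' _ _ _ (hhomX' _ _ _ (hhomX' _ _ _ hhom)), hlow⟩, hfin⟩, ?_⟩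
    intro w hw l
    obtain ⟨w₁, hw₁, w₂, hw₂, rfl⟩ := Submodule.mem_sup.1 hw
    obtain ⟨r, rfl⟩ := Submodule.mem_span_singleton.1 hw₂
    rw [map_add, map_smul]
    exact Submodule.mem_sup_left (add_mem (hV _ hw₁ l) (Submodule.smul_mem _ _ (hfin l))))
  have hcoord {i j} (hij : j ≤ i) {w : E} (hw : w ∈ Submodule.span k (b '' Set.Iio j)) :
      b.coord i w = 0 := by
    induction hw using Submodule.span_induction with
    | mem w hw =>
      obtain ⟨l, hl, rfl⟩ := hw
      have : l ≠ i := (lt_of_lt_of_le hl hij).ne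
      simp [this]
    | zero => simp
    | add u v _ _ hu hv => rw [map_add, hu, hv, add_zero]
    | smul r u _ hu => rw [map_smul, hu, smul_zero]
  refine ⟨⟨fun j => b j, fun i => b.coord i ∘ₗ P, ?_, ?_, ?_, ?_, ?_, ?_⟩⟩
  · intro c
    have := congrArg Subtype.val (b.sum_repr (P c))
    rw [Submodule.coe_sum] at this
    exact this.symm
  · intro i j
    simp [hPE, Finsupp.single_apply, eq_comm]
  · intro i c
    have : P (harm T.D h c) = P c := Subtype.ext (hh.harm_harm_apply c)
    simp [this]
  · intro j
    exact congrArg Subtype.val (hPE (b j))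
  · intro j
    obtain ⟨⟨q, hq, hlow⟩, -⟩ := hb j
    exact ⟨q, hq, fun c hc i hij => hcoord hij (hlow c hc)⟩
  · intro l i j hij
    exact hcoord hij ((hb j).2 l)

end IsSplitting

end TComplex

end

section

open TensorProduct

namespace TComplex

variable {k : Type} [Field k] {p : ℕ} {C : Type} [AddCommGroup C] [Module k C]
  {T : TComplex k p C} {h : Module.End k C}

lemma harm_baseChange {R : Type} [CommRing R] [Algebra k R] (D h : Module.End k C) :
    harm (D.baseChange R) (h.baseChange R) = (harm D h).baseChange R := by
  rw [harm, harm, LinearMap.baseChange_sub, LinearMap.baseChange_sub, LinearMap.baseChange_mul,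
    LinearMap.baseChange_mul]
  congr 2
  ext
  simp

namespace Frame

variable {r : ℕ} (F : T.Frame h r)

section

variable (R : Type) [CommRing R] [Algebra k R]

/-- The coordinates of the harmonic part. -/
noncomputable def coord (i : Fin r) : R ⊗[k] C →ₗ[R] R :=
  (AlgebraTensorModule.rid k R R).toLinearMap ∘ₗ (F.lam i).baseChange R

@[simp]
lemma coord_tmul (i : Fin r) (s : R) (c : C) : F.coord R i (s ⊗ₜ c) = F.lam i c • s := by
  simp [coord]

/-- The harmonic element with given coordinates. -/
noncomputable def incl : (Fin r → R) →ₗ[R] R ⊗[k] C :=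
  Fintype.linearCombination R fun j => (1 : R) ⊗ₜ[k] F.v j

lemma incl_apply (w : Fin r → R) : F.incl R w = ∑ j, w j • (1 : R) ⊗ₜ[k] F.v j :=
  Fintype.linearCombination_apply ..

lemma coord_incl (i : Fin r) (w : Fin r → R) : F.coord R i (F.incl R w) = w i := by
  simp [incl_apply, F.lam_v]

lemma incl_coord (z : R ⊗[k] C) : F.incl R (fun i => F.coord R i z) =
    harm (T.D.baseChange R) (h.baseChange R) z := by
  rw [harm_baseChange]
  induction z with
  | zero => simp only [map_zero]; exact map_zero (F.incl R)
  | add u v hu hv =>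
    rw [map_add, ← hu, ← hv]
    simp only [map_add]
    exact map_add (F.incl R) (fun i => F.coord R i u) (fun i => F.coord R i v)
  | tmul s c =>
    rw [incl_apply, LinearMap.baseChange_tmul, F.harm_eq, tmul_sum]
    refine Finset.sum_congr rfl fun j _ => ?_
    rw [coord_tmul, smul_tmul', smul_eq_mul, mul_one, smul_tmul]

lemma harm_incl (w : Fin r → R) :
    harm (T.D.baseChange R) (h.baseChange R) (F.incl R w) = F.incl R w := by
  rw [← incl_coord]
  congr 1
  ext i
  exact F.coord_incl R i w

end

section

variable {R : Type} [CommRing R] [Algebra k R]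

/-- The matrix of the transferred differential. -/
noncomputable def mat (t : Module.End R (R ⊗[k] C)) : Matrix (Fin r) (Fin r) R :=
  Matrix.of fun i j => F.coord R i
    (transferred (T.D.baseChange R) (h.baseChange R) t (inv h t) ((1 : R) ⊗ₜ F.v j))

lemma mat_mulVec (t : Module.End R (R ⊗[k] C)) (w : Fin r → R) :
    (F.mat t).mulVec w = fun i => F.coord R i
      (transferred (T.D.baseChange R) (h.baseChange R) t (inv h t) (F.incl R w)) := by
  ext i
  simp [Matrix.mulVec, dotProduct, mat, incl_apply, mul_comm]

variable {t₀ t₁ : Module.End R (R ⊗[k] C)}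
  (H : PerturbationData (T.D.baseChange R) (h.baseChange R) t₀ t₁ (inv h t₀) (inv h t₁))
include H

lemma incl_mat_mulVec (w : Fin r → R) : F.incl R ((F.mat t₀).mulVec w) =
    transferred (T.D.baseChange R) (h.baseChange R) t₀ (inv h t₀) (F.incl R w) := by
  rw [mat_mulVec, incl_coord, ← Module.End.mul_apply, transferred, ← mul_assoc, ← mul_assoc,
    ← mul_assoc, H.harm_harm]

lemma mat_mul_mat : F.mat t₁ * F.mat t₀ = 0 := by
  refine Matrix.ext_of_mulVec_single fun j => ?_
  rw [← Matrix.mulVec_mulVec, mat_mulVec, F.incl_mat_mulVec H, ← Module.End.mul_apply,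
    H.transferred_sq]
  ext
  simp

lemma exists_mulVec_eq
    (hex : ∀ c, (T.D.baseChange R + t₀) c = 0 → ∃ w, (T.D.baseChange R + t₁) w = c)
    {v : Fin r → R} (hv : (F.mat t₀).mulVec v = 0) : ∃ w, (F.mat t₁).mulVec w = v := by
  obtain ⟨w, hw, hwv⟩ := H.exact hex (F.harm_incl R v)
    (by rw [← F.incl_mat_mulVec H, hv, map_zero])
  refine ⟨fun i => F.coord R i w, ?_⟩
  rw [mat_mulVec, incl_coord, hw, hwv]
  ext i
  exact F.coord_incl R i v

end

section

variable {R : Type} [CommRing R] [Algebra k R]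

lemma mat_zero : F.mat (0 : Module.End R (R ⊗[k] C)) = 0 := by
  ext
  simp [mat, transferred]

variable {K : Type} [CommRing K] [Algebra k K] (f : R →ₐ[k] K)

lemma rTensor_baseChange (g : Module.End k C) (z : R ⊗[k] C) :
    f.toLinearMap.rTensor C (g.baseChange R z) = g.baseChange K (f.toLinearMap.rTensor C z) := by
  induction z with
  | zero => simp
  | add u v hu hv => simp only [map_add, hu, hv]
  | tmul s c => simp

lemma rTensor_smul (s : R) (z : R ⊗[k] C) :
    f.toLinearMap.rTensor C (s • z) = f s • f.toLinearMap.rTensor C z := by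
  induction z with
  | zero => simp
  | add u v hu hv => simp only [smul_add, map_add, hu, hv]
  | tmul s c => simp [smul_tmul']

lemma coord_rTensor (i : Fin r) (z : R ⊗[k] C) :
    F.coord K i (f.toLinearMap.rTensor C z) = f (F.coord R i z) := by
  induction z with
  | zero => simp
  | add u v hu hv => simp only [map_add, hu, hv]
  | tmul s c => simp

variable {a : Fin 3 → R}

lemma rTensor_shift (z : R ⊗[k] C) : f.toLinearMap.rTensor C (T.shift a z) =
    T.shift (fun i => f (a i)) (f.toLinearMap.rTensor C z) := by
  simp only [shift, LinearMap.sum_apply, map_sum, LinearMap.smul_apply, rTensor_smul,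
    rTensor_baseChange]

lemma rTensor_shift_pow (n : ℕ) (z : R ⊗[k] C) : f.toLinearMap.rTensor C ((T.shift a ^ n) z) =
    (T.shift (fun i => f (a i)) ^ n) (f.toLinearMap.rTensor C z) := by
  induction n with
  | zero => simp
  | succ n ih => rw [pow_succ', pow_succ', Module.End.mul_apply, Module.End.mul_apply,
      rTensor_shift, ih]

lemma rTensor_pert₀ (z : R ⊗[k] C) : f.toLinearMap.rTensor C (T.pert₀ a z) =
    T.pert₀ (fun i => f (a i)) (f.toLinearMap.rTensor C z) := by
  simp only [pert₀, LinearMap.sub_apply, Module.End.mul_apply, map_sub, rTensor_shift,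
    rTensor_shift_pow, rTensor_baseChange]

lemma rTensor_pert₁ (z : R ⊗[k] C) : f.toLinearMap.rTensor C (T.pert₁ a z) =
    T.pert₁ (fun i => f (a i)) (f.toLinearMap.rTensor C z) := by
  simp only [pert₁, LinearMap.sub_apply, Module.End.mul_apply, map_sub, rTensor_shift,
    rTensor_shift_pow, rTensor_baseChange]

lemma mat_map {t : Module.End R (R ⊗[k] C)} {t' : Module.End K (K ⊗[k] C)}
    (ht : ∀ z, f.toLinearMap.rTensor C (t z) = t' (f.toLinearMap.rTensor C z))
    (hu : IsUnit (1 + h.baseChange R * t)) (hu' : IsUnit (1 + h.baseChange K * t')) :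
    (F.mat t).map f = F.mat t' := by
  have hinv (z) : f.toLinearMap.rTensor C (inv h t z) = inv h t' (f.toLinearMap.rTensor C z) := by
    have h1 : (1 + h.baseChange R * t) (inv h t z) = z := by
      rw [← Module.End.mul_apply, inv, Ring.mul_inverse_cancel _ hu, Module.End.one_apply]
    have h2 (y) : f.toLinearMap.rTensor C ((1 + h.baseChange R * t) y) =
        (1 + h.baseChange K * t') (f.toLinearMap.rTensor C y) := by
      simp only [LinearMap.add_apply, Module.End.one_apply, Module.End.mul_apply, map_add,
        rTensor_baseChange, ht]
    conv_rhs => rw [← h1, h2, ← Module.End.mul_apply, inv, Ring.inverse_mul_cancel _ hu',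
      Module.End.one_apply]
  ext i j
  simp only [Matrix.map_apply, mat, Matrix.of_apply]
  rw [← coord_rTensor]
  congr 1
  simp only [transferred, harm_baseChange, Module.End.mul_apply, rTensor_baseChange, ht, hinv]
  simp

end

section

variable {R : Type} [CommRing R] [Algebra k R] {a : Fin 3 → R} (hh : T.IsSplitting h)

lemma coord_harm (i : Fin r) (z : R ⊗[k] C) :
    F.coord R i (harm (T.D.baseChange R) (h.baseChange R) z) = F.coord R i z := by
  rw [← incl_coord, coord_incl]

lemma coord_eq_zero {M : Submodule k C} {i : Fin r} (hM : ∀ c ∈ M, F.lam i c = 0)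
    {z : R ⊗[k] C} (hz : z ∈ M.baseChange R) : F.coord R i z = 0 := by
  obtain ⟨w, rfl⟩ := hz
  induction w with
  | zero => simp
  | add u v hu hv => rw [map_add, map_add, hu, hv, add_zero]
  | tmul s c => simp [hM c c.2]

include hh

lemma mat_apply_eq {t : Module.End R (R ⊗[k] C)}
    (ht : ∀ n, ∀ z ∈ (T.Fil n).baseChange R, t z ∈ (T.Fil n).baseChange R)
    {i j : Fin r} (hij : j ≤ i) : F.mat t i j = F.coord R i (t ((1 : R) ⊗ₜ F.v j)) := by
  obtain ⟨q, hq, hlow⟩ := F.homogeneous j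
  set u := inv h t ((1 : R) ⊗ₜ[k] F.v j) with hu
  have h1 : u + (h.baseChange R * t) u = (1 : R) ⊗ₜ[k] F.v j := by
    have : (1 + h.baseChange R * t) u = (1 : R) ⊗ₜ[k] F.v j := by
      rw [hu, ← Module.End.mul_apply, inv, Ring.mul_inverse_cancel _ (hh.isUnit T ht),
        Module.End.one_apply]
    simpa using this
  have hv : F.v j ∈ T.Fil (q + 1) := by
    rw [Fil, LinearMap.mem_ker, T.m_apply_of_homogeneous hq]
    simp [ind]
  have hmem : u ∈ (T.Fil (q + 1)).baseChange R := by
    refine mem_of_one_add_apply_mem (F := fun n => (T.Fil n).baseChange R)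
      (N := h.baseChange R * t) T.Fil_baseChange_mono
      T.exists_mem_Fil_baseChange (hh.mul_mem_Fil T ht) ?_
    have h3 := Submodule.tmul_mem_baseChange_of_mem (1 : R) hv
    rwa [← h1] at h3
  have h2 : transferred (T.D.baseChange R) (h.baseChange R) t (inv h t) ((1 : R) ⊗ₜ F.v j) =
      harm (T.D.baseChange R) (h.baseChange R) (t u) := by
    rw [hu]
    simp only [transferred, Module.End.mul_apply]
    congr 3
    rw [harm_baseChange, LinearMap.baseChange_tmul, F.harm_v]
  change F.coord R i _ = _
  rw [h2, coord_harm, ← h1, map_add, map_add, left_eq_add]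
  exact F.coord_eq_zero (fun c hc => hlow c hc i hij) (ht _ _ (hh.mul_mem_Fil T ht _ _ hmem))

lemma lam_x_of_lam_eq_zero {j : Fin r} {c : C} (hD : T.D c = 0)
    (hc : ∀ i, j ≤ i → F.lam i c = 0) (l : Fin 3) {i : Fin r} (hij : j ≤ i) :
    F.lam i (T.x l c) = 0 := by
  rw [← F.lam_harm, ← hh.harm_x_harm l hD, F.lam_harm, F.harm_eq, map_sum, map_sum]
  refine Finset.sum_eq_zero fun s _ => ?_
  rw [map_smul, map_smul]
  obtain hs | hs := le_or_gt j s
  · rw [hc s hs, zero_smul]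
  · rw [F.lam_x l i s (hs.le.trans hij), smul_zero]

/-- The cocycles whose coordinates of index at least `j` vanish. -/
lemma exists_submodule (j : Fin r) : ∃ M : Submodule k C, (∀ l, ∀ c ∈ M, T.x l c ∈ M) ∧
    (∀ l, T.x l (F.v j) ∈ M) ∧ ∀ i, j ≤ i → ∀ c ∈ M, F.lam i c = 0 := by
  have hv : T.D (F.v j) = 0 := by rw [← F.harm_v]; exact hh.D_harm_apply _
  refine ⟨LinearMap.ker T.D ⊓ ⨅ i : {i // j ≤ i}, LinearMap.ker (F.lam i), ?_, ?_, ?_⟩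
  · rintro l c ⟨h1, h2⟩
    simp only [SetLike.mem_coe, Submodule.mem_iInf, LinearMap.mem_ker, Subtype.forall] at h1 h2
    simp only [Submodule.mem_inf, Submodule.mem_iInf, LinearMap.mem_ker, Subtype.forall]
    exact ⟨T.D_x l h1, fun i hi => F.lam_x_of_lam_eq_zero hh h1 h2 l hi⟩
  · intro l
    simp only [Submodule.mem_inf, Submodule.mem_iInf, LinearMap.mem_ker, Subtype.forall]
    exact ⟨T.D_x l hv, fun i hi => F.lam_x l i j hi⟩
  · rintro i hi c ⟨-, h2⟩
    simp only [SetLike.mem_coe, Submodule.mem_iInf, LinearMap.mem_ker, Subtype.forall] at h2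
    exact h2 i hi

lemma coord_shift_pow (n : ℕ) {i j : Fin r} (hij : j ≤ i) :
    F.coord R i ((T.shift a ^ (n + 1)) ((1 : R) ⊗ₜ F.v j)) = 0 := by
  obtain ⟨M, hM, hM', hlam⟩ := F.exists_submodule hh j
  refine F.coord_eq_zero (hlam i hij) ?_
  rw [pow_succ, Module.End.mul_apply]
  refine T.shift_pow_mem a hM n ?_
  rw [shift, LinearMap.sum_apply]
  exact sum_mem fun l _ => Submodule.smul_mem _ _ (by
    simpa using Submodule.tmul_mem_baseChange_of_mem (1 : R) (hM' l))

lemma coord_shift_mul {i j : Fin r} (hij : j ≤ i) {n : ℕ} (hn : n ≠ 0) (φ : ℕ → k) :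
    F.coord R i ((T.shift a ^ n * (T.m φ).baseChange R) ((1 : R) ⊗ₜ F.v j)) = 0 := by
  obtain ⟨q, hq, -⟩ := F.homogeneous j
  obtain ⟨n, rfl⟩ := Nat.exists_eq_succ_of_ne_zero hn
  rw [Module.End.mul_apply, LinearMap.baseChange_tmul, T.m_apply_of_homogeneous hq, tmul_smul,
    LinearMap.map_smul_of_tower, LinearMap.map_smul_of_tower, F.coord_shift_pow hh n hij,
    smul_zero]

variable [Fact p.Prime]

lemma mat_pert₀_apply {i j : Fin r} (hij : j ≤ i) : F.mat (T.pert₀ a) i j = 0 := by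
  have hp := (Fact.out : p.Prime).two_le
  have h1 := F.coord_shift_mul hh (a := a) hij one_ne_zero (ind k Even)
  rw [pow_one] at h1
  rw [F.mat_apply_eq hh (T.pert₀_mem_Fil a) hij, pert₀, LinearMap.sub_apply, map_sub, even, odd,
    h1, F.coord_shift_mul hh hij (by omega), sub_zero]

lemma mat_pert₁_apply {i j : Fin r} (hij : j ≤ i) : F.mat (T.pert₁ a) i j = 0 := by
  have hp := (Fact.out : p.Prime).two_le
  have h1 := F.coord_shift_mul hh (a := a) hij one_ne_zero (ind k (fun n => ¬ Even n))
  rw [pow_one] at h1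
  rw [F.mat_apply_eq hh (T.pert₁_mem_Fil a) hij, pert₁, LinearMap.sub_apply, map_sub, even, odd,
    h1, F.coord_shift_mul hh hij (by omega), sub_zero]

end

end Frame

section

variable [Fact p.Prime] {R : Type} [CommRing R] [Algebra k R]

lemma pert₀_zero (T : TComplex k p C) : T.pert₀ (0 : Fin 3 → R) = 0 := by
  have hp := (Fact.out : p.Prime).two_le
  have : p - 1 ≠ 0 := by omega
  have hs : T.shift (0 : Fin 3 → R) = 0 := by simp [shift]
  rw [pert₀, hs, zero_pow this, zero_mul, zero_mul]
  exact sub_zero (0 : Module.End R (R ⊗[k] C))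

lemma pert₁_zero (T : TComplex k p C) : T.pert₁ (0 : Fin 3 → R) = 0 := by
  have hp := (Fact.out : p.Prime).two_le
  have : p - 1 ≠ 0 := by omega
  have hs : T.shift (0 : Fin 3 → R) = 0 := by simp [shift]
  rw [pert₁, hs, zero_pow this, zero_mul, zero_mul]
  exact sub_zero (0 : Module.End R (R ⊗[k] C))

end

open MvPolynomial in
/-- A complex with an action of `(ℤ/p)³` whose cohomology has dimension between `1` and `4` is
not acyclic for all shifted cyclic subgroups. -/
theorem false_of_acyclic [Fact p.Prime] [CharP k p] (T : TComplex k p C) {ι : Type} [Fintype ι]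
    (hι : Fintype.card ι ≤ 4) (z : ι → C)
    (hz : ∀ c, T.D c = 0 → ∃ l : ι → k, ∃ w, c = ∑ i, l i • z i + T.D w)
    (hne : ∃ c, T.D c = 0 ∧ ∀ w, T.D w ≠ c)
    (hac : ∀ (K : Type) [Field K] [Algebra k K] (a : Fin 3 → K), a ≠ 0 → T.Acyclic a) :
    False := by
  obtain ⟨h, hh⟩ := T.exists_isSplitting
  have hspan : LinearMap.range (harm T.D h) ≤
      Submodule.span k (Set.range fun i => harm T.D h (z i)) := by
    rintro _ ⟨c, rfl⟩
    obtain ⟨l, w, hw⟩ := hz _ (hh.D_harm_apply c)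
    rw [← hh.harm_harm_apply c, hw, map_add, ← Module.End.mul_apply, hh.data.harm_D,
      LinearMap.zero_apply, add_zero, map_sum]
    refine sum_mem fun i _ => ?_
    rw [map_smul]
    exact Submodule.smul_mem _ _ (Submodule.subset_span ⟨i, rfl⟩)
  have : FiniteDimensional k (Submodule.span k (Set.range fun i => harm T.D h (z i))) :=
    FiniteDimensional.span_of_finite k (Set.finite_range _)
  have : FiniteDimensional k (LinearMap.range (harm T.D h)) :=
    Submodule.finiteDimensional_of_le hspan
  have hr4 : Module.finrank k (LinearMap.range (harm T.D h)) ≤ 4 :=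
    ((Submodule.finrank_mono hspan).trans (finrank_range_le_card _)).trans hι
  have hr1 : 1 ≤ Module.finrank k (LinearMap.range (harm T.D h)) := by
    rw [Nat.one_le_iff_ne_zero]
    intro h0
    rw [Submodule.finrank_eq_zero] at h0
    obtain ⟨c, hc, hcw⟩ := hne
    apply hcw (h c)
    have : harm T.D h c = 0 := by
      rw [← Submodule.mem_bot k, ← h0]
      exact ⟨c, rfl⟩
    simp only [harm, LinearMap.sub_apply, Module.End.one_apply, Module.End.mul_apply, hc, map_zero,
      sub_zero] at this
    exact (sub_eq_zero.1 this).symm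
  obtain ⟨F⟩ := hh.exists_frame
  have hm₀ (K : Type) [CommRing K] [Algebra k K] (a : Fin 3 → K) :
      (F.mat (T.pert₀ (X : Fin 3 → MvPolynomial (Fin 3) k))).map (aeval a) =
        F.mat (T.pert₀ a) := by
    refine F.mat_map (aeval a) (fun z => ?_) (hh.isUnit T (T.pert₀_mem_Fil _))
      (hh.isUnit T (T.pert₀_mem_Fil _))
    rw [Frame.rTensor_pert₀]
    simp
  have hm₁ (K : Type) [CommRing K] [Algebra k K] (a : Fin 3 → K) :
      (F.mat (T.pert₁ (X : Fin 3 → MvPolynomial (Fin 3) k))).map (aeval a) =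
        F.mat (T.pert₁ a) := by
    refine F.mat_map (aeval a) (fun z => ?_) (hh.isUnit T (T.pert₁_mem_Fil _))
      (hh.isUnit T (T.pert₁_mem_Fil _))
    rw [Frame.rTensor_pert₁]
    simp
  refine false_of_exactOffZero hr1 hr4 (d := F.mat (T.pert₀ (X : Fin 3 → MvPolynomial (Fin 3) k)))
    (e := F.mat (T.pert₁ (X : Fin 3 → MvPolynomial (Fin 3) k)))
    (fun i j => F.mat_pert₀_apply hh) (fun i j => F.mat_pert₁_apply hh) (fun i j => ?_)
    (fun i j => ?_) ?_ ?_ ?_ ?_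
  · have := congrFun (congrFun (hm₀ k 0) i) j
    rwa [pert₀_zero, F.mat_zero] at this
  · have := congrFun (congrFun (hm₁ k 0) i) j
    rwa [pert₁_zero, F.mat_zero] at this
  · exact F.mat_mul_mat (T.perturbationData _ hh).symm
  · exact F.mat_mul_mat (T.perturbationData _ hh)
  · intro K _ _ a ha v hv
    rw [hm₀] at hv
    rw [hm₁]
    exact F.exists_mulVec_eq (T.perturbationData a hh) (hac K a ha).1 hv
  · intro K _ _ a ha v hv
    rw [hm₁] at hv
    rw [hm₀]
    exact F.exists_mulVec_eq (T.perturbationData a hh).symm (hac K a ha).2 hv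

end TComplex

end

section

open Topology

section Cochain

variable {k : Type} [Field k] {X Y W : Type}

/-- The alternating coboundary of a function of finite sequences. -/
def alternatingSum (f : List X → k) : List X → k
  | [] => 0
  | x :: l => f l - alternatingSum (fun l => f (x :: l)) l

lemma alternatingSum_add (f g : List X → k) (l : List X) :
    alternatingSum (f + g) l = alternatingSum f l + alternatingSum g l := by
  induction l generalizing f g with
  | nil => simp [alternatingSum]
  | cons x l ih =>
    have := ih (fun l => f (x :: l)) (fun l => g (x :: l))
    simp only [alternatingSum, Pi.add_apply]
    change f l + g l - alternatingSum ((fun l => f (x :: l)) + fun l => g (x :: l)) l = _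
    rw [this]
    ring

lemma alternatingSum_smul (r : k) (f : List X → k) (l : List X) :
    alternatingSum (r • f) l = r * alternatingSum f l := by
  induction l generalizing f with
  | nil => simp [alternatingSum]
  | cons x l ih =>
    have := ih (fun l => f (x :: l))
    simp only [alternatingSum, Pi.smul_apply]
    change r • f l - alternatingSum (r • (fun l => f (x :: l))) l = _
    rw [this, smul_eq_mul]
    ring

lemma alternatingSum_sub (f g : List X → k) (l : List X) :
    alternatingSum (f - g) l = alternatingSum f l - alternatingSum g l := by
  rw [sub_eq_add_neg, ← neg_one_smul k g, alternatingSum_add, alternatingSum_smul]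
  ring

lemma alternatingSum_alternatingSum (f : List X → k) (l : List X) :
    alternatingSum (alternatingSum f) l = 0 := by
  induction l generalizing f with
  | nil => rfl
  | cons x l ih =>
    have h : (fun l => alternatingSum f (x :: l)) =
        f - alternatingSum (fun l => f (x :: l)) := rfl
    rw [alternatingSum, h, alternatingSum_sub, ih]
    ring

lemma alternatingSum_map (u : X → Y) (f : List Y → k) (l : List X) :
    alternatingSum (fun l => f (l.map u)) l = alternatingSum f (l.map u) := by
  induction l generalizing f with
  | nil => rfl
  | cons x l ih =>
    have := ih fun l => f (u x :: l)
    simp only [alternatingSum, List.map_cons, this]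

lemma alternatingSum_eq_zero {f : List X → k} {U : Set X}
    (hf : ∀ l, (∀ x ∈ l, x ∈ U) → f l = 0) (l : List X) (hl : ∀ x ∈ l, x ∈ U) :
    alternatingSum f l = 0 := by
  induction l generalizing f with
  | nil => rfl
  | cons x l ih =>
    rw [List.forall_mem_cons] at hl
    rw [alternatingSum, hf l hl.2, ih (fun l' hl' => hf _ (List.forall_mem_cons.2 ⟨hl.1, hl'⟩))
      hl.2, sub_zero]

lemma alternatingSum_of_length {f : List X → k} {n : ℕ} (hf : ∀ l, n ≤ l.length → f l = 0)
    (l : List X) (hl : n + 1 ≤ l.length) : alternatingSum f l = 0 := by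
  induction l generalizing f n with
  | nil => rfl
  | cons x l ih =>
    simp only [List.length_cons] at hl
    rw [alternatingSum, hf l (by omega), zero_sub, neg_eq_zero]
    cases l with
    | nil => rfl
    | cons y l =>
      simp only [List.length_cons] at hl
      exact ih (n := n - 1) (fun l' hl' => hf _ (by simp only [List.length_cons]; omega))
        (by simp only [List.length_cons]; omega)

lemma alternatingSum_length_mul (φ : ℕ → k) (f : List X → k) (l : List X) :
    alternatingSum (fun l => φ (l.length + 1) * f l) l = φ l.length * alternatingSum f l := by
  induction l generalizing f φ with
  | nil => simp [alternatingSum]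
  | cons x l ih =>
    have := ih (fun n => φ (n + 1)) fun l => f (x :: l)
    simp only [alternatingSum, List.length_cons, this]
    ring

/-- The prism operator of two maps. -/
def prismSum (u v : X → Y) (f : List Y → k) : List X → k
  | [] => 0
  | x :: l => f (u x :: v x :: l.map v) - prismSum u v (fun l => f (u x :: l)) l

lemma prismSum_add (u v : X → Y) (f g : List Y → k) (l : List X) :
    prismSum u v (f + g) l = prismSum u v f l + prismSum u v g l := by
  induction l generalizing f g with
  | nil => simp [prismSum]
  | cons x l ih =>
    have := ih (fun l => f (u x :: l)) (fun l => g (u x :: l))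
    simp only [prismSum, Pi.add_apply]
    change f _ + g _ - prismSum u v ((fun l => f (u x :: l)) + fun l => g (u x :: l)) l = _
    rw [this]
    ring

lemma prismSum_smul (u v : X → Y) (r : k) (f : List Y → k) (l : List X) :
    prismSum u v (r • f) l = r * prismSum u v f l := by
  induction l generalizing f with
  | nil => simp [prismSum]
  | cons x l ih =>
    have := ih (fun l => f (u x :: l))
    simp only [prismSum, Pi.smul_apply]
    change r • f _ - prismSum u v (r • (fun l => f (u x :: l))) l = _
    rw [this, smul_eq_mul]
    ring

lemma prismSum_sub (u v : X → Y) (f g : List Y → k) (l : List X) :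
    prismSum u v (f - g) l = prismSum u v f l - prismSum u v g l := by
  rw [sub_eq_add_neg, ← neg_one_smul k g, prismSum_add, prismSum_smul]
  ring

lemma prismSum_homotopy (u v : X → Y) (f : List Y → k) (l : List X) :
    alternatingSum (prismSum u v f) l + prismSum u v (alternatingSum f) l =
      f (l.map v) - f (l.map u) := by
  induction l generalizing f with
  | nil => simp [alternatingSum, prismSum]
  | cons x l ih =>
    have h1 : alternatingSum (fun l => prismSum u v f (x :: l)) l =
        alternatingSum (fun l => f (u x :: v x :: l)) (l.map v) -
          alternatingSum (prismSum u v (fun l => f (u x :: l))) l := by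
      rw [← alternatingSum_map, ← alternatingSum_sub]
      rfl
    have h2 : prismSum u v (fun l => alternatingSum f (u x :: l)) l =
        prismSum u v f l - prismSum u v (alternatingSum (fun l => f (u x :: l))) l := by
      rw [← prismSum_sub]
      rfl
    have h4 := ih fun l => f (u x :: l)
    rw [alternatingSum, prismSum, h1, h2]
    simp only [alternatingSum, List.map_cons]
    linear_combination h4

lemma prismSum_eq_zero {u v : X → Y} {f : List Y → k} {U : Set X} {V : Set Y}
    (hu : ∀ x ∈ U, u x ∈ V) (hv : ∀ x ∈ U, v x ∈ V)
    (hf : ∀ l, (∀ x ∈ l, x ∈ V) → f l = 0) (l : List X) (hl : ∀ x ∈ l, x ∈ U) :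
    prismSum u v f l = 0 := by
  induction l generalizing f with
  | nil => rfl
  | cons x l ih =>
    rw [List.forall_mem_cons] at hl
    rw [prismSum, ih (fun l' hl' => hf _ (List.forall_mem_cons.2 ⟨hu x hl.1, hl'⟩)) hl.2,
      sub_zero]
    apply hf
    simp only [List.mem_cons, List.mem_map, forall_eq_or_imp]
    refine ⟨hu x hl.1, hv x hl.1, ?_⟩
    rintro _ ⟨y, hy, rfl⟩
    exact hv y (hl.2 y hy)

lemma prismSum_of_length {u v : X → Y} {f : List Y → k} {n : ℕ}
    (hf : ∀ l, n ≤ l.length → f l = 0) (l : List X) (hl : n ≤ l.length) :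
    prismSum u v f l = 0 := by
  induction l generalizing f n with
  | nil => rfl
  | cons x l ih =>
    simp only [List.length_cons] at hl
    rw [prismSum, hf _ (by simp only [List.length_cons, List.length_map]; omega), zero_sub,
      neg_eq_zero]
    exact ih (n := n - 1) (fun l' hl' => hf _ (by simp only [List.length_cons]; omega))
      (by omega)

variable (k X) in
/-- Alexander--Spanier cochains of bounded degree, before passing to germs at the diagonal. A
cochain of degree `n` is a function of sequences of length `n + 1`. -/
def Cochain : Submodule k (List X → k) where
  carrier := {f | f [] = 0 ∧ ∃ n, ∀ l, n ≤ l.length → f l = 0}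
  add_mem' := by
    rintro f g ⟨hf, n, hn⟩ ⟨hg, m, hm⟩
    refine ⟨by simp [hf, hg], max n m, fun l hl => ?_⟩
    simp [hn l (le_of_max_le_left hl), hm l (le_of_max_le_right hl)]
  zero_mem' := ⟨rfl, 0, fun _ _ => rfl⟩
  smul_mem' := by
    rintro r f ⟨hf, n, hn⟩
    exact ⟨by simp [hf], n, fun l hl => by simp [hn l hl]⟩

namespace Cochain

variable (k X) in
/-- The coboundary. -/
def d : Module.End k (Cochain k X) where
  toFun f := ⟨alternatingSum f.1, rfl, by
    obtain ⟨n, hn⟩ := f.2.2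
    exact ⟨n + 1, alternatingSum_of_length hn⟩⟩
  map_add' f g := Subtype.ext (funext (alternatingSum_add f.1 g.1))
  map_smul' r f := Subtype.ext (funext (alternatingSum_smul r f.1))

lemma d_d (f : Cochain k X) : d k X (d k X f) = 0 :=
  Subtype.ext (funext (alternatingSum_alternatingSum f.1))

variable (k) in
/-- The pullback of cochains along a map. -/
def pullback (u : X → Y) : Cochain k Y →ₗ[k] Cochain k X where
  toFun f := ⟨fun l => f.1 (l.map u), f.2.1, by
    obtain ⟨n, hn⟩ := f.2.2
    exact ⟨n, fun l hl => hn _ (by simpa)⟩⟩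
  map_add' _ _ := rfl
  map_smul' _ _ := rfl

lemma d_pullback (u : X → Y) (f : Cochain k Y) :
    d k X (pullback k u f) = pullback k u (d k Y f) :=
  Subtype.ext (funext (alternatingSum_map u f.1))

lemma pullback_pullback (u : X → Y) (v : Y → W) (f : Cochain k W) :
    pullback k u (pullback k v f) = pullback k (v ∘ u) f :=
  Subtype.ext (funext fun _ => congrArg f.1 List.map_map)

lemma pullback_id (f : Cochain k X) : pullback k id f = f :=
  Subtype.ext (funext fun _ => congrArg f.1 (List.map_id _))

variable (k) in
/-- The prism operator. -/
def prism (u v : X → Y) : Cochain k Y →ₗ[k] Cochain k X where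
  toFun f := ⟨prismSum u v f.1, rfl, by
    obtain ⟨n, hn⟩ := f.2.2
    exact ⟨n, prismSum_of_length hn⟩⟩
  map_add' f g := Subtype.ext (funext (prismSum_add u v f.1 g.1))
  map_smul' r f := Subtype.ext (funext (prismSum_smul u v r f.1))

lemma d_prism (u v : X → Y) (f : Cochain k Y) :
    d k X (prism k u v f) + prism k u v (d k Y f) = pullback k v f - pullback k u f :=
  Subtype.ext (funext (prismSum_homotopy u v f.1))

variable [TopologicalSpace X] [TopologicalSpace Y] [TopologicalSpace W]

variable (k) in
/-- The cochains vanishing on small sequences near the points of `A`. -/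
def null (A : Set X) : Submodule k (Cochain k X) where
  carrier := {f | ∀ a ∈ A, ∃ U ∈ 𝓝 a, ∀ l, (∀ x ∈ l, x ∈ U) → f.1 l = 0}
  add_mem' := by
    intro f g hf hg a ha
    obtain ⟨U, hU, hfU⟩ := hf a ha
    obtain ⟨V, hV, hgV⟩ := hg a ha
    refine ⟨U ∩ V, Filter.inter_mem hU hV, fun l hl => ?_⟩
    change f.1 l + g.1 l = 0
    rw [hfU l fun x hx => (hl x hx).1, hgV l fun x hx => (hl x hx).2, add_zero]
  zero_mem' := fun a _ => ⟨Set.univ, Filter.univ_mem, fun _ _ => rfl⟩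
  smul_mem' := by
    intro r f hf a ha
    obtain ⟨U, hU, hfU⟩ := hf a ha
    refine ⟨U, hU, fun l hl => ?_⟩
    change r * f.1 l = 0
    rw [hfU l hl, mul_zero]

lemma mem_null_open {A : Set X} {f : Cochain k X} : f ∈ null k A ↔
    ∀ a ∈ A, ∃ U, IsOpen U ∧ a ∈ U ∧ ∀ l, (∀ x ∈ l, x ∈ U) → f.1 l = 0 := by
  refine ⟨fun hf a ha => ?_, fun hf a ha => ?_⟩
  · obtain ⟨U, hU, hfU⟩ := hf a ha
    obtain ⟨V, hVU, hV, haV⟩ := mem_nhds_iff.1 hU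
    exact ⟨V, hV, haV, fun l hl => hfU l fun x hx => hVU (hl x hx)⟩
  · obtain ⟨U, hU, haU, hfU⟩ := hf a ha
    exact ⟨U, hU.mem_nhds haU, hfU⟩

lemma null_anti {A B : Set X} (h : A ⊆ B) : null k B ≤ null k A := fun _ hf a ha => hf a (h ha)

lemma mem_null_union {A B : Set X} {f : Cochain k X} (hA : f ∈ null k A) (hB : f ∈ null k B) :
    f ∈ null k (A ∪ B) := fun a ha => ha.elim (hA a) (hB a)

lemma d_mem_null {A : Set X} {f : Cochain k X} (hf : f ∈ null k A) : d k X f ∈ null k A := by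
  intro a ha
  obtain ⟨U, hU, hfU⟩ := hf a ha
  exact ⟨U, hU, alternatingSum_eq_zero hfU⟩

lemma pullback_mem_null {A : Set X} {B : Set Y} {u : X → Y} (hu : ∀ a ∈ A, ContinuousAt u a)
    (huB : ∀ a ∈ A, u a ∈ B) {f : Cochain k Y} (hf : f ∈ null k B) :
    pullback k u f ∈ null k A := by
  intro a ha
  obtain ⟨V, hV, hfV⟩ := hf _ (huB a ha)
  refine ⟨u ⁻¹' V, hu a ha hV, fun l hl => hfV _ fun y hy => ?_⟩
  obtain ⟨x, hx, rfl⟩ := List.mem_map.1 hy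
  exact hl x hx

variable (k) in
/-- The cocycles of germs along `A`. -/
def cocycles (A : Set X) : Submodule k (Cochain k X) := (null k A).comap (d k X)

variable (k) in
/-- The cochains whose germ along `A` is a coboundary. -/
def coboundaries (A : Set X) : Submodule k (Cochain k X) := null k A ⊔ LinearMap.range (d k X)

lemma mem_cocycles {A : Set X} {f : Cochain k X} : f ∈ cocycles k A ↔ d k X f ∈ null k A :=
  Iff.rfl

lemma mem_coboundaries {A : Set X} {f : Cochain k X} :
    f ∈ coboundaries k A ↔ ∃ w, f - d k X w ∈ null k A := by
  rw [coboundaries, Submodule.mem_sup]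
  constructor
  · rintro ⟨n, hn, _, ⟨w, rfl⟩, rfl⟩
    exact ⟨w, by simpa using hn⟩
  · rintro ⟨w, hw⟩
    exact ⟨_, hw, _, ⟨w, rfl⟩, by simp⟩

lemma d_mem_coboundaries (A : Set X) (f : Cochain k X) : d k X f ∈ coboundaries k A :=
  Submodule.mem_sup_right ⟨f, rfl⟩

lemma cocycles_anti {A B : Set X} (h : A ⊆ B) : cocycles k B ≤ cocycles k A :=
  fun _ hf => null_anti h hf

lemma pullback_mem_cocycles {A : Set X} {B : Set Y} {u : X → Y}
    (hu : ∀ a ∈ A, ContinuousAt u a) (huB : ∀ a ∈ A, u a ∈ B) {f : Cochain k Y}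
    (hf : f ∈ cocycles k B) : pullback k u f ∈ cocycles k A := by
  rw [mem_cocycles, d_pullback]
  exact pullback_mem_null hu huB hf

lemma pullback_mem_coboundaries {A : Set X} {B : Set Y} {u : X → Y}
    (hu : ∀ a ∈ A, ContinuousAt u a) (huB : ∀ a ∈ A, u a ∈ B) {f : Cochain k Y}
    (hf : f ∈ coboundaries k B) : pullback k u f ∈ coboundaries k A := by
  rw [mem_coboundaries] at hf ⊢
  obtain ⟨w, hw⟩ := hf
  exact ⟨pullback k u w, by rw [d_pullback, ← map_sub]; exact pullback_mem_null hu huB hw⟩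

omit [TopologicalSpace Y] in
/-- Close maps induce the same map in cohomology. -/
lemma pullback_sub_mem {A : Set X} {u v : X → Y} {f : Cochain k Y}
    (h : ∀ a ∈ A, ∃ U ∈ 𝓝 a, ∃ V : Set Y, (∀ x ∈ U, u x ∈ V) ∧ (∀ x ∈ U, v x ∈ V) ∧
      ∀ l, (∀ x ∈ l, x ∈ V) → (d k Y f).1 l = 0) :
    pullback k v f - pullback k u f ∈ coboundaries k A := by
  rw [mem_coboundaries]
  refine ⟨prism k u v f, ?_⟩
  rw [← d_prism, add_sub_cancel_left]
  intro a ha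
  obtain ⟨U, hU, V, hu, hv, hV⟩ := h a ha
  exact ⟨U, hU, prismSum_eq_zero hu hv hV⟩

lemma pullback_sub_mem_of_eqOn {A : Set X} {B : Set Y} {u v : X → Y}
    (hu : ∀ a ∈ A, ContinuousAt u a) (hv : ∀ a ∈ A, ContinuousAt v a) (huv : Set.EqOn u v A)
    (huB : ∀ a ∈ A, u a ∈ B) {f : Cochain k Y} (hf : f ∈ cocycles k B) :
    pullback k v f - pullback k u f ∈ coboundaries k A := by
  refine pullback_sub_mem fun a ha => ?_
  obtain ⟨V, hV, hfV⟩ := hf _ (huB a ha)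
  exact ⟨u ⁻¹' V ∩ v ⁻¹' V, Filter.inter_mem (hu a ha hV) (hv a ha (by rwa [← huv ha])), V,
    fun x hx => hx.1, fun x hx => hx.2, hfV⟩

/-- Homotopy invariance. -/
lemma pullback_sub_mem_of_homotopy {A : Set X} (hA : IsCompact A) {B : Set Y} (F : ℝ → X → Y)
    (hF : ∀ t ∈ Set.Icc (0 : ℝ) 1, ∀ a ∈ A, ContinuousAt (Function.uncurry F) (t, a))
    (hFB : ∀ t ∈ Set.Icc (0 : ℝ) 1, ∀ a ∈ A, F t a ∈ B) {f : Cochain k Y}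
    (hf : f ∈ cocycles k B) :
    pullback k (F 1) f - pullback k (F 0) f ∈ coboundaries k A := by
  refine isPreconnected_Icc.induction₂ (s := Set.Icc (0 : ℝ) 1)
    (fun s t => pullback k (F t) f - pullback k (F s) f ∈ coboundaries k A) ?_ ?_ ?_
    (Set.left_mem_Icc.2 zero_le_one) (Set.right_mem_Icc.2 zero_le_one)
  · intro t ht
    have key : ∀ᶠ s in 𝓝 t, ∀ a ∈ A, ∃ U ∈ 𝓝 a, ∃ V : Set Y, (∀ x ∈ U, F t x ∈ V) ∧
        (∀ x ∈ U, F s x ∈ V) ∧ ∀ l, (∀ x ∈ l, x ∈ V) → (d k Y f).1 l = 0 := by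
      refine hA.eventually_forall_of_forall_eventually (x₀ := t) fun a ha => ?_
      obtain ⟨V, hV, hfV⟩ := hf _ (hFB t ht a ha)
      have h1 : Function.uncurry F ⁻¹' V ∈ 𝓝 (t, a) := hF t ht a ha hV
      rw [nhds_prod_eq, Filter.mem_prod_iff] at h1
      obtain ⟨I, hI, U, hU, hIU⟩ := h1
      have h2 : I ×ˢ interior U ∈ 𝓝 (t, a) := prod_mem_nhds hI (interior_mem_nhds.2 hU)
      filter_upwards [h2] with z hz
      exact ⟨interior U, isOpen_interior.mem_nhds hz.2, V,
        fun x hx => hIU (Set.mk_mem_prod (mem_of_mem_nhds hI) (interior_subset hx)),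
        fun x hx => hIU (Set.mk_mem_prod hz.1 (interior_subset hx)), hfV⟩
    filter_upwards [mem_nhdsWithin_of_mem_nhds key] with s hs
    exact pullback_sub_mem hs
  · intro r s t _ _ _ hrs hst
    simpa using add_mem hst hrs
  · intro s t _ _ hst
    rw [← neg_sub]
    exact neg_mem hst

/-- Cochains agreeing near the intersection of two compact sets can be glued. -/
lemma exists_glue [T2Space X] {A B : Set X} (hA : IsCompact A) (hB : IsCompact B)
    {f g : Cochain k X} (hfg : f - g ∈ null k (A ∩ B)) :
    ∃ w, w - f ∈ null k A ∧ w - g ∈ null k B := by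
  classical
  rw [mem_null_open] at hfg
  choose! U hU haU hfU using hfg
  set O := ⋃ a ∈ A ∩ B, U a with hO
  have hOo : IsOpen O := isOpen_biUnion hU
  have hdisj : Disjoint (A \ O) (B \ O) := by
    rw [Set.disjoint_left]
    rintro a ⟨ha, haO⟩ ⟨hb, -⟩
    exact haO (Set.mem_biUnion ⟨ha, hb⟩ (haU a ⟨ha, hb⟩))
  obtain ⟨P, Q, hP, hQ, hAP, hBQ, hPQ⟩ :=
    SeparatedNhds.of_isCompact_isCompact (hA.diff hOo) (hB.diff hOo) hdisj
  let w : List X → k := fun l => if ∃ x ∈ l.head?, x ∈ P then f.1 l else g.1 l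
  have hw : w ∈ Cochain k X := by
    obtain ⟨n, hn⟩ := f.2.2
    obtain ⟨m, hm⟩ := g.2.2
    refine ⟨by simp [w, g.2.1], max n m, fun l hl => ?_⟩
    simp only [w]
    split_ifs
    exacts [hn l (le_of_max_le_left hl), hm l (le_of_max_le_right hl)]
  have hnil : w [] = 0 := hw.1
  refine ⟨⟨w, hw⟩, fun a ha => ?_, fun b hb => ?_⟩
  · by_cases haO : a ∈ O
    · obtain ⟨c, hc, hac⟩ := Set.mem_iUnion₂.1 haO
      refine ⟨U c, (hU c hc).mem_nhds hac, fun l hl => ?_⟩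
      have := hfU c hc l hl
      change w l - f.1 l = 0
      change f.1 l - g.1 l = 0 at this
      simp only [w]
      split_ifs
      · ring
      · linear_combination -this
    · refine ⟨P, hP.mem_nhds (hAP ⟨ha, haO⟩), fun l hl => ?_⟩
      change w l - f.1 l = 0
      cases l with
      | nil => rw [hnil, f.2.1, sub_zero]
      | cons x l => simp [w, hl x]
  · by_cases hbO : b ∈ O
    · obtain ⟨c, hc, hac⟩ := Set.mem_iUnion₂.1 hbO
      refine ⟨U c, (hU c hc).mem_nhds hac, fun l hl => ?_⟩
      have := hfU c hc l hl
      change w l - g.1 l = 0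
      change f.1 l - g.1 l = 0 at this
      simp only [w]
      split_ifs
      · exact this
      · ring
    · refine ⟨Q, hQ.mem_nhds (hBQ ⟨hb, hbO⟩), fun l hl => ?_⟩
      change w l - g.1 l = 0
      cases l with
      | nil => rw [hnil, g.2.1, sub_zero]
      | cons x l =>
        have : x ∉ P := Set.disjoint_right.1 hPQ (hl x List.mem_cons_self)
        simp [w, this]

end Cochain

end Cochain

end

section

open Topology

namespace Cochain

variable {k : Type} [Field k] {X Y : Type} [TopologicalSpace X] [TopologicalSpace Y]
  {ι κ : Type} {A B e : Set X}

/-- The classes of the cochains `v i` generate the cohomology of germs along `A`. -/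
def Generates (A : Set X) (v : ι → Cochain k X) : Prop :=
  (∀ i, v i ∈ cocycles k A) ∧ cocycles k A ≤ Submodule.span k (Set.range v) ⊔ coboundaries k A

/-- The classes of the cochains `v i` generate a subspace of the cohomology of germs along `A`
containing the classes vanishing along `e`. -/
def GeneratesRel (e A : Set X) (v : ι → Cochain k X) : Prop :=
  (∀ i, v i ∈ cocycles k A) ∧
    ∀ u ∈ cocycles k A, u ∈ coboundaries k e → u ∈ Submodule.span k (Set.range v) ⊔ coboundaries k A

lemma Generates.pullback {B : Set Y} {v : ι → Cochain k Y} (hv : Generates B v) {f : X → Y}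
    {g : Y → X} (hf : ∀ a ∈ A, ContinuousAt f a) (hfB : ∀ a ∈ A, f a ∈ B)
    (hg : ∀ b ∈ B, ContinuousAt g b) (hgA : ∀ b ∈ B, g b ∈ A)
    (hgf : ∀ u ∈ cocycles k A, u - pullback k (g ∘ f) u ∈ coboundaries k A) :
    Generates A fun i => pullback k f (v i) := by
  refine ⟨fun i => pullback_mem_cocycles hf hfB (hv.1 i), fun u hu => ?_⟩
  obtain ⟨s, hs, b, hb, hsb⟩ := Submodule.mem_sup.1 (hv.2 (pullback_mem_cocycles hg hgA hu))
  have h1 : u = Cochain.pullback k f s + (Cochain.pullback k f b +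
      (u - Cochain.pullback k (g ∘ f) u)) := by
    rw [← pullback_pullback, ← hsb, map_add]
    abel
  rw [h1]
  refine Submodule.add_mem_sup ?_ (add_mem (pullback_mem_coboundaries hf hfB hb) (hgf u hu))
  have h2 := Submodule.mem_map_of_mem (f := Cochain.pullback k f) hs
  rwa [Submodule.map_span, ← Set.range_comp] at h2

lemma GeneratesRel.generates {v : ι → Cochain k X} {w : κ → Cochain k X}
    (hw : GeneratesRel e A w) (hv : Generates e v) (he : e ⊆ A) {r : X → X}
    (hr : ∀ a ∈ A, ContinuousAt r a) (hre : ∀ a ∈ A, r a ∈ e) (hid : ∀ a ∈ e, r a = a) :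
    Generates A (Sum.elim (fun i => Cochain.pullback k r (v i)) w) := by
  refine ⟨?_, fun u hu => ?_⟩
  · rintro (i | i)
    · exact pullback_mem_cocycles hr hre (hv.1 i)
    · exact hw.1 i
  rw [Set.Sum.elim_range, Submodule.span_union, sup_assoc]
  have h1 : u = pullback k r u + (u - pullback k r u) := by abel
  rw [h1]
  refine add_mem ?_ ?_
  · obtain ⟨s, hs, b, hb, hsb⟩ := Submodule.mem_sup.1 (hv.2 (cocycles_anti he hu))
    rw [← hsb, map_add]
    have h2 := Submodule.mem_map_of_mem (f := Cochain.pullback k r) hs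
    rw [Submodule.map_span, ← Set.range_comp] at h2
    exact add_mem (Submodule.mem_sup_left h2) (Submodule.mem_sup_right
      (Submodule.mem_sup_right (pullback_mem_coboundaries hr hre hb)))
  · refine Submodule.mem_sup_right (hw.2 _ ?_ ?_)
    · exact sub_mem hu (pullback_mem_cocycles hr (fun a ha => he (hre a ha)) hu)
    · have := pullback_sub_mem_of_eqOn (A := e) (B := A) (u := r) (v := id)
        (fun a ha => hr a (he ha)) (fun a _ => continuousAt_id) hid
        (fun a ha => he (hre a (he ha))) hu
      rwa [pullback_id] at this

variable [T2Space X]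

/-- The Mayer--Vietoris step: a union of two sets which can be contracted to `e`. -/
lemma GeneratesRel.exists_union [Fintype ι] {c : ι → Cochain k X} (hc : GeneratesRel e (A ∩ B) c)
    (hA : IsCompact A) (hB : IsCompact B) (he : e ⊆ A ∩ B) {r : X → X}
    (hr : ∀ a ∈ A ∪ B, ContinuousAt r a) (hre : ∀ a ∈ A ∪ B, r a ∈ e) (hid : ∀ a ∈ e, r a = a)
    (hrA : ∀ u ∈ cocycles k A, u - pullback k r u ∈ coboundaries k A)
    (hrB : ∀ u ∈ cocycles k B, u - pullback k r u ∈ coboundaries k B) :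
    ∃ c' : ι → Cochain k X, GeneratesRel e (A ∪ B) c' := by
  have hglue (i : ι) := exists_glue (k := k) hA hB (f := d k X (c i)) (g := 0)
    (by rw [sub_zero]; exact hc.1 i)
  choose c' hc'A hc'B using hglue
  have hAe : A ∩ B ⊆ A ∪ B := Set.inter_subset_left.trans Set.subset_union_left
  refine ⟨c', fun i => ?_, fun u hu hue => ?_⟩
  · refine mem_null_union ?_ ?_
    · simpa [d_d] using d_mem_null (hc'A i)
    · simpa using d_mem_null (hc'B i)
  have hru {D : Set X} (hD : D ⊆ A ∪ B) : pullback k r u ∈ coboundaries k D :=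
    pullback_mem_coboundaries (fun a ha => hr a (hD ha)) (fun a ha => hre a (hD ha)) hue
  have huA := add_mem (hrA u (cocycles_anti Set.subset_union_left hu)) (hru Set.subset_union_left)
  have huB := add_mem (hrB u (cocycles_anti Set.subset_union_right hu))
    (hru Set.subset_union_right)
  rw [sub_add_cancel, mem_coboundaries] at huA huB
  obtain ⟨a, ha⟩ := huA
  obtain ⟨b, hb⟩ := huB
  have hab : a - b ∈ cocycles k (A ∩ B) := by
    have := sub_mem (null_anti Set.inter_subset_right hb) (null_anti Set.inter_subset_left ha)
    rw [mem_cocycles, map_sub]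
    simpa using this
  have hrab : pullback k r (a - b) ∈ cocycles k (A ∪ B) :=
    pullback_mem_cocycles hr (fun x hx => he (hre x hx)) hab
  have hdiff : (a - b) - pullback k r (a - b) ∈ coboundaries k e := by
    have := pullback_sub_mem_of_eqOn (A := e) (B := A ∩ B) (u := r) (v := id)
      (fun a ha => hr a (hAe (he ha))) (fun a _ => continuousAt_id) hid
      (fun a ha => he (hre a (hAe (he ha)))) hab
    rwa [pullback_id] at this
  obtain ⟨s, hs, t, ht, hst⟩ := Submodule.mem_sup.1
    (hc.2 _ (sub_mem hab (cocycles_anti hAe hrab)) hdiff)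
  obtain ⟨l, rfl⟩ := (Submodule.mem_span_range_iff_exists_fun k).1 hs
  obtain ⟨θ, hθ⟩ := mem_coboundaries.1 ht
  obtain ⟨ω, hωA, hωB⟩ := exists_glue (k := k) hA hB
    (f := a - ∑ i, l i • c i - d k X θ) (g := b + pullback k r (a - b)) (by
      have : t - d k X θ = a - ∑ i, l i • c i - d k X θ - (b + pullback k r (a - b)) := by
        rw [eq_sub_iff_add_eq.2 ((add_comm _ _).trans hst)]
        abel
      rwa [← this])
  have hsum : u = ∑ i, l i • c' i + (u - ∑ i, l i • c' i) := by abel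
  rw [hsum]
  refine Submodule.add_mem_sup (Submodule.sum_mem _ fun i _ =>
    Submodule.smul_mem _ _ (Submodule.subset_span ⟨i, rfl⟩)) (mem_coboundaries.2 ⟨ω, ?_⟩)
  refine mem_null_union ?_ ?_
  · have h1 : ∑ i, l i • (c' i - d k X (c i)) ∈ null k A :=
      sum_mem fun i _ => Submodule.smul_mem _ _ (hc'A i)
    have h2 := d_mem_null hωA
    have : u - ∑ i, l i • c' i - d k X ω = (u - d k X a) - ∑ i, l i • (c' i - d k X (c i)) -
        d k X (ω - (a - ∑ i, l i • c i - d k X θ)) := by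
      simp only [map_sub, d_d, map_sum, map_smul, smul_sub, Finset.sum_sub_distrib]
      abel
    rw [this]
    exact sub_mem (sub_mem ha h1) h2
  · have h1 : ∑ i, l i • c' i ∈ null k B :=
      sum_mem fun i _ => Submodule.smul_mem _ _ (by simpa using hc'B i)
    have h2 := d_mem_null hωB
    have h3 := null_anti Set.subset_union_right hrab
    have : u - ∑ i, l i • c' i - d k X ω = (u - d k X b) - ∑ i, l i • c' i -
        d k X (ω - (b + pullback k r (a - b))) - d k X (pullback k r (a - b)) := by
      simp only [map_sub, map_add]
      abel
    rw [this]
    exact sub_mem (sub_mem (sub_mem hb h1) h2) h3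

lemma Generates.exists_union_of_disjoint [Fintype ι] {v : ι → Cochain k X} (hv : Generates B v)
    (hA : IsCompact A) (hB : IsCompact B) (hAB : Disjoint A B) :
    ∃ c : ι → Cochain k X, GeneratesRel A (A ∪ B) c := by
  have hnull (f : Cochain k X) : f ∈ null k (A ∩ B) := by
    rw [Set.disjoint_iff_inter_eq_empty.1 hAB]
    exact fun a ha => ha.elim
  choose c hcA hcB using fun i => exists_glue (k := k) hA hB (f := 0) (g := v i) (hnull _)
  refine ⟨c, fun i => mem_null_union (by simpa using d_mem_null (hcA i)) ?_, fun u hu huA => ?_⟩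
  · have := add_mem (d_mem_null (hcB i)) (hv.1 i)
    simpa using this
  obtain ⟨a, ha⟩ := mem_coboundaries.1 huA
  obtain ⟨s, hs, t, ht, hst⟩ := Submodule.mem_sup.1
    (hv.2 (cocycles_anti Set.subset_union_right hu))
  obtain ⟨l, rfl⟩ := (Submodule.mem_span_range_iff_exists_fun k).1 hs
  obtain ⟨b, hb⟩ := mem_coboundaries.1 ht
  obtain ⟨ω, hωA, hωB⟩ := exists_glue (k := k) (f := a) (g := b) hA hB (hnull _)
  have hsum : u = ∑ i, l i • c i + (u - ∑ i, l i • c i) := by abel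
  rw [hsum]
  refine Submodule.add_mem_sup (Submodule.sum_mem _ fun i _ =>
    Submodule.smul_mem _ _ (Submodule.subset_span ⟨i, rfl⟩)) (mem_coboundaries.2 ⟨ω, ?_⟩)
  refine mem_null_union ?_ ?_
  · have h1 : ∑ i, l i • c i ∈ null k A :=
      sum_mem fun i _ => Submodule.smul_mem _ _ (by simpa using hcA i)
    have : u - ∑ i, l i • c i - d k X ω = (u - d k X a) - ∑ i, l i • c i -
        d k X (ω - a) := by
      simp only [map_sub]
      abel
    rw [this]
    exact sub_mem (sub_mem ha h1) (d_mem_null hωA)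
  · have h1 : ∑ i, l i • (c i - v i) ∈ null k B :=
      sum_mem fun i _ => Submodule.smul_mem _ _ (hcB i)
    have : u - ∑ i, l i • c i - d k X ω = (t - d k X b) - ∑ i, l i • (c i - v i) -
        d k X (ω - b) := by
      rw [← hst]
      simp only [map_sub, smul_sub, Finset.sum_sub_distrib]
      abel
    rw [this]
    exact sub_mem (sub_mem hb h1) (d_mem_null hωB)

end Cochain

end

section

open Topology

section

variable {k : Type} [Field k] {X : Type}

lemma alternatingSum_length (φ : ℕ → k) (l : List X) :
    alternatingSum (fun l => φ l.length) l = if Odd l.length then φ (l.length - 1) else 0 := by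
  induction l generalizing φ with
  | nil => simp [alternatingSum]
  | cons x l ih =>
    have := ih fun n => φ (n + 1)
    simp only [alternatingSum, List.length_cons, this, Nat.add_sub_cancel, Nat.odd_add_one]
    by_cases h : Odd l.length
    · have : l.length - 1 + 1 = l.length := Nat.sub_add_cancel h.pos
      simp [h, this]
    · simp [h]

namespace Cochain

variable (k X) in
/-- The unit cocycle. -/
def unit : Cochain k X :=
  ⟨fun l => if l.length = 1 then 1 else 0, by simp, 2, fun l hl => if_neg (by omega)⟩

lemma d_unit : d k X (unit k X) = 0 := by
  refine Subtype.ext (funext fun l => ?_)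
  change alternatingSum (fun l : List X => (fun n => if n = 1 then (1 : k) else 0) l.length) l = 0
  refine (alternatingSum_length (fun n => if n = 1 then (1 : k) else 0) l).trans ?_
  refine ite_eq_right_iff.2 fun h => if_neg ?_
  rintro h'
  have : l.length = 2 := by omega
  rw [this] at h
  exact absurd h (by decide)

lemma d_apply_singleton (f : Cochain k X) (x : X) : (d k X f).1 [x] = 0 := by
  change f.1 [] - 0 = 0
  rw [f.2.1, sub_zero]

lemma unit_not_mem_coboundaries [TopologicalSpace X] {A : Set X} (hA : A.Nonempty) :
    unit k X ∉ coboundaries k A := by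
  rw [mem_coboundaries]
  rintro ⟨w, hw⟩
  obtain ⟨a, ha⟩ := hA
  obtain ⟨U, hU, hUw⟩ := hw a ha
  have h1 := hUw [a] (by simpa using mem_of_mem_nhds hU)
  change 1 - (d k X w).1 [a] = 0 at h1
  simp [d_apply_singleton] at h1

lemma generates_point : Generates (Set.univ : Set Unit) fun _ : Unit => unit k Unit := by
  refine ⟨fun _ => by rw [mem_cocycles, d_unit]; exact zero_mem _, fun f hf => ?_⟩
  have hlen (l : List Unit) : l = List.replicate l.length () := by
    simp [List.eq_replicate_iff]
  set φ : ℕ → k := fun n => f.1 (List.replicate n ()) with hφ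
  have hfφ (l : List Unit) : f.1 l = φ l.length := congrArg f.1 (hlen l)
  have hd (l : List Unit) : (d k Unit f).1 l = if Odd l.length then φ (l.length - 1) else 0 := by
    rw [← alternatingSum_length]
    exact congrFun (congrArg alternatingSum (funext hfφ)) l
  have heven (n : ℕ) (hn : Even n) : φ n = 0 := by
    obtain ⟨U, hU, hfU⟩ := hf () trivial
    have := hfU (List.replicate (n + 1) ()) fun _ _ => mem_of_mem_nhds hU
    rw [hd] at this
    simpa [Nat.odd_add_one, hn] using this
  have hw : (fun l => if Even l.length ∧ l.length ≠ 0 then φ (l.length + 1) else 0) ∈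
      Cochain k Unit := by
    obtain ⟨n, hn⟩ := f.2.2
    refine ⟨by simp, n, fun l hl => ?_⟩
    change (if Even l.length ∧ l.length ≠ 0 then φ (l.length + 1) else 0) = 0
    split_ifs
    · exact hn _ (by simp; omega)
    · rfl
  have : f = φ 1 • unit k Unit + d k Unit ⟨_, hw⟩ := by
    refine Subtype.ext (funext fun l => ?_)
    change f.1 l = φ 1 * (if l.length = 1 then 1 else 0) + alternatingSum (fun l : List Unit =>
      (fun n => if Even n ∧ n ≠ 0 then φ (n + 1) else 0) l.length) l
    have h1 := alternatingSum_length (fun n => if Even n ∧ n ≠ 0 then φ (n + 1) else 0) l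
    refine Eq.trans ?_ (congrArg (_ + ·) h1.symm)
    rw [hfφ]
    obtain h | h := Nat.even_or_odd l.length
    · rw [heven _ h, if_neg (by intro h1; rw [h1] at h; exact absurd h (by decide)),
        if_neg (Nat.not_odd_iff_even.2 h)]
      simp
    · rw [if_pos h]
      obtain ⟨m, hm⟩ := h
      by_cases h0 : m = 0
      · simp [hm, h0]
      · have : 2 * m ≠ 0 := by omega
        simp [hm, h0]
  rw [this]
  exact Submodule.add_mem_sup (Submodule.smul_mem _ _ (Submodule.subset_span ⟨(), rfl⟩))
    (d_mem_coboundaries _ _)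

end Cochain

end

namespace Cochain

variable {k : Type} [Field k] {M : Type} [TopologicalSpace M] {ι : Type} {Z : Set M}

section

variable {V : Type} [NormedAddCommGroup V] [NormedSpace ℝ V]

omit [NormedSpace ℝ V] in
lemma Generates.prod_singleton {v : ι → Cochain k M} (hv : Generates Z v) (q : V) :
    Generates (Z ×ˢ {q}) fun i => Cochain.pullback k Prod.fst (v i) := by
  refine hv.pullback (g := fun z => (z, q)) (fun _ _ => continuousAt_fst) (fun _ h => h.1)
    (fun _ _ => by fun_prop) (fun _ h => ⟨h, rfl⟩) fun u hu => ?_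
  have := pullback_sub_mem_of_eqOn (A := Z ×ˢ {q}) (u := (fun z : M => (z, q)) ∘ Prod.fst) (v := id)
    (fun a _ => by fun_prop) (fun a _ => continuousAt_id) ?_ ?_ hu
  · rwa [pullback_id] at this
  · rintro ⟨z, x⟩ ⟨-, hx⟩
    exact Prod.ext rfl hx.symm
  · rintro ⟨z, x⟩ ⟨hz, -⟩
    exact ⟨hz, rfl⟩

/-- Radial projection of a segment ending in `p`. -/
noncomputable def segmentProj (p : V) (t : ℝ) (x : V) : V :=
  ‖(1 - t) • x + t • p‖⁻¹ • ((1 - t) • x + t • p)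

lemma continuousAt_segmentProj {p : V} {t : ℝ} {x : V} (h : (1 - t) • x + t • p ≠ 0) :
    ContinuousAt (fun z : ℝ × V => segmentProj p z.1 z.2) (t, x) := by
  have h1 : ContinuousAt (fun z : ℝ × V => (1 - z.1) • z.2 + z.1 • p) (t, x) := by fun_prop
  exact (h1.norm.inv₀ (norm_ne_zero_iff.2 h)).smul h1

lemma sub_pullback_mem_of_segment (hZ : IsCompact Z) {K : Set V} (hK : IsCompact K)
    (hK1 : ∀ x ∈ K, ‖x‖ = 1) {p q : V} (hq : q ∈ K)
    (h0 : ∀ x ∈ K, ∀ t ∈ Set.Icc (0 : ℝ) 1, (1 - t) • x + t • p ≠ 0)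
    (h1 : ∀ x ∈ K, ∀ t ∈ Set.Icc (0 : ℝ) 1, segmentProj p t x ∈ K)
    {u : Cochain k (M × V)} (hu : u ∈ cocycles k (Z ×ˢ K)) :
    u - pullback k (fun z => (z.1, q)) u ∈ coboundaries k (Z ×ˢ K) := by
  have hF := pullback_sub_mem_of_homotopy (hZ.prod hK) (B := Z ×ˢ K)
    (fun t z => (z.1, segmentProj p t z.2)) (by
      rintro t ht ⟨z, x⟩ ⟨-, hx⟩
      refine ContinuousAt.prodMk (by fun_prop) ?_
      exact ContinuousAt.comp (f := fun y : ℝ × (M × V) => (y.1, y.2.2))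
        (x := (t, (z, x))) (continuousAt_segmentProj (h0 x hx t ht)) (by fun_prop))
    (fun t ht z hz => ⟨hz.1, h1 _ hz.2 t ht⟩) hu
  have hG := pullback_sub_mem_of_homotopy (hZ.prod hK) (B := Z ×ˢ K)
    (fun t z => (z.1, segmentProj p t q)) (by
      rintro t ht ⟨z, x⟩ -
      refine ContinuousAt.prodMk (by fun_prop) ?_
      exact ContinuousAt.comp (f := fun y : ℝ × (M × V) => (y.1, q))
        (x := (t, (z, x))) (continuousAt_segmentProj (h0 q hq t ht)) (by fun_prop))
    (fun t ht z hz => ⟨hz.1, h1 _ hq t ht⟩) hu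
  have hI := pullback_sub_mem_of_eqOn (A := Z ×ˢ K) (B := Z ×ˢ K)
    (u := fun z => (z.1, segmentProj p 0 z.2)) (v := id) (by
      rintro ⟨z, x⟩ ⟨-, hx⟩
      refine ContinuousAt.prodMk (by fun_prop) ?_
      exact ContinuousAt.comp (f := fun y : M × V => ((0 : ℝ), y.2))
        (x := (z, x)) (continuousAt_segmentProj (h0 x hx 0 (by simp))) (by fun_prop))
    (fun _ _ => continuousAt_id) (by
      rintro ⟨z, x⟩ ⟨-, hx⟩
      simp [segmentProj, hK1 x hx]) (fun z hz => ⟨hz.1, h1 _ hz.2 0 (by simp)⟩) hu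
  have e1 : segmentProj p 0 q = q := by simp [segmentProj, hK1 q hq]
  have e2 (x : V) : segmentProj p 1 x = segmentProj p 1 q := by simp [segmentProj]
  simp only [e1, e2] at hF hG
  rw [pullback_id] at hI
  have := add_mem (sub_mem hI hF) hG
  convert this using 1
  abel

end

variable {n : ℕ}

/-- The subspheres of the unit sphere. -/
def subsphere (n j : ℕ) : Set (EuclideanSpace ℝ (Fin (n + 1))) :=
  {x | ‖x‖ = 1 ∧ ∀ i : Fin (n + 1), j < i → x i = 0}

/-- The hemispheres of the subspheres. -/
def hemisphere (n : ℕ) (j : Fin (n + 1)) (s : ℝ) : Set (EuclideanSpace ℝ (Fin (n + 1))) :=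
  {x | x ∈ subsphere n j ∧ 0 ≤ s * x j}

lemma isCompact_subsphere (j : ℕ) : IsCompact (subsphere n j) := by
  have h : subsphere n j = Metric.sphere (0 : EuclideanSpace ℝ (Fin (n + 1))) 1 ∩
      ⋂ i : Fin (n + 1), ⋂ _ : j < i, (fun x : EuclideanSpace ℝ (Fin (n + 1)) => x i) ⁻¹' {0} := by
    ext x
    simp [subsphere]
  rw [h]
  exact (isCompact_sphere _ 1).inter_right (isClosed_iInter fun i => isClosed_iInter fun _ =>
    isClosed_singleton.preimage (by fun_prop))

lemma isCompact_hemisphere (j : Fin (n + 1)) (s : ℝ) : IsCompact (hemisphere n j s) :=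
  (isCompact_subsphere (j : ℕ)).inter_right
    (t := (fun x : EuclideanSpace ℝ (Fin (n + 1)) => s * x j) ⁻¹' Set.Ici 0)
    (isClosed_Ici.preimage (by fun_prop))

lemma hemisphere_union (j : Fin (n + 1)) :
    hemisphere n j 1 ∪ hemisphere n j (-1) = subsphere n j := by
  ext x
  simp only [hemisphere, Set.mem_union, Set.mem_ofPred_eq, ← and_or_left, and_iff_left_iff_imp]
  intro _
  obtain h | h := le_total 0 (x j)
  · left; linarith
  · right; linarith

lemma hemisphere_inter {j : ℕ} (hj : j + 1 < n + 1) :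
    hemisphere n ⟨j + 1, hj⟩ 1 ∩ hemisphere n ⟨j + 1, hj⟩ (-1) = subsphere n j := by
  ext x
  constructor
  · rintro ⟨⟨⟨h1, h2⟩, h3⟩, -, h4⟩
    refine ⟨h1, fun i hi => ?_⟩
    obtain h | h := Nat.eq_or_lt_of_le (Nat.succ_le_of_lt hi)
    · obtain rfl : i = ⟨j + 1, hj⟩ := Fin.ext h.symm
      linarith
    · exact h2 i h
  · rintro ⟨h1, h2⟩
    have h3 := h2 ⟨j + 1, hj⟩ (Nat.lt_succ_self j)
    have h4 : x ∈ subsphere n (j + 1) := ⟨h1, fun i hi => h2 i (by omega)⟩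
    exact ⟨⟨h4, by rw [h3, mul_zero]⟩, h4, by rw [h3, mul_zero]⟩

lemma segment_hemisphere {j : Fin (n + 1)} {s : ℝ} (hs : s * s = 1)
    {x : EuclideanSpace ℝ (Fin (n + 1))} (hx : x ∈ hemisphere n j s) {t : ℝ}
    (ht : t ∈ Set.Icc (0 : ℝ) 1) :
    (1 - t) • x + t • EuclideanSpace.single j s ≠ 0 ∧
      segmentProj (EuclideanSpace.single j s) t x ∈ hemisphere n j s := by
  have hcoord : s * ((1 - t) • x + t • EuclideanSpace.single j s) j = (1 - t) * (s * x j) + t := by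
    simp only [PiLp.add_apply, PiLp.smul_apply, smul_eq_mul, PiLp.single_apply, if_true]
    linear_combination t * hs
  have hnn : 0 ≤ (1 - t) * (s * x j) := mul_nonneg (by linarith [ht.2]) hx.2
  have hne : (1 - t) • x + t • EuclideanSpace.single j s ≠ 0 := by
    intro h
    rw [h] at hcoord
    simp only [PiLp.zero_apply, mul_zero] at hcoord
    have ht0 : t = 0 := by linarith [ht.1]
    rw [ht0] at h
    have hx1 := hx.1.1
    simp only [sub_zero, one_smul, zero_smul, add_zero] at h
    rw [h] at hx1
    simp at hx1
  refine ⟨hne, ⟨?_, fun i hi => ?_⟩, ?_⟩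
  · rw [segmentProj, norm_smul, norm_inv, norm_norm, inv_mul_cancel₀ (norm_ne_zero_iff.2 hne)]
  · have hij : i ≠ j := by rintro rfl; exact lt_irrefl _ hi
    simp [segmentProj, hx.1.2 i hi, hij]
  · rw [segmentProj, PiLp.smul_apply, smul_eq_mul, mul_left_comm, hcoord]
    exact mul_nonneg (by positivity) (by linarith [ht.1])

lemma subsphere_zero : subsphere n 0 =
    {EuclideanSpace.single 0 1} ∪ {EuclideanSpace.single 0 (-1)} := by
  ext x
  simp only [subsphere, Set.mem_ofPred_eq, Set.union_singleton, Set.mem_insert_iff,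
    Set.mem_singleton_iff]
  constructor
  · rintro ⟨h1, h2⟩
    have hx : x = EuclideanSpace.single 0 (x 0) := by
      ext i
      by_cases hi : i = 0
      · simp [hi]
      · simp [hi, h2 i (Nat.pos_of_ne_zero fun h => hi (Fin.ext h))]
    rw [hx, PiLp.norm_single, Real.norm_eq_abs] at h1
    obtain h | h := eq_or_eq_neg_of_abs_eq h1
    · right; rw [hx, h]
    · left; rw [hx, h]
  · have hne (i : Fin (n + 1)) (hi : 0 < (i : ℕ)) : i ≠ 0 := by rintro rfl; exact lt_irrefl _ hi
    rintro (rfl | rfl)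
    · exact ⟨by simp, fun i hi => by simp [hne i hi]⟩
    · exact ⟨by simp, fun i hi => by simp [hne i hi]⟩

variable [T2Space M]

lemma Generates.exists_generatesRel_subsphere [Fintype ι] {v : ι → Cochain k M}
    (hv : Generates Z v) (hZ : IsCompact Z) {j : ℕ} (hj : j ≤ n) :
    ∃ c : ι → Cochain k (M × EuclideanSpace ℝ (Fin (n + 1))),
      GeneratesRel (Z ×ˢ {EuclideanSpace.single 0 1}) (Z ×ˢ subsphere n j) c := by
  induction j with
  | zero =>
    rw [subsphere_zero, Set.prod_union]
    refine (hv.prod_singleton _).exists_union_of_disjoint (hZ.prod isCompact_singleton)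
      (hZ.prod isCompact_singleton) ?_
    rw [Set.disjoint_prod]
    right
    rw [Set.disjoint_singleton]
    intro h
    have := congrArg (fun x : EuclideanSpace ℝ (Fin (n + 1)) => x 0) h
    norm_num at this
  | succ j ih =>
    have hj' : j + 1 < n + 1 := by omega
    obtain ⟨c, hc⟩ := ih (by omega)
    have hq : EuclideanSpace.single 0 1 ∈ subsphere n j :=
      ⟨by simp, fun i hi => by
        have : i ≠ 0 := by rintro rfl; exact Nat.not_lt_zero _ hi
        simp [this]⟩
    rw [← hemisphere_inter hj', Set.prod_inter] at hc
    have hq' := hq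
    rw [← hemisphere_inter hj'] at hq'
    have := hc.exists_union (hZ.prod (isCompact_hemisphere _ _))
      (hZ.prod (isCompact_hemisphere _ _)) (r := fun z => (z.1, EuclideanSpace.single 0 1)) ?_
      (fun _ _ => by fun_prop) ?_ ?_ ?_ ?_
    · rwa [← Set.prod_union, hemisphere_union] at this
    · rintro ⟨z, x⟩ ⟨hz, hx⟩
      obtain rfl : x = EuclideanSpace.single 0 1 := hx
      exact ⟨⟨hz, hq'.1⟩, hz, hq'.2⟩
    · rintro ⟨z, x⟩ (⟨hz, -⟩ | ⟨hz, -⟩) <;> exact ⟨hz, rfl⟩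
    · rintro ⟨z, x⟩ ⟨-, hx⟩
      exact Prod.ext rfl hx.symm
    · intro u hu
      exact sub_pullback_mem_of_segment hZ (isCompact_hemisphere _ _) (fun x hx => hx.1.1) hq'.1
        (fun x hx t ht => (segment_hemisphere (by norm_num) hx ht).1)
        (fun x hx t ht => (segment_hemisphere (by norm_num) hx ht).2) hu
    · intro u hu
      exact sub_pullback_mem_of_segment hZ (isCompact_hemisphere _ _) (fun x hx => hx.1.1) hq'.2
        (fun x hx t ht => (segment_hemisphere (by norm_num) hx ht).1)
        (fun x hx t ht => (segment_hemisphere (by norm_num) hx ht).2) hu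

/-- Taking the product with a sphere at most doubles the number of generators. -/
lemma Generates.exists_prod_sphere [Fintype ι] {v : ι → Cochain k M} (hv : Generates Z v)
    (hZ : IsCompact Z) (n : ℕ) : ∃ c : ι ⊕ ι → Cochain k (M × EuclideanSpace ℝ (Fin (n + 1))),
      Generates (Z ×ˢ Metric.sphere (0 : EuclideanSpace ℝ (Fin (n + 1))) 1) c := by
  obtain ⟨c, hc⟩ := hv.exists_generatesRel_subsphere hZ (le_refl n)
  have hS : subsphere n n = Metric.sphere (0 : EuclideanSpace ℝ (Fin (n + 1))) 1 := by
    ext x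
    simp only [subsphere, Set.mem_ofPred_eq, mem_sphere_zero_iff_norm, and_iff_left_iff_imp]
    intro _ i hi
    omega
  rw [hS] at hc
  refine ⟨_, hc.generates (hv.prod_singleton _) ?_ (r := fun z => (z.1, EuclideanSpace.single 0 1))
    (fun _ _ => by fun_prop) ?_ ?_⟩
  · rintro ⟨z, x⟩ ⟨hz, hx⟩
    obtain rfl : x = EuclideanSpace.single 0 1 := hx
    exact ⟨hz, by simp⟩
  · rintro ⟨z, x⟩ ⟨hz, -⟩
    exact ⟨hz, rfl⟩
  · rintro ⟨z, x⟩ ⟨-, hx⟩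
    exact Prod.ext rfl hx.symm

end Cochain

end

section

open Topology

section

variable {n : ℕ}

/-- Radial projection onto the sphere. -/
noncomputable def radialProj (n : ℕ) (x : EuclideanSpace ℝ (Fin (n + 1))) :
    Metric.sphere (0 : EuclideanSpace ℝ (Fin (n + 1))) 1 :=
  open Classical in
  if h : x = 0 then ⟨EuclideanSpace.single 0 1, by simp⟩ else
    ⟨‖x‖⁻¹ • x, by simp [norm_smul, norm_ne_zero_iff.2 h]⟩

lemma radialProj_coe (x : Metric.sphere (0 : EuclideanSpace ℝ (Fin (n + 1))) 1) :
    radialProj n x = x := by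
  have h : ‖(x : EuclideanSpace ℝ (Fin (n + 1)))‖ = 1 := by simp
  have h0 : (x : EuclideanSpace ℝ (Fin (n + 1))) ≠ 0 := norm_ne_zero_iff.1 (by rw [h]; simp)
  refine Subtype.ext ?_
  rw [radialProj, dif_neg h0]
  simp

lemma continuousAt_radialProj {x : EuclideanSpace ℝ (Fin (n + 1))} (hx : x ≠ 0) :
    ContinuousAt (radialProj n) x := by
  rw [IsInducing.subtypeVal.continuousAt_iff]
  have h : ContinuousAt (fun y : EuclideanSpace ℝ (Fin (n + 1)) => ‖y‖⁻¹ • y) x :=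
    (continuous_norm.continuousAt.inv₀ (norm_ne_zero_iff.2 hx)).smul continuousAt_id
  refine h.congr ?_
  filter_upwards [isOpen_ne.mem_nhds hx] with y hy
  simp [radialProj, dif_neg hy]

end

namespace Cochain

variable {k : Type} [Field k] {X : Type} [TopologicalSpace X]

lemma exists_generates_of_homotopyEquiv [CompactSpace X] {m n : ℕ}
    (e : ContinuousMap.HomotopyEquiv X
      (Metric.sphere (0 : EuclideanSpace ℝ (Fin (m + 1))) 1 ×
        Metric.sphere (0 : EuclideanSpace ℝ (Fin (n + 1))) 1)) :
    ∃ c : (Unit ⊕ Unit) ⊕ (Unit ⊕ Unit) → Cochain k X, Generates Set.univ c := by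
  obtain ⟨v, hv⟩ := (generates_point (k := k)).exists_prod_sphere isCompact_univ m
  obtain ⟨w, hw⟩ := hv.exists_prod_sphere (isCompact_univ.prod (isCompact_sphere 0 1)) n
  obtain ⟨H⟩ := e.left_inv
  let f : X → (Unit × EuclideanSpace ℝ (Fin (m + 1))) × EuclideanSpace ℝ (Fin (n + 1)) :=
    fun x => (((), (e x).1), (e x).2)
  let g : (Unit × EuclideanSpace ℝ (Fin (m + 1))) × EuclideanSpace ℝ (Fin (n + 1)) → X :=
    fun z => e.invFun (radialProj m z.1.2, radialProj n z.2)
  have hne {j : ℕ} {x : EuclideanSpace ℝ (Fin (j + 1))} (hx : x ∈ Metric.sphere 0 1) : x ≠ 0 := by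
    rintro rfl
    simp at hx
  have hf : Continuous f := by
    have : Continuous fun x => e x := e.toFun.continuous
    fun_prop
  refine ⟨_, hw.pullback (A := Set.univ) (f := f) (g := g) (fun _ _ => hf.continuousAt)
    (fun x _ => ⟨⟨trivial, (e x).1.2⟩, (e x).2.2⟩) ?_ (fun _ _ => trivial) fun u hu => ?_⟩
  · rintro ⟨⟨z, x⟩, y⟩ ⟨⟨-, hx⟩, hy⟩
    refine e.invFun.continuous.continuousAt.comp (ContinuousAt.prodMk ?_ ?_)
    · exact ContinuousAt.comp (x := ((z, x), y))
        (f := fun z : (Unit × EuclideanSpace ℝ (Fin (m + 1))) × EuclideanSpace ℝ (Fin (n + 1)) =>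
          z.1.2) (continuousAt_radialProj (hne hx)) (by fun_prop)
    · exact ContinuousAt.comp (x := ((z, x), y))
        (f := fun z : (Unit × EuclideanSpace ℝ (Fin (m + 1))) × EuclideanSpace ℝ (Fin (n + 1)) =>
          z.2) (continuousAt_radialProj (hne hy)) (by fun_prop)
  · have := pullback_sub_mem_of_homotopy isCompact_univ (B := Set.univ)
      (fun t x => H (Set.projIcc 0 1 zero_le_one t, x)) (fun t _ a _ => by
        refine Continuous.continuousAt ?_
        exact H.continuous.comp ((continuous_projIcc.comp continuous_fst).prodMk continuous_snd))
      (fun _ _ _ _ => trivial) hu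
    have h1 : (fun x => H (Set.projIcc 0 1 zero_le_one 1, x)) = id := by
      funext x
      rw [Set.projIcc_right]
      exact H.apply_one x
    have h0 : (fun x => H (Set.projIcc 0 1 zero_le_one 0, x)) = g ∘ f := by
      funext x
      rw [Set.projIcc_left]
      refine (H.apply_zero x).trans ?_
      simp only [g, f, Function.comp, radialProj_coe]
      rfl
    rwa [h1, h0, pullback_id] at this

end Cochain

end

section

open TensorProduct

section Algebra

variable {K : Type} [Field K] {p : ℕ} [Fact p.Prime] [CharP K p]

/-- In characteristic `p` the homogeneous geometric sum of length `p` is a power. -/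
lemma geom_sum_eq_sub_pow {B : Type*} [CommRing B] [Algebra K B] (u v : B) :
    ∑ i ∈ Finset.range p, u ^ i * v ^ (p - 1 - i) = (u - v) ^ (p - 1) := by
  have hp : p - 1 + 1 = p := Nat.sub_add_cancel (Fact.out : p.Prime).one_le
  have h : (∑ i ∈ Finset.range p, MvPolynomial.X 0 ^ i * MvPolynomial.X 1 ^ (p - 1 - i) :
      MvPolynomial (Fin 2) K) = (MvPolynomial.X 0 - MvPolynomial.X 1) ^ (p - 1) := by
    refine mul_right_cancel₀ (b := MvPolynomial.X 0 - MvPolynomial.X 1) ?_ ?_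
    · rw [sub_ne_zero]
      exact (MvPolynomial.X_injective (R := K)).ne (by decide)
    · rw [(Commute.all _ _).geom_sum₂_mul, ← pow_succ, hp, sub_pow_char]
  simpa using congrArg (MvPolynomial.aeval ![u, v]) h

lemma sub_pow_eq_zero_of_pow_eq_zero {B : Type*} [CommRing B] [Algebra K B] {u v : B}
    (hu : u ^ p = 0) (hv : v ^ p = 0) : (u - v) ^ p = 0 := by
  have hp : p - 1 + 1 = p := Nat.sub_add_cancel (Fact.out : p.Prime).one_le
  rw [← hp, pow_succ, ← geom_sum_eq_sub_pow (K := K), (Commute.all _ _).geom_sum₂_mul, hu, hv,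
    sub_zero]

omit [CharP K p] in
lemma sum_smul_pow_mul_prod {B : Type*} [CommRing B] [Algebra K B] {ι : Type*} [Fintype ι]
    [DecidableEq ι] (a : ι → K) {y : ι → B} (hy : ∀ i, y i ^ p = 0) (i : ι) :
    (∑ j, a j • y j) ^ (p - 1) * ∏ j ∈ Finset.univ.erase i, y j ^ (p - 1) =
      a i ^ (p - 1) • ∏ j, y j ^ (p - 1) := by
  have hp : p - 1 + 1 = p := Nat.sub_add_cancel (Fact.out : p.Prime).one_le
  rw [← Finset.mul_prod_erase _ _ (Finset.mem_univ i), ← smul_mul_assoc, ← smul_pow, ← sub_eq_zero,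
    ← sub_mul]
  obtain ⟨q, hq⟩ := sub_dvd_pow_sub_pow (∑ j, a j • y j) (a i • y i) (p - 1)
  rw [hq, ← Finset.add_sum_erase _ _ (Finset.mem_univ i), add_sub_cancel_left, mul_right_comm]
  convert zero_mul q
  rw [Finset.sum_mul]
  refine Finset.sum_eq_zero fun j hj => ?_
  rw [← Finset.mul_prod_erase _ _ hj, smul_mul_assoc, ← mul_assoc, ← pow_succ', hp, hy, zero_mul,
    smul_zero]

lemma exists_geom_sum_eq_one_of_algHom {M : Type} [Ring M] [Algebra K M] {x : Fin 3 → M}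
    {B : Type*} [CommRing B] [Algebra K B] (ρ : B →ₐ[K] Module.End K M) {l r : Fin 3 → B}
    (hρl : ∀ i, ρ (l i) = LinearMap.mulLeft K (x i))
    (hρr : ∀ i, ρ (r i) = LinearMap.mulRight K (x i))
    (hl : ∀ i, l i ^ p = 0) (hr : ∀ i, r i ^ p = 0) {e : M}
    (he : ∑ i ∈ Finset.range p, ∑ j ∈ Finset.range p, ∑ l ∈ Finset.range p,
      (1 + x 0) ^ i * (1 + x 1) ^ j * (1 + x 2) ^ l * e *
        ((1 + x 0) ^ (p - 1 - i) * (1 + x 1) ^ (p - 1 - j) * (1 + x 2) ^ (p - 1 - l)) = 1)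
    {a : Fin 3 → K} (ha : a ≠ 0) :
    ∃ E : M, ∑ j ∈ Finset.range p,
      (∑ i, a i • x i) ^ j * E * (∑ i, a i • x i) ^ (p - 1 - j) = 1 := by
  obtain ⟨i, hi⟩ := Function.ne_iff.1 ha
  have hy (i : Fin 3) : (l i - r i) ^ p = 0 := sub_pow_eq_zero_of_pow_eq_zero (K := K) (hl i) (hr i)
  have hL {b : B} {y : M} (hb : ρ b = LinearMap.mulLeft K y) (n : ℕ) (c : B) (m : M) :
      ρ (b ^ n * c) m = y ^ n * ρ c m := by
    rw [map_mul, map_pow, hb, LinearMap.pow_mulLeft, Module.End.mul_apply, LinearMap.mulLeft_apply]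
  have hR {b : B} {y : M} (hb : ρ b = LinearMap.mulRight K y) (n : ℕ) (c : B) (m : M) :
      ρ (c * b ^ n) m = ρ c (m * y ^ n) := by
    rw [map_mul, map_pow, hb, LinearMap.pow_mulRight, Module.End.mul_apply,
      LinearMap.mulRight_apply]
  have hL1 (i : Fin 3) : ρ (1 + l i) = LinearMap.mulLeft K (1 + x i) := by
    rw [map_add, map_one, hρl]
    ext m
    simp [add_mul]
  have hR1 (i : Fin 3) : ρ (1 + r i) = LinearMap.mulRight K (1 + x i) := by
    rw [map_add, map_one, hρr]
    ext m
    simp [mul_add]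
  have hLa : ρ (∑ i, a i • l i) = LinearMap.mulLeft K (∑ i, a i • x i) := by
    ext m
    simp [Fin.sum_univ_three, hρl, add_mul]
  have hRa : ρ (∑ i, a i • r i) = LinearMap.mulRight K (∑ i, a i • x i) := by
    ext m
    simp [Fin.sum_univ_three, hρr, mul_add]
  let ev : B →ₗ[K] M := LinearMap.applyₗ e ∘ₗ ρ.toLinearMap
  have hone : ρ (∏ i, (l i - r i) ^ (p - 1)) e = 1 := by
    have h (i : Fin 3) : (l i - r i) ^ (p - 1) =
        ∑ n ∈ Finset.range p, (1 + l i) ^ n * (1 + r i) ^ (p - 1 - n) := by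
      rw [geom_sum_eq_sub_pow (K := K), add_sub_add_left_eq_sub]
    rw [← he, Fin.prod_univ_three, h, h, h, Finset.sum_mul_sum, Finset.sum_mul]
    change ev _ = _
    rw [map_sum]
    refine Finset.sum_congr rfl fun i _ => ?_
    rw [Finset.sum_mul, map_sum]
    refine Finset.sum_congr rfl fun j _ => ?_
    rw [Finset.mul_sum, map_sum]
    refine Finset.sum_congr rfl fun n _ => ?_
    have : (1 + l 0) ^ i * (1 + r 0) ^ (p - 1 - i) * ((1 + l 1) ^ j * (1 + r 1) ^ (p - 1 - j)) *
        ((1 + l 2) ^ n * (1 + r 2) ^ (p - 1 - n)) = (1 + l 0) ^ i * ((1 + l 1) ^ j *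
        ((1 + l 2) ^ n * (1 * (1 + r 2) ^ (p - 1 - n) * (1 + r 1) ^ (p - 1 - j) *
          (1 + r 0) ^ (p - 1 - i)))) := by ring
    rw [this]
    change ρ _ e = _
    rw [hL (hL1 0), hL (hL1 1), hL (hL1 2), hR (hR1 0), hR (hR1 1), hR (hR1 2), map_one,
      Module.End.one_apply]
    simp only [mul_assoc]
  let c : B := ∏ j ∈ Finset.univ.erase i, (l j - r j) ^ (p - 1)
  have hai : a i ^ (p - 1) ≠ 0 := pow_ne_zero _ hi
  refine ⟨(a i ^ (p - 1))⁻¹ • ρ c e, ?_⟩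
  have key := congrArg ev (sum_smul_pow_mul_prod a hy i)
  have hsub : ∑ j, a j • (l j - r j) = ∑ j, a j • l j - ∑ j, a j • r j := by
    simp only [smul_sub, Finset.sum_sub_distrib]
  rw [hsub, ← geom_sum_eq_sub_pow (K := K), Finset.sum_mul, map_sum, map_smul] at key
  change _ = _ • ρ (∏ i, (l i - r i) ^ (p - 1)) e at key
  rw [hone] at key
  simp only [mul_smul_comm, smul_mul_assoc]
  rw [← Finset.smul_sum, inv_smul_eq_iff₀ hai, ← key]
  refine Finset.sum_congr rfl fun j _ => ?_
  change _ = ρ (_ * c) e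
  have h1 : (∑ i, a i • l i) ^ j * (∑ i, a i • r i) ^ (p - 1 - j) * c =
      (∑ i, a i • l i) ^ j * ((1 * (∑ i, a i • r i) ^ (p - 1 - j)) * c) := by ring
  rw [h1, hL hLa, mul_comm _ c, mul_comm 1, mul_one]
  rw [← one_mul ((∑ i, a i • r i) ^ (p - 1 - j)), ← mul_assoc, mul_one, mul_comm c, map_mul,
    Module.End.mul_apply, ← one_mul ((∑ i, a i • r i) ^ (p - 1 - j)), hR hRa, map_one,
    Module.End.one_apply, mul_assoc]

open scoped IsMulCommutative in
lemma exists_geom_sum_eq_one {M : Type} [Ring M] [Algebra K M] {x : Fin 3 → M}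
    (hx : ∀ i j, x i * x j = x j * x i) (hxp : ∀ i, x i ^ p = 0) {e : M}
    (he : ∑ i ∈ Finset.range p, ∑ j ∈ Finset.range p, ∑ l ∈ Finset.range p,
      (1 + x 0) ^ i * (1 + x 1) ^ j * (1 + x 2) ^ l * e *
        ((1 + x 0) ^ (p - 1 - i) * (1 + x 1) ^ (p - 1 - j) * (1 + x 2) ^ (p - 1 - l)) = 1)
    {a : Fin 3 → K} (ha : a ≠ 0) :
    ∃ E : M, ∑ j ∈ Finset.range p,
      (∑ i, a i • x i) ^ j * E * (∑ i, a i • x i) ^ (p - 1 - j) = 1 := by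
  let s : Set (Module.End K M) :=
    (Set.range fun i => LinearMap.mulLeft K (x i)) ∪ Set.range fun i => LinearMap.mulRight K (x i)
  have hs : ∀ f ∈ s, ∀ g ∈ s, f * g = g * f := by
    rintro _ (⟨i, rfl⟩ | ⟨i, rfl⟩) _ (⟨j, rfl⟩ | ⟨j, rfl⟩) <;> ext m <;>
      simp only [Module.End.mul_apply, LinearMap.mulLeft_apply, LinearMap.mulRight_apply]
    · rw [← mul_assoc, hx, mul_assoc]
    · rw [mul_assoc]
    · rw [mul_assoc]
    · rw [mul_assoc, hx, ← mul_assoc]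
  have := Algebra.isMulCommutative_adjoin K hs
  let l (i : Fin 3) : Algebra.adjoin K s :=
    ⟨LinearMap.mulLeft K (x i), Algebra.subset_adjoin (Or.inl ⟨i, rfl⟩)⟩
  let r (i : Fin 3) : Algebra.adjoin K s :=
    ⟨LinearMap.mulRight K (x i), Algebra.subset_adjoin (Or.inr ⟨i, rfl⟩)⟩
  refine exists_geom_sum_eq_one_of_algHom (Algebra.adjoin K s).val (l := l) (r := r)
    (fun _ => rfl) (fun _ => rfl) (fun i => Subtype.ext ?_) (fun i => Subtype.ext ?_) he ha
  · change LinearMap.mulLeft K (x i) ^ p = 0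
    rw [LinearMap.pow_mulLeft, hxp, LinearMap.mulLeft_zero_eq_zero]
  · change LinearMap.mulRight K (x i) ^ p = 0
    rw [LinearMap.pow_mulRight, hxp, LinearMap.mulRight_zero_eq_zero]

end Algebra

end

section

open TensorProduct

section

variable {K : Type} [Field K] {p : ℕ} [Fact p.Prime] [CharP K p]

lemma exists_geom_sum_eq_one_of_commute {A : Type} [Ring A] [Algebra K A] {S : Set A}
    {x : Fin 3 → A} {e : A} (hx : ∀ i j, x i * x j = x j * x i) (hxp : ∀ i, x i ^ p = 0)
    (hxS : ∀ i, ∀ g ∈ S, g * x i = x i * g) (heS : ∀ g ∈ S, g * e = e * g)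
    (he : ∑ i ∈ Finset.range p, ∑ j ∈ Finset.range p, ∑ l ∈ Finset.range p,
      (1 + x 0) ^ i * (1 + x 1) ^ j * (1 + x 2) ^ l * e *
        ((1 + x 0) ^ (p - 1 - i) * (1 + x 1) ^ (p - 1 - j) * (1 + x 2) ^ (p - 1 - l)) = 1)
    {a : Fin 3 → K} (ha : a ≠ 0) :
    ∃ E : A, (∀ g ∈ S, g * E = E * g) ∧ ∑ j ∈ Finset.range p,
      (∑ i, a i • x i) ^ j * E * (∑ i, a i • x i) ^ (p - 1 - j) = 1 := by
  let M := Subalgebra.centralizer K S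
  obtain ⟨⟨E, hE⟩, h⟩ := exists_geom_sum_eq_one (K := K) (p := p) (M := M)
    (x := fun i => ⟨x i, Subalgebra.mem_centralizer_iff K |>.2 (hxS i)⟩)
    (e := ⟨e, Subalgebra.mem_centralizer_iff K |>.2 heS⟩) (fun i j => Subtype.ext (hx i j))
    (fun i => Subtype.ext (hxp i)) (Subtype.ext (by
      change M.val _ = 1
      simp only [map_sum, map_mul, map_pow, map_add, map_one]
      exact he)) ha
  refine ⟨E, Subalgebra.mem_centralizer_iff K |>.1 hE, ?_⟩
  have h' := congrArg M.val h
  simp only [map_sum, map_mul, map_pow, map_smul, map_one] at h'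
  exact h'

end

namespace TComplex

lemma contraction_eq_one {A : Type*} [Ring A] {D X Y o e E F : A} (heD : e * D = D * o)
    (hoD : o * D = D * e) (heo : e * o = 0) (hoe : o * e = 0) (hee : e * e = e) (hoo : o * o = o)
    (hadd : e + o = 1) (hXe : Commute e X) (hXo : Commute o X) (hYe : Commute e Y)
    (hYo : Commute o Y) (hEe : Commute e E) (hEo : Commute o E) (hFe : Commute e F)
    (hFo : Commute o F) (hED : Commute E D) (hFD : Commute F D)
    (h1 : X * F + E * Y = 1) (h2 : Y * E + F * X = 1) :
    (D + (Y * e - X * o)) * (E * e - F * o) + (F * e - E * o) * (D + (X * e - Y * o)) = 1 ∧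
    (D + (X * e - Y * o)) * (F * e - E * o) + (E * e - F * o) * (D + (Y * e - X * o)) = 1 := by
  have h1' (f : A) : X * (F * f) + E * (Y * f) = f := by
    rw [← mul_assoc, ← mul_assoc, ← add_mul, h1, one_mul]
  have h2' (f : A) : Y * (E * f) + F * (X * f) = f := by
    rw [← mul_assoc, ← mul_assoc, ← add_mul, h2, one_mul]
  simp only [mul_add, add_mul, mul_sub, sub_mul, mul_assoc, heD, hoD, heo, hoe, hee, hoo,
    hXe.left_comm, hXo.left_comm, hYe.left_comm, hYo.left_comm, hEe.left_comm, hEo.left_comm,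
    hFe.left_comm, hFo.left_comm, hED.left_comm, hFD.left_comm, mul_zero, sub_zero, zero_sub]
  constructor
  · calc _ = (Y * (E * e) + F * (X * e)) + (X * (F * o) + E * (Y * o)) := by abel
      _ = 1 := by rw [h1', h2', hadd]
  · calc _ = (X * (F * e) + E * (Y * e)) + (Y * (E * o) + F * (X * o)) := by abel
      _ = 1 := by rw [h1', h2', hadd]

variable {k : Type} [Field k] {p : ℕ} [Fact p.Prime] [CharP k p] {C : Type} [AddCommGroup C]
  [Module k C] (T : TComplex k p C)

omit [CharP k p] in
lemma acyclic_of_geom_sum_eq_one {K : Type} [Field K] [Algebra k K] {a : Fin 3 → K}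
    {E : Module.End K (K ⊗[k] C)} (hD : Commute E (T.D.baseChange K))
    (he : Commute E (T.even.baseChange K)) (ho : Commute E (T.odd.baseChange K))
    (hE : ∑ j ∈ Finset.range p, T.shift a ^ j * E * T.shift a ^ (p - 1 - j) = 1) :
    T.Acyclic a := by
  have hp : p - 1 + 1 = p := Nat.sub_add_cancel (Fact.out : p.Prime).one_le
  set X := T.shift a with hX
  set F : Module.End K (K ⊗[k] C) :=
    ∑ j ∈ Finset.range (p - 1), X ^ j * E * X ^ (p - 1 - (j + 1)) with hF
  have hcomm {f : Module.End K (K ⊗[k] C)} (h1 : Commute E f) (h2 : Commute X f) :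
      Commute f F :=
    Commute.sum_right _ _ _ fun j _ =>
      ((h2.pow_left _).mul_left h1).mul_left (h2.pow_left _) |>.symm
  have hbc {f g h i : Module.End k C} (hh : f * g = h * i) :
      f.baseChange K * g.baseChange K = h.baseChange K * i.baseChange K := by
    rw [← LinearMap.baseChange_mul, hh, LinearMap.baseChange_mul]
  have hbc0 {f g : Module.End k C} (hh : f * g = 0) : f.baseChange K * g.baseChange K = 0 := by
    rw [← LinearMap.baseChange_mul, hh, LinearMap.baseChange_zero]
  have hbc1 {f g h : Module.End k C} (hh : f * g = h) :
      f.baseChange K * g.baseChange K = h.baseChange K := by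
    rw [← LinearMap.baseChange_mul, hh]
  have h1 : X * F + E * X ^ (p - 1) = 1 := by
    rw [← hE]
    conv_rhs => rw [← hp, Finset.sum_range_succ']
    simp [hF, Finset.mul_sum, pow_succ', mul_assoc]
  have h2 : X ^ (p - 1) * E + F * X = 1 := by
    rw [← hE]
    conv_rhs => rw [← hp, Finset.sum_range_succ]
    rw [add_comm, hF, Finset.sum_mul]
    congr 1
    · refine Finset.sum_congr (by simp) fun j hj => ?_
      rw [mul_assoc, ← pow_succ]
      congr 2
      have := Finset.mem_range.1 hj
      omega
    · simp
  have hadd : T.even.baseChange K + T.odd.baseChange K = 1 := by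
    rw [← LinearMap.baseChange_add, T.even_add_odd]
    exact LinearMap.baseChange_one k C
  obtain ⟨hA, hB⟩ := contraction_eq_one (A := Module.End K (K ⊗[k] C))
    (hbc T.even_mul_D) (hbc T.odd_mul_D) (hbc0 T.even_mul_odd)
    (hbc0 T.odd_mul_even) (hbc1 T.even_mul_even) (hbc1 T.odd_mul_odd) hadd
    (T.shift_even a).symm (T.shift_odd a).symm ((T.shift_even a).pow_left (p - 1)).symm
    ((T.shift_odd a).pow_left (p - 1)).symm he.symm ho.symm
    (hcomm he (T.shift_even a)) (hcomm ho (T.shift_odd a)) hD (hcomm hD (T.shift_D a)).symm h1 h2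
  constructor <;> intro c hc
  · refine ⟨(E * T.even.baseChange K - F * T.odd.baseChange K) c, ?_⟩
    have := LinearMap.congr_fun hA c
    rw [pert₀] at hc
    rwa [LinearMap.add_apply, Module.End.mul_apply, Module.End.mul_apply _ _ c, hc, map_zero,
      add_zero] at this
  · refine ⟨(F * T.even.baseChange K - E * T.odd.baseChange K) c, ?_⟩
    have := LinearMap.congr_fun hB c
    rw [pert₁] at hc
    rwa [LinearMap.add_apply, Module.End.mul_apply, Module.End.mul_apply _ _ c, hc, map_zero,
      add_zero] at this

/-- A complex which is induced from the trivial group is acyclic. -/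
lemma acyclic_of_sum_eq_one {e : Module.End k C} (hD : e * T.D = T.D * e)
    (hm : ∀ φ, e * T.m φ = T.m φ * e)
    (he : ∑ i ∈ Finset.range p, ∑ j ∈ Finset.range p, ∑ l ∈ Finset.range p,
      (1 + T.x 0) ^ i * (1 + T.x 1) ^ j * (1 + T.x 2) ^ l * e *
        ((1 + T.x 0) ^ (p - 1 - i) * (1 + T.x 1) ^ (p - 1 - j) * (1 + T.x 2) ^ (p - 1 - l)) = 1)
    {K : Type} [Field K] [Algebra k K] {a : Fin 3 → K} (ha : a ≠ 0) : T.Acyclic a := by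
  have : CharP K p := charP_of_injective_algebraMap (algebraMap k K).injective p
  let S : Set (Module.End K (K ⊗[k] C)) :=
    {T.D.baseChange K, T.even.baseChange K, T.odd.baseChange K}
  let β := Module.End.baseChangeHom k K C
  have hmem {f : Module.End k C} (hfD : f * T.D = T.D * f) (hfm : ∀ φ, f * T.m φ = T.m φ * f) :
      ∀ g ∈ S, g * f.baseChange K = f.baseChange K * g := by
    rintro _ (rfl | rfl | rfl)
    · rw [← LinearMap.baseChange_mul, ← hfD, LinearMap.baseChange_mul]
    · rw [even, ← LinearMap.baseChange_mul, ← hfm, LinearMap.baseChange_mul]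
    · rw [odd, ← LinearMap.baseChange_mul, ← hfm, LinearMap.baseChange_mul]
  obtain ⟨E, hE, h⟩ := exists_geom_sum_eq_one_of_commute (K := K) (p := p)
    (A := Module.End K (K ⊗[k] C)) (S := S)
    (x := fun i => (T.x i).baseChange K) (e := e.baseChange K) (fun i j => (T.commute_x i j).eq)
    (fun i => by rw [← LinearMap.baseChange_pow, T.x_pow, LinearMap.baseChange_zero])
    (fun i => hmem (T.x_D i) (T.x_m i)) (hmem hD hm) (by
      have h' := congrArg β he
      simp only [map_sum, map_mul, map_pow, map_add, map_one] at h'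
      exact h') ha
  exact T.acyclic_of_geom_sum_eq_one (E := E) (hE _ (by simp [S])).symm
    (hE _ (by simp [S])).symm (hE _ (by simp [S])).symm h

end TComplex

end

section

open Topology TensorProduct

namespace Cochain

variable {k : Type} [Field k] {X : Type}

variable (k X) in
/-- Multiplication by a function of the number of vertices. -/
def lengthMul : (ℕ → k) →ₐ[k] Module.End k (Cochain k X) where
  toFun φ :=
    { toFun := fun f => ⟨fun l => φ l.length * f.1 l, by simp [f.2.1], by
        obtain ⟨n, hn⟩ := f.2.2
        exact ⟨n, fun l hl => by simp [hn l hl]⟩⟩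
      map_add' := fun f g => Subtype.ext (funext fun l => mul_add (φ l.length) (f.1 l) (g.1 l))
      map_smul' := fun r f =>
        Subtype.ext (funext fun l => mul_left_comm (φ l.length) r (f.1 l)) }
  map_one' := LinearMap.ext fun f => Subtype.ext (funext fun l => one_mul (f.1 l))
  map_mul' φ ψ := LinearMap.ext fun f =>
    Subtype.ext (funext fun l => mul_assoc (φ l.length) (ψ l.length) (f.1 l))
  map_zero' := LinearMap.ext fun f => Subtype.ext (funext fun l => zero_mul (f.1 l))
  map_add' φ ψ := LinearMap.ext fun f =>
    Subtype.ext (funext fun l => add_mul (φ l.length) (ψ l.length) (f.1 l))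
  commutes' _ := rfl

lemma lengthMul_d (φ : ℕ → k) (f : Cochain k X) :
    lengthMul k X φ (d k X f) = d k X (lengthMul k X (fun n => φ (n + 1)) f) :=
  Subtype.ext (funext fun l => (alternatingSum_length_mul φ f.1 l).symm)

variable (k) in
open Classical in
/-- Restriction to the sequences whose first vertex lies in `O`. -/
noncomputable def headMul (O : Set X) : Module.End k (Cochain k X) where
  toFun f := ⟨fun l => if ∃ x ∈ l.head?, x ∈ O then f.1 l else 0, by simp, by
    obtain ⟨n, hn⟩ := f.2.2
    exact ⟨n, fun l hl => by simp [hn l hl]⟩⟩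
  map_add' f g := Subtype.ext <| funext fun l => by
    change ite _ (f.1 l + g.1 l) 0 = ite _ (f.1 l) 0 + ite _ (g.1 l) 0
    split_ifs <;> simp
  map_smul' r f := Subtype.ext <| funext fun l => by
    change ite _ (r * f.1 l) 0 = r * ite _ (f.1 l) 0
    split_ifs <;> simp

lemma headMul_apply_of_subset {O U : Set X} (h : U ⊆ O) (f : Cochain k X) {l : List X}
    (hl : ∀ x ∈ l, x ∈ U) : (headMul k O f).1 l = f.1 l := by
  classical
  cases l with
  | nil => exact (headMul k O f).2.1.trans f.2.1.symm
  | cons x l => exact if_pos ⟨x, rfl, h (hl x List.mem_cons_self)⟩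

lemma headMul_apply_of_disjoint {O U : Set X} (h : ∀ x ∈ U, x ∉ O) (f : Cochain k X) {l : List X}
    (hl : ∀ x ∈ l, x ∈ U) : (headMul k O f).1 l = 0 := by
  classical
  cases l with
  | nil => exact (headMul k O f).2.1
  | cons x l =>
    refine if_neg ?_
    rintro ⟨y, hy, hyO⟩
    obtain rfl : x = y := by simpa using hy
    exact h x (hl x List.mem_cons_self) hyO

lemma headMul_lengthMul (O : Set X) (φ : ℕ → k) (f : Cochain k X) :
    headMul k O (lengthMul k X φ f) = lengthMul k X φ (headMul k O f) := by
  classical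
  refine Subtype.ext (funext fun l => ?_)
  change ite _ (φ l.length * f.1 l) 0 = φ l.length * ite _ (f.1 l) 0
  split_ifs <;> simp

lemma pullback_lengthMul (u : X → X) (φ : ℕ → k) (f : Cochain k X) :
    pullback k u (lengthMul k X φ f) = lengthMul k X φ (pullback k u f) := by
  refine Subtype.ext (funext fun l => ?_)
  change φ (l.map u).length * f.1 (l.map u) = φ l.length * f.1 (l.map u)
  rw [List.length_map]

lemma pullback_headMul (u : X → X) (O : Set X) (f : Cochain k X) :
    pullback k u (headMul k O f) = headMul k (u ⁻¹' O) (pullback k u f) := by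
  classical
  refine Subtype.ext (funext fun l => ?_)
  change ite _ (f.1 (l.map u)) 0 = ite _ (f.1 (l.map u)) 0
  refine if_congr ?_ rfl rfl
  cases l <;> simp

variable [TopologicalSpace X]

lemma lengthMul_mem_null {A : Set X} (φ : ℕ → k) {f : Cochain k X} (hf : f ∈ null k A) :
    lengthMul k X φ f ∈ null k A := by
  intro a ha
  obtain ⟨U, hU, hfU⟩ := hf a ha
  refine ⟨U, hU, fun l hl => ?_⟩
  change φ l.length * f.1 l = 0
  rw [hfU l hl, mul_zero]

lemma headMul_mem_null {A : Set X} (O : Set X) {f : Cochain k X} (hf : f ∈ null k A) :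
    headMul k O f ∈ null k A := by
  classical
  intro a ha
  obtain ⟨U, hU, hfU⟩ := hf a ha
  refine ⟨U, hU, fun l hl => ?_⟩
  change ite _ (f.1 l) 0 = 0
  rw [hfU l hl, ite_self]

lemma headMul_d_sub_mem_null {A O : Set X}
    (hO : ∀ a ∈ A, ∃ U ∈ 𝓝 a, U ⊆ O ∨ ∀ x ∈ U, x ∉ O) (f : Cochain k X) :
    headMul k O (d k X f) - d k X (headMul k O f) ∈ null k A := by
  intro a ha
  obtain ⟨U, hU, h⟩ := hO a ha
  refine ⟨U, hU, fun l hl => ?_⟩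
  change (headMul k O (d k X f)).1 l - alternatingSum (headMul k O f).1 l = 0
  rcases h with h | h
  · rw [headMul_apply_of_subset h _ hl]
    refine (alternatingSum_sub f.1 (headMul k O f).1 l).symm.trans
      (alternatingSum_eq_zero (fun l hl => ?_) l hl)
    exact sub_eq_zero.2 (headMul_apply_of_subset h f hl).symm
  · rw [headMul_apply_of_disjoint h _ hl, zero_sub, neg_eq_zero]
    exact alternatingSum_eq_zero (fun l hl => headMul_apply_of_disjoint h _ hl) l hl

variable (k) in
/-- The germs of cochains along `A`. -/
abbrev Germ (A : Set X) : Type := Cochain k X ⧸ null k A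

end Cochain

/-- Three commuting self-maps of a space, each with `p`-th iterate the identity. -/
structure Translations (p : ℕ) (X : Type) [TopologicalSpace X] where
  u : Fin 3 → X → X
  continuous_u : ∀ i, Continuous (u i)
  comm : ∀ i j, u i ∘ u j = u j ∘ u i
  iterate : ∀ i, (u i)^[p] = id

lemma sub_one_pow_eq_zero (k : Type*) [Field k] {p : ℕ} [Fact p.Prime] [CharP k p] {M : Type*}
    [Ring M] [Algebra k M] {x : M} (hx : x ^ p = 1) : (x - 1) ^ p = 0 := by
  have hp0 : (p : M) = 0 := by
    rw [← map_natCast (algebraMap k M), CharP.cast_eq_zero k p, map_zero]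
  obtain ⟨r, hr⟩ := (Commute.one_right (x - 1)).exists_add_pow_prime_eq (Fact.out : p.Prime)
  rw [hp0, sub_add_cancel, hx, one_pow] at hr
  simpa using hr

namespace Translations

open Cochain

variable {p : ℕ} {X : Type} [TopologicalSpace X] (S : Translations p X) {A : Set X}
  (hA : ∀ i, Set.MapsTo (S.u i) A A) (k : Type) [Field k]

/-- The action on germs. -/
def act (i : Fin 3) : Module.End k (Germ k A) :=
  (null k A).mapQ (null k A) (pullback k (S.u i)) fun _ hf =>
    pullback_mem_null (fun _ _ => (S.continuous_u i).continuousAt) (hA i) hf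

lemma act_mkQ (i : Fin 3) (f : Cochain k X) :
    S.act hA k i ((null k A).mkQ f) = (null k A).mkQ (pullback k (S.u i) f) := rfl

lemma act_pow_mkQ (i : Fin 3) (n : ℕ) (f : Cochain k X) :
    (S.act hA k i ^ n) ((null k A).mkQ f) = (null k A).mkQ (pullback k (S.u i)^[n] f) := by
  induction n with
  | zero => simp [pullback_id]
  | succ n ih =>
    rw [pow_succ', Module.End.mul_apply, ih, act_mkQ, pullback_pullback, Function.iterate_succ]

lemma act_pow (i : Fin 3) : S.act hA k i ^ p = 1 := by
  refine Submodule.linearMap_qext _ (LinearMap.ext fun f => ?_)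
  rw [LinearMap.comp_apply, act_pow_mkQ, S.iterate, pullback_id]
  rfl

lemma act_comm (i j : Fin 3) : S.act hA k i * S.act hA k j = S.act hA k j * S.act hA k i := by
  refine Submodule.linearMap_qext _ (LinearMap.ext fun f => ?_)
  simp only [LinearMap.comp_apply, Module.End.mul_apply, act_mkQ, pullback_pullback, S.comm i j]

/-- The germs of cochains along an invariant subset. -/
def germs [Fact p.Prime] [CharP k p] : TComplex k p (Germ k A) where
  D := (null k A).mapQ (null k A) (d k X) fun _ hf => d_mem_null hf
  m := AlgHom.ofLinearMap
    { toFun := fun φ => (null k A).mapQ (null k A) (lengthMul k X φ)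
        fun _ hf => lengthMul_mem_null φ hf
      map_add' := fun φ ψ => Submodule.linearMap_qext _ (LinearMap.ext fun f =>
        congrArg (null k A).mkQ (LinearMap.congr_fun (map_add (lengthMul k X) φ ψ) f))
      map_smul' := fun r φ => Submodule.linearMap_qext _ (LinearMap.ext fun f =>
        congrArg (null k A).mkQ (LinearMap.congr_fun (map_smul (lengthMul k X) r φ) f)) }
    (Submodule.linearMap_qext _ (LinearMap.ext fun f =>
        congrArg (null k A).mkQ (LinearMap.congr_fun (map_one (lengthMul k X)) f)))
    fun φ ψ => Submodule.linearMap_qext _ (LinearMap.ext fun f =>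
        congrArg (null k A).mkQ (LinearMap.congr_fun (map_mul (lengthMul k X) φ ψ) f))
  x i := S.act hA k i - 1
  D_sq := Submodule.linearMap_qext _ (LinearMap.ext fun f => congrArg (null k A).mkQ (d_d f))
  m_D φ := Submodule.linearMap_qext _ (LinearMap.ext fun f =>
    congrArg (null k A).mkQ (lengthMul_d φ f))
  bdd := by
    refine (Submodule.mkQ_surjective (null k A)).forall.2 fun f => ?_
    obtain ⟨n, hn⟩ := f.2.2
    refine ⟨n, congrArg (null k A).mkQ (Subtype.ext (funext fun l => ?_))⟩
    change (if l.length < n then (1 : k) else 0) * f.1 l = f.1 l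
    split_ifs with h
    · rw [one_mul]
    · rw [zero_mul, hn l (not_lt.1 h)]
  x_m i φ := by
    refine Commute.sub_left (?_ : S.act hA k i * _ = _) (Commute.one_left _)
    exact Submodule.linearMap_qext _ (LinearMap.ext fun f =>
      congrArg (null k A).mkQ (pullback_lengthMul (S.u i) φ f))
  x_D i := by
    refine Commute.sub_left (?_ : S.act hA k i * _ = _) (Commute.one_left _)
    exact Submodule.linearMap_qext _ (LinearMap.ext fun f =>
      congrArg (null k A).mkQ (d_pullback (S.u i) f).symm)
  x_comm i j := Commute.sub_left
    (Commute.sub_right (S.act_comm hA k i j) (Commute.one_right _)) (Commute.one_left _)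
  x_pow i := sub_one_pow_eq_zero k (S.act_pow hA k i)

end Translations

end

section

open Topology TensorProduct

namespace Translations

open Cochain

variable {p : ℕ} {X : Type} [TopologicalSpace X] (S : Translations p X) {A : Set X}
  (hA : ∀ i, Set.MapsTo (S.u i) A A) (k : Type) [Field k]

/-- A product of powers of the three translations. -/
def word (i j l : ℕ) : X → X := (S.u 2)^[l] ∘ (S.u 1)^[j] ∘ (S.u 0)^[i]

lemma continuous_word (i j l : ℕ) : Continuous (S.word i j l) :=
  ((S.continuous_u 2).iterate l).comp
    (((S.continuous_u 1).iterate j).comp ((S.continuous_u 0).iterate i))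

variable (A) in
/-- Restriction of germs to the sequences starting in `O`. -/
noncomputable def headGerm (O : Set X) : Module.End k (Germ k A) :=
  (null k A).mapQ (null k A) (headMul k O) fun _ hf => headMul_mem_null O hf

lemma act_mul_headGerm (i j l : ℕ) (O : Set X) :
    S.act hA k 0 ^ i * S.act hA k 1 ^ j * S.act hA k 2 ^ l * headGerm A k O =
      headGerm A k (S.word i j l ⁻¹' O) *
        (S.act hA k 0 ^ i * S.act hA k 1 ^ j * S.act hA k 2 ^ l) := by
  have h (f : Cochain k X) : (S.act hA k 0 ^ i * S.act hA k 1 ^ j * S.act hA k 2 ^ l)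
      ((null k A).mkQ f) = (null k A).mkQ (pullback k (S.word i j l) f) := by
    simp only [Module.End.mul_apply, act_pow_mkQ, pullback_pullback]
    rfl
  refine Submodule.linearMap_qext _ (LinearMap.ext fun f => ?_)
  have h' : headGerm A k O ((null k A).mkQ f) = (null k A).mkQ (headMul k O f) := rfl
  rw [LinearMap.comp_apply, LinearMap.comp_apply, Module.End.mul_apply (_ * _) (headGerm A k O),
    Module.End.mul_apply (headGerm A k _), h', h, h, pullback_headMul]
  rfl

lemma mul_mul_mul_comm_three {M : Type*} [Monoid M] {x y z x' y' z' : M} (h1 : Commute y x')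
    (h2 : Commute z x') (h3 : Commute z y') :
    x * y * z * (x' * y' * z') = x * x' * (y * y') * (z * z') := by
  rw [(h2.mul_right h3).mul_mul_mul_comm, h1.mul_mul_mul_comm]

lemma act_pow_mul_act_pow {i j l : ℕ} (hi : i < p) (hj : j < p) (hl : l < p) :
    S.act hA k 0 ^ i * S.act hA k 1 ^ j * S.act hA k 2 ^ l *
      (S.act hA k 0 * S.act hA k 1 * S.act hA k 2 *
        (S.act hA k 0 ^ (p - 1 - i) * S.act hA k 1 ^ (p - 1 - j) * S.act hA k 2 ^ (p - 1 - l))) =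
      1 := by
  have h (i j : Fin 3) : Commute (S.act hA k i) (S.act hA k j) := S.act_comm hA k i j
  rw [mul_mul_mul_comm_three ((h 1 0).pow_right _) ((h 2 0).pow_right _) ((h 2 1).pow_right _),
    mul_mul_mul_comm_three (((h 1 0).mul_right ((h 1 0).pow_right _)).pow_left _)
      (((h 2 0).mul_right ((h 2 0).pow_right _)).pow_left _)
      (((h 2 1).mul_right ((h 2 1).pow_right _)).pow_left _)]
  simp only [← pow_succ', ← pow_add]
  rw [show i + (p - 1 - i + 1) = p by omega, show j + (p - 1 - j + 1) = p by omega,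
    show l + (p - 1 - l + 1) = p by omega]
  simp only [act_pow, mul_one]

variable {O : Set X} (hO : IsOpen O)
  (huniq : ∀ x, ∀ i < p, ∀ j < p, ∀ l < p, ∀ i' < p, ∀ j' < p, ∀ l' < p,
    S.word i j l x ∈ O → S.word i' j' l' x ∈ O → i = i' ∧ j = j' ∧ l = l')
  (hcov : ∀ a ∈ A, ∃ i < p, ∃ j < p, ∃ l < p, S.word i j l a ∈ O)
include hO huniq hcov

lemma sum_headGerm : ∑ i ∈ Finset.range p, ∑ j ∈ Finset.range p, ∑ l ∈ Finset.range p,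
    headGerm A k (S.word i j l ⁻¹' O) = 1 := by
  refine Submodule.linearMap_qext _ (LinearMap.ext fun f => ?_)
  have h (i j l) : headGerm A k (S.word i j l ⁻¹' O) ((null k A).mkQ f) =
    (null k A).mkQ (headMul k (S.word i j l ⁻¹' O) f) := rfl
  simp only [LinearMap.comp_apply, LinearMap.sum_apply, h, ← map_sum, Module.End.one_apply]
  refine (Submodule.Quotient.eq _).2 fun a ha => ?_
  obtain ⟨i, hi, j, hj, l, hl, hmem⟩ := hcov a ha
  refine ⟨S.word i j l ⁻¹' O, (hO.preimage (S.continuous_word i j l)).mem_nhds hmem,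
    fun v hv => ?_⟩
  have h0 : ∀ i' < p, ∀ j' < p, ∀ l' < p, ¬ (i = i' ∧ j = j' ∧ l = l') →
      (headMul k (S.word i' j' l' ⁻¹' O) f).1 v = 0 := fun i' hi' j' hj' l' hl' hne =>
    headMul_apply_of_disjoint (fun x hx hx' =>
      hne (huniq x i hi j hj l hl i' hi' j' hj' l' hl' hx hx')) f hv
  simp only [AddSubgroupClass.coe_sub, Submodule.coe_sum, Pi.sub_apply, Finset.sum_apply]
  rw [Finset.sum_eq_single i, Finset.sum_eq_single j, Finset.sum_eq_single l,
    headMul_apply_of_subset subset_rfl f hv, sub_self]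
  · exact fun l' hl' hne => h0 i hi j hj l' (Finset.mem_range.1 hl') fun h => hne h.2.2.symm
  · exact fun h => (h (Finset.mem_range.2 hl)).elim
  · exact fun j' hj' hne => Finset.sum_eq_zero fun l' hl' =>
      h0 i hi j' (Finset.mem_range.1 hj') l' (Finset.mem_range.1 hl') fun h => hne h.2.1.symm
  · exact fun h => (h (Finset.mem_range.2 hj)).elim
  · exact fun i' hi' hne => Finset.sum_eq_zero fun j' hj' => Finset.sum_eq_zero fun l' hl' =>
      h0 i' (Finset.mem_range.1 hi') j' (Finset.mem_range.1 hj') l' (Finset.mem_range.1 hl')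
        fun h => hne h.1.symm
  · exact fun h => (h (Finset.mem_range.2 hi)).elim

lemma acyclic_of_slice [Fact p.Prime] [CharP k p] {K : Type} [Field K] [Algebra k K]
    {a : Fin 3 → K} (ha : a ≠ 0) : (S.germs hA k).Acyclic a := by
  have hp := (Fact.out : p.Prime).pos
  have hloc : ∀ a ∈ A, ∃ U ∈ 𝓝 a, U ⊆ O ∨ ∀ x ∈ U, x ∉ O := by
    intro a ha
    obtain ⟨i, hi, j, hj, l, hl, hmem⟩ := hcov a ha
    refine ⟨S.word i j l ⁻¹' O, (hO.preimage (S.continuous_word i j l)).mem_nhds hmem, ?_⟩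
    by_cases h0 : i = 0 ∧ j = 0 ∧ l = 0
    · obtain ⟨rfl, rfl, rfl⟩ := h0
      exact Or.inl subset_rfl
    · exact Or.inr fun x hx hx' => h0 (huniq x i hi j hj l hl 0 hp 0 hp 0 hp hx hx')
  have hx (i : Fin 3) : 1 + (S.germs hA k).x i = S.act hA k i := add_sub_cancel _ _
  have hxD (i : Fin 3) : Commute (S.act hA k i) (S.germs hA k).D := by
    rw [← hx]
    exact (Commute.one_left _).add_left ((S.germs hA k).x_D i)
  have hxm (i : Fin 3) (φ) : Commute (S.act hA k i) ((S.germs hA k).m φ) := by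
    rw [← hx]
    exact (Commute.one_left _).add_left ((S.germs hA k).x_m i φ)
  have hD : Commute (headGerm A k O) (S.germs hA k).D :=
    Submodule.linearMap_qext _ (LinearMap.ext fun f =>
      (Submodule.Quotient.eq _).2 (headMul_d_sub_mem_null hloc f))
  have hm (φ) : Commute (headGerm A k O) ((S.germs hA k).m φ) :=
    Submodule.linearMap_qext _ (LinearMap.ext fun f =>
      congrArg (null k A).mkQ (headMul_lengthMul O φ f))
  refine TComplex.acyclic_of_sum_eq_one (S.germs hA k)
    (e := headGerm A k O * (S.act hA k 0 * S.act hA k 1 * S.act hA k 2))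
    (hD.mul_left (((hxD 0).mul_left (hxD 1)).mul_left (hxD 2)))
    (fun φ => (hm φ).mul_left (((hxm 0 φ).mul_left (hxm 1 φ)).mul_left (hxm 2 φ))) ?_ ha
  simp only [hx]
  refine Eq.trans ?_ (S.sum_headGerm k hO huniq hcov)
  refine Finset.sum_congr rfl fun i hi => Finset.sum_congr rfl fun j hj =>
    Finset.sum_congr rfl fun l hl => ?_
  rw [← mul_assoc _ (headGerm A k O), act_mul_headGerm, mul_assoc (_ * _) (_ * _ * _),
    mul_assoc (headGerm A k _), act_pow_mul_act_pow,
    mul_one]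
  exacts [Finset.mem_range.1 hi, Finset.mem_range.1 hj, Finset.mem_range.1 hl]

end Translations

end

section

open Topology TensorProduct

namespace TComplex

section Chase

variable {R M N P Q : Type*} [Ring R] [AddCommGroup M] [Module R M] [AddCommGroup N] [Module R N]
  [AddCommGroup P] [Module R P] [AddCommGroup Q] [Module R Q]

/-- The diagram chase behind the Mayer--Vietoris sequence. -/
lemma exists_preimage_of_pullback {r : M →ₗ[R] N} {s : M →ₗ[R] P} {r' : N →ₗ[R] Q}
    {s' : P →ₗ[R] Q} (hrs : ∀ c, r' (r c) = s' (s c)) (hr' : Function.Surjective r')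
    (hinj : ∀ c, r c = 0 → s c = 0 → c = 0)
    (hglue : ∀ x y, r' x = s' y → ∃ c, r c = x ∧ s c = y)
    {E F : Module.End R M} {EN FN : Module.End R N} {EP FP : Module.End R P}
    {EQ FQ : Module.End R Q} (hrE : ∀ c, r (E c) = EN (r c)) (hrF : ∀ c, r (F c) = FN (r c))
    (hsE : ∀ c, s (E c) = EP (s c)) (hsF : ∀ c, s (F c) = FP (s c))
    (hr'E : ∀ c, r' (EN c) = EQ (r' c)) (hr'F : ∀ c, r' (FN c) = FQ (r' c))
    (hs'F : ∀ c, s' (FP c) = FQ (s' c)) (hFE : ∀ c, FN (EN c) = 0)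
    (hN : ∀ c, EN c = 0 → ∃ w, FN w = c) (hP : ∀ c, EP c = 0 → ∃ w, FP w = c)
    (hQ : ∀ c, FQ c = 0 → ∃ w, EQ w = c) {c : M} (hc : E c = 0) : ∃ w, F w = c := by
  obtain ⟨x, hx⟩ := hN (r c) (by rw [← hrE, hc, map_zero])
  obtain ⟨y, hy⟩ := hP (s c) (by rw [← hsE, hc, map_zero])
  obtain ⟨z, hz⟩ := hQ (r' x - s' y) (by
    rw [map_sub, ← hr'F, ← hs'F, hx, hy, hrs, sub_self])
  obtain ⟨t, rfl⟩ := hr' z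
  obtain ⟨w, hw, hw'⟩ := hglue (x - EN t) y (by rw [map_sub, hr'E, hz, sub_sub_cancel])
  refine ⟨w, sub_eq_zero.1 (hinj _ ?_ ?_)⟩
  · rw [map_sub, hrF, hw, map_sub, hFE, sub_zero, hx, sub_self]
  · rw [map_sub, hsF, hw', hy, sub_self]

end Chase

variable {k : Type} [Field k]

section Splitting

variable {M N P Q : Type} [AddCommGroup M] [Module k M] [AddCommGroup N]
  [Module k N] [AddCommGroup P] [Module k P] [AddCommGroup Q] [Module k Q]
  {r : M →ₗ[k] N} {s : M →ₗ[k] P} {r' : N →ₗ[k] Q} {s' : P →ₗ[k] Q}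

lemma exists_splitting (hrs : r' ∘ₗ r = s' ∘ₗ s) (hr' : Function.Surjective r')
    (hinj : ∀ c, r c = 0 → s c = 0 → c = 0)
    (hglue : ∀ x y, r' x = s' y → ∃ c, r c = x ∧ s c = y) :
    ∃ (τ : Q →ₗ[k] N) (γ : N →ₗ[k] M) (δ : P →ₗ[k] M), r' ∘ₗ τ = .id ∧
      γ ∘ₗ r + δ ∘ₗ s = .id ∧ r ∘ₗ γ + τ ∘ₗ r' = .id ∧ s ∘ₗ γ = 0 ∧ r ∘ₗ δ = τ ∘ₗ s' ∧
      s ∘ₗ δ = .id := by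
  obtain ⟨τ, hτ⟩ := LinearMap.exists_rightInverse_of_surjective r' (LinearMap.range_eq_top.2 hr')
  obtain ⟨γ, hγ⟩ := LinearMap.exists_leftInverse_of_injective (r.prod s)
    (LinearMap.ker_eq_bot'.2 fun c hc => hinj c (congrArg Prod.fst hc) (congrArg Prod.snd hc))
  have hγ' (x : N) (y : P) (h : r' x = s' y) : r (γ (x, y)) = x ∧ s (γ (x, y)) = y := by
    obtain ⟨c, rfl, rfl⟩ := hglue x y h
    have : γ (r c, s c) = c := LinearMap.congr_fun hγ c
    rw [this]
    exact ⟨rfl, rfl⟩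
  have hτ' (z : Q) : r' (τ z) = z := LinearMap.congr_fun hτ z
  have h1 (x : N) := hγ' (x - τ (r' x)) 0 (by rw [map_sub, hτ', sub_self, map_zero])
  have h2 (y : P) := hγ' (τ (s' y)) y (hτ' _)
  refine ⟨τ, γ ∘ₗ (LinearMap.id - τ ∘ₗ r').prod 0, γ ∘ₗ (τ ∘ₗ s').prod .id, hτ, ?_, ?_, ?_, ?_, ?_⟩
  · ext c
    have hc : r' (r c) = s' (s c) := LinearMap.congr_fun hrs c
    have : γ (r c, s c) = c := LinearMap.congr_fun hγ c
    change γ (r c - τ (r' (r c)), 0) + γ (τ (s' (s c)), s c) = c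
    rw [← map_add, Prod.mk_add_mk, zero_add, hc, sub_add_cancel, this]
  · ext x
    change r (γ (x - τ (r' x), 0)) + τ (r' x) = x
    rw [(h1 x).1, sub_add_cancel]
  · exact LinearMap.ext fun x => (h1 x).2
  · exact LinearMap.ext fun y => (h2 y).1
  · exact LinearMap.ext fun y => (h2 y).2

lemma baseChange_pullback (hrs : r' ∘ₗ r = s' ∘ₗ s) (hr' : Function.Surjective r')
    (hinj : ∀ c, r c = 0 → s c = 0 → c = 0)
    (hglue : ∀ x y, r' x = s' y → ∃ c, r c = x ∧ s c = y) (R : Type) [CommRing R] [Algebra k R] :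
    Function.Surjective (r'.baseChange R) ∧
    (∀ c, r.baseChange R c = 0 → s.baseChange R c = 0 → c = 0) ∧
    ∀ x y, r'.baseChange R x = s'.baseChange R y →
      ∃ c, r.baseChange R c = x ∧ s.baseChange R c = y := by
  obtain ⟨τ, γ, δ, h1, h2, h3, h4, h5, h6⟩ := exists_splitting hrs hr' hinj hglue
  have e1 (z) : r'.baseChange R (τ.baseChange R z) = z := by
    rw [← LinearMap.comp_apply, ← LinearMap.baseChange_comp, h1, LinearMap.baseChange_id,
      LinearMap.id_apply]
  have e2 (c) : γ.baseChange R (r.baseChange R c) + δ.baseChange R (s.baseChange R c) = c := by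
    rw [← LinearMap.comp_apply, ← LinearMap.baseChange_comp, ← LinearMap.comp_apply,
      ← LinearMap.baseChange_comp, ← LinearMap.add_apply, ← LinearMap.baseChange_add, h2,
      LinearMap.baseChange_id, LinearMap.id_apply]
  have e3 (x) : r.baseChange R (γ.baseChange R x) + τ.baseChange R (r'.baseChange R x) = x := by
    rw [← LinearMap.comp_apply, ← LinearMap.baseChange_comp, ← LinearMap.comp_apply,
      ← LinearMap.baseChange_comp, ← LinearMap.add_apply, ← LinearMap.baseChange_add, h3,
      LinearMap.baseChange_id, LinearMap.id_apply]
  have e4 (x) : s.baseChange R (γ.baseChange R x) = 0 := by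
    rw [← LinearMap.comp_apply, ← LinearMap.baseChange_comp, h4, LinearMap.baseChange_zero,
      LinearMap.zero_apply]
  have e5 (y) : r.baseChange R (δ.baseChange R y) = τ.baseChange R (s'.baseChange R y) := by
    rw [← LinearMap.comp_apply, ← LinearMap.baseChange_comp, h5, LinearMap.baseChange_comp,
      LinearMap.comp_apply]
  have e6 (y) : s.baseChange R (δ.baseChange R y) = y := by
    rw [← LinearMap.comp_apply, ← LinearMap.baseChange_comp, h6, LinearMap.baseChange_id,
      LinearMap.id_apply]
  refine ⟨fun z => ⟨_, e1 z⟩, fun c hr hs => ?_, fun x y h => ?_⟩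
  · rw [← e2 c, hr, hs, map_zero, map_zero, add_zero]
  · refine ⟨γ.baseChange R x + δ.baseChange R y, ?_, ?_⟩
    · rw [map_add, e5, ← h, e3]
    · rw [map_add, e4, e6, zero_add]

end Splitting

variable {p : ℕ} {C C' : Type} [AddCommGroup C] [Module k C] [AddCommGroup C'] [Module k C']

lemma baseChange_comp_apply {R : Type} [CommRing R] [Algebra k R] {F : C →ₗ[k] C'}
    {g : Module.End k C} {g' : Module.End k C'} (h : F ∘ₗ g = g' ∘ₗ F)
    (c : R ⊗[k] C) : F.baseChange R (g.baseChange R c) = g'.baseChange R (F.baseChange R c) := by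
  rw [← LinearMap.comp_apply, ← LinearMap.baseChange_comp, h, LinearMap.baseChange_comp,
    LinearMap.comp_apply]

/-- A linear map compatible with the structure maps. -/
structure IsHom (T : TComplex k p C) (T' : TComplex k p C') (F : C →ₗ[k] C') : Prop where
  map_D : F ∘ₗ T.D = T'.D ∘ₗ F
  map_m : ∀ φ, F ∘ₗ T.m φ = T'.m φ ∘ₗ F
  map_x : ∀ i, F ∘ₗ T.x i = T'.x i ∘ₗ F

namespace IsHom

variable {T : TComplex k p C} {T' : TComplex k p C'} {F : C →ₗ[k] C'} (hF : IsHom T T' F)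
  {R : Type} [CommRing R] [Algebra k R] (a : Fin 3 → R)
include hF

lemma map_shift (c : R ⊗[k] C) :
    F.baseChange R (T.shift a c) = T'.shift a (F.baseChange R c) := by
  simp only [shift, LinearMap.sum_apply, LinearMap.smul_apply, map_sum, map_smul,
    baseChange_comp_apply (hF.map_x _)]

lemma map_shift_pow (n : ℕ) (c : R ⊗[k] C) :
    F.baseChange R ((T.shift a ^ n) c) = (T'.shift a ^ n) (F.baseChange R c) := by
  induction n with
  | zero => simp
  | succ n ih => rw [pow_succ', pow_succ', Module.End.mul_apply, Module.End.mul_apply,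
      hF.map_shift, ih]

lemma map_pert₀ (c : R ⊗[k] C) : F.baseChange R ((T.D.baseChange R + T.pert₀ a) c) =
    (T'.D.baseChange R + T'.pert₀ a) (F.baseChange R c) := by
  simp only [pert₀, LinearMap.add_apply, LinearMap.sub_apply, Module.End.mul_apply, map_add,
    map_sub, baseChange_comp_apply hF.map_D, hF.map_shift, hF.map_shift_pow, even, odd,
    baseChange_comp_apply (hF.map_m _)]

lemma map_pert₁ (c : R ⊗[k] C) : F.baseChange R ((T.D.baseChange R + T.pert₁ a) c) =
    (T'.D.baseChange R + T'.pert₁ a) (F.baseChange R c) := by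
  simp only [pert₁, LinearMap.add_apply, LinearMap.sub_apply, Module.End.mul_apply, map_add,
    map_sub, baseChange_comp_apply hF.map_D, hF.map_shift, hF.map_shift_pow, even, odd,
    baseChange_comp_apply (hF.map_m _)]

end IsHom

lemma differential_relations [Fact p.Prime] [CharP k p] (T : TComplex k p C) {R : Type}
    [CommRing R] [Algebra k R] (a : Fin 3 → R) :
    (T.D.baseChange R + T.pert₀ a) * (T.D.baseChange R + T.pert₁ a) = 0 ∧
    (T.D.baseChange R + T.pert₁ a) * (T.D.baseChange R + T.pert₀ a) = 0 := by
  obtain ⟨h1, h2, h3, h4⟩ := T.pert_relations a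
  have hD : T.D.baseChange R * T.D.baseChange R = 0 := by
    rw [← LinearMap.baseChange_mul, T.D_sq, LinearMap.baseChange_zero]
  constructor
  · rw [add_mul, mul_add, mul_add, hD, h2, h4]
    abel
  · rw [add_mul, mul_add, mul_add, hD, h1, h3]
    abel

variable {N P Q : Type} [AddCommGroup N] [Module k N] [AddCommGroup P] [Module k P]
  [AddCommGroup Q] [Module k Q]

lemma Acyclic.of_pullback [Fact p.Prime] [CharP k p] {T : TComplex k p C} {TN : TComplex k p N}
    {TP : TComplex k p P} {TQ : TComplex k p Q} {r : C →ₗ[k] N} {s : C →ₗ[k] P} {r' : N →ₗ[k] Q}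
    {s' : P →ₗ[k] Q} (hr : IsHom T TN r) (hs : IsHom T TP s) (hr' : IsHom TN TQ r')
    (hs' : IsHom TP TQ s') (hrs : r' ∘ₗ r = s' ∘ₗ s) (hsurj : Function.Surjective r')
    (hinj : ∀ c, r c = 0 → s c = 0 → c = 0)
    (hglue : ∀ x y, r' x = s' y → ∃ c, r c = x ∧ s c = y) {K : Type} [CommRing K] [Algebra k K]
    {a : Fin 3 → K} (hN : TN.Acyclic a) (hP : TP.Acyclic a) (hQ : TQ.Acyclic a) :
    T.Acyclic a := by
  obtain ⟨h1, h2, h3⟩ := baseChange_pullback hrs hsurj hinj hglue K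
  have h0 (c) : r'.baseChange K (r.baseChange K c) = s'.baseChange K (s.baseChange K c) := by
    rw [← LinearMap.comp_apply, ← LinearMap.baseChange_comp, hrs, LinearMap.baseChange_comp,
      LinearMap.comp_apply]
  obtain ⟨h4, h5⟩ := TN.differential_relations a
  exact ⟨fun c hc => exists_preimage_of_pullback h0 h1 h2 h3 (hr.map_pert₀ a) (hr.map_pert₁ a)
      (hs.map_pert₀ a) (hs.map_pert₁ a) (hr'.map_pert₀ a) (hr'.map_pert₁ a) (hs'.map_pert₁ a)
      (LinearMap.congr_fun h5) hN.1 hP.1 hQ.2 hc,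
    fun c hc => exists_preimage_of_pullback h0 h1 h2 h3 (hr.map_pert₁ a) (hr.map_pert₀ a)
      (hs.map_pert₁ a) (hs.map_pert₀ a) (hr'.map_pert₁ a) (hr'.map_pert₀ a) (hs'.map_pert₀ a)
      (LinearMap.congr_fun h4) hN.2 hP.2 hQ.1 hc⟩

end TComplex

namespace Translations

open Cochain

variable {p : ℕ} {X : Type} [TopologicalSpace X] (S : Translations p X) {A B : Set X}
  (hA : ∀ i, Set.MapsTo (S.u i) A A) (hB : ∀ i, Set.MapsTo (S.u i) B B) (k : Type) [Field k]

/-- Restriction of germs to a smaller subset. -/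
def res (h : B ⊆ A) : Germ k A →ₗ[k] Germ k B := Submodule.factor (null_anti h)

variable [Fact p.Prime] [CharP k p]

lemma isHom_res (h : B ⊆ A) : TComplex.IsHom (S.germs hA k) (S.germs hB k) (res k h) where
  map_D := Submodule.linearMap_qext _ (LinearMap.ext fun _ => rfl)
  map_m _ := Submodule.linearMap_qext _ (LinearMap.ext fun _ => rfl)
  map_x _ := Submodule.linearMap_qext _ (LinearMap.ext fun _ => rfl)

lemma acyclic_union [T2Space X] (hAc : IsCompact A) (hBc : IsCompact B) {K : Type} [CommRing K]
    [Algebra k K] {a : Fin 3 → K} (h1 : (S.germs hA k).Acyclic a) (h2 : (S.germs hB k).Acyclic a)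
    (h3 : (S.germs (fun i => (hA i).inter_inter (hB i)) k).Acyclic a) :
    (S.germs (fun i => (hA i).union_union (hB i)) k).Acyclic a := by
  refine TComplex.Acyclic.of_pullback (S.isHom_res _ _ k Set.subset_union_left)
    (S.isHom_res _ _ k Set.subset_union_right) (S.isHom_res _ _ k Set.inter_subset_left)
    (S.isHom_res _ _ k Set.inter_subset_right) ?_ ?_ ?_ ?_ h1 h2 h3
  · exact Submodule.linearMap_qext _ (LinearMap.ext fun _ => rfl)
  · exact Submodule.factor_surjective (null_anti Set.inter_subset_left)
  · refine (Submodule.mkQ_surjective _).forall.2 fun f hfA hfB => ?_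
    exact (Submodule.Quotient.mk_eq_zero _).2 (mem_null_union
      ((Submodule.Quotient.mk_eq_zero _).1 hfA) ((Submodule.Quotient.mk_eq_zero _).1 hfB))
  · refine (Submodule.mkQ_surjective _).forall.2 fun f =>
      (Submodule.mkQ_surjective _).forall.2 fun g hfg => ?_
    obtain ⟨w, hwf, hwg⟩ := exists_glue hAc hBc ((Submodule.Quotient.eq _).1 hfg)
    exact ⟨Submodule.Quotient.mk w, (Submodule.Quotient.eq _).2 hwf,
      (Submodule.Quotient.eq _).2 hwg⟩

end Translations

end

section

open Topology TensorProduct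

namespace Translations

open Cochain

variable {p : ℕ} {X : Type} [TopologicalSpace X] (S : Translations p X)

lemma iterate_comm (i j : Fin 3) (m n : ℕ) (x : X) :
    (S.u i)^[m] ((S.u j)^[n] x) = (S.u j)^[n] ((S.u i)^[m] x) :=
  (Function.Commute.iterate_iterate (f := S.u i) (g := S.u j)
    (fun x => congrFun (S.comm i j) x) m n) x

lemma word_word (i j l i' j' l' : ℕ) (x : X) :
    S.word i j l (S.word i' j' l' x) = S.word (i + i') (j + j') (l + l') x := by
  simp only [word, Function.comp_apply, Function.iterate_add_apply]
  rw [S.iterate_comm 0 2, S.iterate_comm 0 1, S.iterate_comm 1 2]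

lemma iterate_mod (i : Fin 3) (n : ℕ) : (S.u i)^[n % p] = (S.u i)^[n] := by
  ext x
  exact Function.IsPeriodicPt.iterate_mod_apply (congrFun (S.iterate i) x) n

lemma word_mod (i j l : ℕ) : S.word (i % p) (j % p) (l % p) = S.word i j l := by
  simp only [word, iterate_mod]

lemma word_eq_of_modEq {i j l i' j' l' : ℕ} (hi : i ≡ i' [MOD p]) (hj : j ≡ j' [MOD p])
    (hl : l ≡ l' [MOD p]) : S.word i j l = S.word i' j' l' := by
  rw [← S.word_mod i j l, hi, hj, hl, word_mod]

/-- The action generated by the translations is free. -/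
def Free : Prop := ∀ x i j l, S.word i j l x = x → p ∣ i ∧ p ∣ j ∧ p ∣ l

lemma Free.exists_slice [T2Space X] (hp : 0 < p) (hS : S.Free) (x : X) :
    ∃ O, IsOpen O ∧ x ∈ O ∧ ∀ y, ∀ i < p, ∀ j < p, ∀ l < p, ∀ i' < p, ∀ j' < p, ∀ l' < p,
      S.word i j l y ∈ O → S.word i' j' l' y ∈ O → i = i' ∧ j = j' ∧ l = l' := by
  have h (t : ℕ × ℕ × ℕ) : ∃ N, IsOpen N ∧ x ∈ N ∧
      ∀ y ∈ N, S.word t.1 t.2.1 t.2.2 y ∈ N → p ∣ t.1 ∧ p ∣ t.2.1 ∧ p ∣ t.2.2 := by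
    by_cases ht : S.word t.1 t.2.1 t.2.2 x = x
    · exact ⟨Set.univ, isOpen_univ, trivial, fun _ _ _ => hS x _ _ _ ht⟩
    · obtain ⟨U, V, hU, hV, hxU, hxV, hUV⟩ := t2_separation ht
      exact ⟨V ∩ S.word t.1 t.2.1 t.2.2 ⁻¹' U, hV.inter (hU.preimage (S.continuous_word _ _ _)),
        ⟨hxV, hxU⟩, fun y hy hy' => (Set.disjoint_left.1 hUV hy.2 hy'.1).elim⟩
  choose N hN hxN hNN using h
  refine ⟨⋂ t ∈ Finset.range p ×ˢ Finset.range p ×ˢ Finset.range p, N t,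
    isOpen_biInter_finset fun t _ => hN t, Set.mem_iInter₂.2 fun t _ => hxN t, ?_⟩
  intro y i hi j hj l hl i' hi' j' hj' l' hl' hy hy'
  have hw : S.word ((p - i + i') % p) ((p - j + j') % p) ((p - l + l') % p) (S.word i j l y) =
      S.word i' j' l' y := by
    rw [word_mod, word_word, show p - i + i' + i = i' + p by omega,
      show p - j + j' + j = j' + p by omega, show p - l + l' + l = l' + p by omega]
    exact congrFun (S.word_eq_of_modEq (Nat.add_modEq_right) (Nat.add_modEq_right)
      (Nat.add_modEq_right)) y
  have ht : ((p - i + i') % p, (p - j + j') % p, (p - l + l') % p) ∈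
      Finset.range p ×ˢ Finset.range p ×ˢ Finset.range p := by
    simp [Nat.mod_lt _ hp]
  obtain ⟨h1, h2, h3⟩ := hNN _ _ (Set.mem_iInter₂.1 hy _ ht)
    (by dsimp only; rw [hw]; exact Set.mem_iInter₂.1 hy' _ ht)
  have key {i i' : ℕ} (hi : i < p) (hi' : i' < p) (h : p ∣ (p - i + i') % p) : i = i' := by
    obtain ⟨c, hc⟩ := (Nat.dvd_mod_iff dvd_rfl).1 h
    have h1 : c < 2 := by
      by_contra! h
      nlinarith [Nat.sub_add_cancel hi.le]
    have h2 : c ≠ 0 := by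
      rintro rfl
      omega
    obtain rfl : c = 1 := by omega
    omega
  exact ⟨key hi hi' h1, key hj hj' h2, key hl hl' h3⟩

variable (k : Type) [Field k] [Fact p.Prime] [CharP k p] {K : Type} [Field K] [Algebra k K]

/-- Acyclicity of the germs along every closed invariant subset of `A`. -/
def AcyclicOn (a : Fin 3 → K) (A : Set X) : Prop :=
  ∀ B ⊆ A, IsClosed B → ∀ hB : ∀ i, Set.MapsTo (S.u i) B B, (S.germs hB k).Acyclic a

variable {a : Fin 3 → K}

lemma AcyclicOn.union [CompactSpace X] [T2Space X] {A B : Set X} (hA : IsClosed A)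
    (hB : IsClosed B) (hAi : ∀ i, Set.MapsTo (S.u i) A A) (hBi : ∀ i, Set.MapsTo (S.u i) B B)
    (h : S.AcyclicOn k a A) (h' : S.AcyclicOn k a B) : S.AcyclicOn k a (A ∪ B) := by
  intro E hE hEc hEi
  have h1 := h (E ∩ A) Set.inter_subset_right (hEc.inter hA) fun i => (hEi i).inter_inter (hAi i)
  have h2 := h' (E ∩ B) Set.inter_subset_right (hEc.inter hB) fun i => (hEi i).inter_inter (hBi i)
  have h3 := h ((E ∩ A) ∩ (E ∩ B)) (Set.inter_subset_left.trans Set.inter_subset_right)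
    ((hEc.inter hA).inter (hEc.inter hB)) fun i =>
      ((hEi i).inter_inter (hAi i)).inter_inter ((hEi i).inter_inter (hBi i))
  have h4 := S.acyclic_union _ _ k (hEc.inter hA).isCompact (hEc.inter hB).isCompact h1 h2 h3
  have hE' : E ∩ A ∪ E ∩ B = E := by
    rw [← Set.inter_union_distrib_left, Set.inter_eq_left.2 hE]
  revert h4
  generalize_proofs h5
  revert h5
  rw [hE']
  exact fun _ h => h

lemma Free.acyclic [CompactSpace X] [T2Space X] (hS : S.Free) (ha : a ≠ 0) :
    (S.germs (A := Set.univ) (fun _ => Set.mapsTo_univ _ _) k).Acyclic a := by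
  have hp := (Fact.out : p.Prime).pos
  suffices h : ∃ A, Set.univ ⊆ A ∧ IsClosed A ∧ (∀ i, Set.MapsTo (S.u i) A A) ∧
      S.AcyclicOn k a A by
    obtain ⟨A, huA, -, -, hA⟩ := h
    exact hA Set.univ huA isClosed_univ _
  refine isCompact_univ.induction_on (p := fun s : Set X => ∃ A, s ⊆ A ∧
    IsClosed A ∧ (∀ i, Set.MapsTo (S.u i) A A) ∧ S.AcyclicOn k a A) ?_ ?_ ?_ ?_
  · refine ⟨∅, subset_rfl, isClosed_empty, fun i => Set.mapsTo_empty _ _, fun B hB _ hBi => ?_⟩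
    exact S.acyclic_of_slice hBi k (O := ∅) isOpen_empty (by simp)
      (fun b hb => (hB hb).elim) ha
  · rintro s t hst ⟨A, htA, hA⟩
    exact ⟨A, hst.trans htA, hA⟩
  · rintro s t ⟨A, hsA, hA, hAi, hAa⟩ ⟨B, htB, hB, hBi, hBa⟩
    exact ⟨A ∪ B, Set.union_subset_union hsA htB, hA.union hB,
      fun i => (hAi i).union_union (hBi i), AcyclicOn.union S k hA hB hAi hBi hAa hBa⟩
  · intro x _
    obtain ⟨O, hO, hxO, huniq⟩ := Free.exists_slice S hp hS x
    obtain ⟨V, hV, hVc, hVO⟩ := exists_mem_nhds_isClosed_subset (hO.mem_nhds hxO)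
    have hAc : IsClosed (⋃ t ∈ Finset.range p ×ˢ Finset.range p ×ˢ Finset.range p,
        S.word t.1 t.2.1 t.2.2 ⁻¹' V) := Set.Finite.isClosed_biUnion (Finset.finite_toSet _)
      fun t _ => hVc.preimage (S.continuous_word _ _ _)
    set A := ⋃ t ∈ Finset.range p ×ˢ Finset.range p ×ˢ Finset.range p,
        S.word t.1 t.2.1 t.2.2 ⁻¹' V with hA
    have hmem {y i j l} (h : S.word i j l y ∈ V) : y ∈ A := by
      refine Set.mem_iUnion₂.2 ⟨(i % p, j % p, l % p), by simp [Nat.mod_lt _ hp], ?_⟩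
      rwa [Set.mem_preimage, word_mod]
    have hmem' {y} (hy : y ∈ A) : ∃ i < p, ∃ j < p, ∃ l < p, S.word i j l y ∈ V := by
      obtain ⟨t, ht, h⟩ := Set.mem_iUnion₂.1 hy
      simp only [Finset.mem_product, Finset.mem_range] at ht
      exact ⟨_, ht.1, _, ht.2.1, _, ht.2.2, h⟩
    refine ⟨A, mem_nhdsWithin_of_mem_nhds (Filter.mem_of_superset hV fun y hy =>
      hmem (i := 0) (j := 0) (l := 0) hy), A, subset_rfl, hAc, fun m y hy => ?_, ?_⟩
    · obtain ⟨i, -, j, -, l, -, h⟩ := hmem' hy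
      have hmod (n : ℕ) : n ≡ n + p [MOD p] := Nat.add_modEq_right.symm
      have h0 : S.u 0 y = S.word 1 0 0 y := rfl
      have h1 : S.u 1 y = S.word 0 1 0 y := rfl
      have h2 : S.u 2 y = S.word 0 0 1 y := rfl
      fin_cases m
      · refine hmem (i := i + (p - 1)) (j := j) (l := l) ?_
        rw [S.word_eq_of_modEq (hmod i) rfl rfl] at h
        simpa [h0, word_word, add_assoc, Nat.sub_add_cancel hp] using h
      · refine hmem (i := i) (j := j + (p - 1)) (l := l) ?_
        rw [S.word_eq_of_modEq rfl (hmod j) rfl] at h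
        simpa [h1, word_word, add_assoc, Nat.sub_add_cancel hp] using h
      · refine hmem (i := i) (j := j) (l := l + (p - 1)) ?_
        rw [S.word_eq_of_modEq rfl rfl (hmod l)] at h
        simpa [h2, word_word, add_assoc, Nat.sub_add_cancel hp] using h
    · intro B hBA _ hBi
      refine S.acyclic_of_slice hBi k hO huniq (fun b hb => ?_) ha
      obtain ⟨i, hi, j, hj, l, hl, h⟩ := hmem' (hBA hb)
      exact ⟨i, hi, j, hj, l, hl, hVO h⟩

end Translations

end

namespace AttachCells

variable {n k : ℕ} {X : Type} [TopologicalSpace X] {f : Fin k → C(CellBoundary n, X)}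

/-- A function on the space with cells attached, from compatible functions on the pieces. -/
def lift (g : X → ℝ) (h : Fin k → Cell n → ℝ)
    (hgh : ∀ i (s : CellBoundary n), g (f i s) = h i ⟨s.1, sphere_subset_closedBall s.2⟩) :
    AttachCells n k X f → ℝ :=
  Quot.lift (Sum.elim g fun v => h v.1 v.2) (by
    rintro _ _ ⟨i, s, rfl, rfl⟩
    exact hgh i s)

lemma continuous_lift {g : X → ℝ} {h : Fin k → Cell n → ℝ}
    (hgh : ∀ i (s : CellBoundary n), g (f i s) = h i ⟨s.1, sphere_subset_closedBall s.2⟩)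
    (hg : Continuous g) (hh : ∀ i, Continuous (h i)) : Continuous (lift (f := f) g h hgh) :=
  continuous_quot_lift _ (hg.sumElim
    (continuous_sigma (f := fun v : Σ _ : Fin k, Cell n => h v.1 v.2) hh))

lemma exists_rep (z : AttachCells n k X f) : (∃ x, z = Quot.mk _ (Sum.inl x)) ∨
    ∃ (i : Fin k) (v : Cell n), ‖v.1‖ < 1 ∧ z = Quot.mk _ (Sum.inr ⟨i, v⟩) := by
  obtain ⟨x | ⟨i, v⟩, rfl⟩ := Quot.exists_rep z
  · exact Or.inl ⟨x, rfl⟩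
  · rcases (mem_closedBall_zero_iff.1 v.2).lt_or_eq with h | h
    · exact Or.inr ⟨i, v, h, rfl⟩
    · exact Or.inl ⟨f i ⟨v.1, mem_sphere_zero_iff_norm.2 h⟩,
        (Quot.sound ⟨i, ⟨v.1, mem_sphere_zero_iff_norm.2 h⟩, rfl, rfl⟩).symm⟩

instance compactSpace [CompactSpace X] : CompactSpace (AttachCells n k X f) := by
  have : CompactSpace (Cell n) := isCompact_iff_compactSpace.1 (isCompact_closedBall _ _)
  infer_instance

lemma exists_separating_inl [CompactSpace X] [T2Space X] {x y : X} (hxy : x ≠ y) :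
    ∃ F : AttachCells n k X f → ℝ, Continuous F ∧
      F (Quot.mk _ (Sum.inl x)) ≠ F (Quot.mk _ (Sum.inl y)) := by
  obtain ⟨g, hx, hy, -⟩ := exists_continuous_zero_one_of_isClosed (isClosed_singleton (x := x))
    (isClosed_singleton (x := y)) (Set.disjoint_singleton.2 hxy)
  have he : Topology.IsClosedEmbedding
      (fun s : CellBoundary n => (⟨s.1, sphere_subset_closedBall s.2⟩ : Cell n)) := by
    have : CompactSpace (CellBoundary n) := isCompact_iff_compactSpace.1 (isCompact_sphere _ _)
    exact Continuous.isClosedEmbedding (by fun_prop) fun s t h =>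
      Subtype.ext (congrArg (fun w : Cell n => w.1) h :)
  choose h hh using fun i => ContinuousMap.exists_extension he (g.comp (f i))
  refine ⟨lift g (fun i => h i) fun i s => (DFunLike.congr_fun (hh i) s).symm,
    continuous_lift _ g.continuous fun i => (h i).continuous, ?_⟩
  change g x ≠ g y
  rw [hx rfl, hy rfl]
  exact zero_ne_one

lemma exists_separating_inr {i : Fin k} {v : Cell n} (hv : ‖v.1‖ < 1) {z : AttachCells n k X f}
    (hz : z ≠ Quot.mk _ (Sum.inr ⟨i, v⟩)) :
    ∃ F : AttachCells n k X f → ℝ, Continuous F ∧ F z ≠ F (Quot.mk _ (Sum.inr ⟨i, v⟩)) := by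
  classical
  have hc (q : Cell n → ℝ) (hq : Continuous q) : ∃ F : AttachCells n k X f → ℝ, Continuous F ∧
      (∀ x, F (Quot.mk _ (Sum.inl x)) = 0) ∧ ∀ j w, F (Quot.mk _ (Sum.inr ⟨j, w⟩)) =
        if j = i then (1 - ‖w.1‖) * q w else 0 := by
    refine ⟨lift 0 (fun j w => if j = i then (1 - ‖w.1‖) * q w else 0) fun j s => ?_,
      continuous_lift _ continuous_const fun j => ?_, fun _ => rfl, fun _ _ => rfl⟩
    · have : ‖s.1‖ = 1 := mem_sphere_zero_iff_norm.1 s.2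
      simp [this]
    · split_ifs <;> fun_prop
  have h1 : 0 < 1 - ‖v.1‖ := sub_pos.2 hv
  rcases exists_rep z with ⟨x, rfl⟩ | ⟨j, w, hw, rfl⟩
  · obtain ⟨F, hF, hF0, hF1⟩ := hc 1 continuous_const
    refine ⟨F, hF, ?_⟩
    rw [hF0, hF1, if_pos rfl]
    simpa using h1.ne
  · by_cases hj : j = i
    · subst hj
      obtain ⟨F, hF, hF0, hF1⟩ := hc (fun w => dist w v) (by fun_prop)
      refine ⟨F, hF, ?_⟩
      have hwv : w ≠ v := by
        rintro rfl
        exact hz rfl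
      rw [hF1, hF1, if_pos rfl, if_pos rfl, dist_self, mul_zero]
      exact (mul_pos (sub_pos.2 hw) (dist_pos.2 hwv)).ne'
    · obtain ⟨F, hF, hF0, hF1⟩ := hc 1 continuous_const
      refine ⟨F, hF, ?_⟩
      rw [hF1, hF1, if_pos rfl, if_neg hj]
      simpa using h1.ne

instance t2Space [CompactSpace X] [T2Space X] : T2Space (AttachCells n k X f) := by
  refine ⟨fun y z hyz => ?_⟩
  rcases exists_rep z with ⟨x, rfl⟩ | ⟨i, v, hv, rfl⟩
  · rcases exists_rep y with ⟨x', rfl⟩ | ⟨i, v, hv, rfl⟩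
    · obtain ⟨F, hF, h⟩ := exists_separating_inl (n := n) (k := k) (f := f) (x := x') (y := x)
        fun h => hyz (by rw [h])
      exact separated_by_continuous hF h
    · obtain ⟨F, hF, h⟩ := exists_separating_inr hv hyz.symm
      exact separated_by_continuous hF h.symm
  · obtain ⟨F, hF, h⟩ := exists_separating_inr hv hyz
    exact separated_by_continuous hF h

end AttachCells

lemma IsFiniteCWAtMost.compactSpace_and_t2Space {n : ℕ} {X : Type} [TopologicalSpace X]
    (hX : IsFiniteCWAtMost n X) : CompactSpace X ∧ T2Space X := by
  induction hX with
  | base k f => exact ⟨inferInstance, inferInstance⟩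
  | up _ ih => exact ih
  | attach _ k f ih =>
    obtain ⟨_, _⟩ := ih
    exact ⟨inferInstance, inferInstance⟩
  | homeo _ e ih =>
    obtain ⟨_, _⟩ := ih
    exact ⟨e.compactSpace, e.t2Space⟩

lemma Homeomorph.coe_pow_eq_iterate {X : Type} [TopologicalSpace X] (e : X ≃ₜ X) (n : ℕ) :
    ⇑(e ^ n) = (⇑e)^[n] := by
  induction n with
  | zero => rfl
  | succ n ih => rw [pow_succ, Function.iterate_succ, ← ih]; rfl

/-- The commuting translations by which the standard generators of `(ℤ/p)³` act. -/
def Translations.ofHom {p : ℕ} {X : Type} [TopologicalSpace X]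
    (ψ : (Fin 3 → Multiplicative (ZMod p)) →* (X ≃ₜ X)) : Translations p X where
  u i := ψ (Pi.mulSingle i (Multiplicative.ofAdd 1))
  continuous_u i := (ψ _).continuous
  comm i j := by
    funext x
    exact DFunLike.congr_fun ((Commute.all _ _).map ψ).eq x
  iterate i := by
    rw [← Homeomorph.coe_pow_eq_iterate, ← map_pow, ← Pi.mulSingle_pow, ← ofAdd_nsmul]
    simp
    rfl

lemma Translations.ofHom_word {p : ℕ} {X : Type} [TopologicalSpace X]
    (ψ : (Fin 3 → Multiplicative (ZMod p)) →* (X ≃ₜ X)) (i j l : ℕ) :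
    (ofHom ψ).word i j l =
      ψ ![Multiplicative.ofAdd (i : ZMod p), Multiplicative.ofAdd (j : ZMod p),
        Multiplicative.ofAdd (l : ZMod p)] := by
  let b : Fin 3 → Fin 3 → Multiplicative (ZMod p) :=
    fun m => Pi.mulSingle m (Multiplicative.ofAdd 1)
  have hs : ![Multiplicative.ofAdd (i : ZMod p), Multiplicative.ofAdd (j : ZMod p),
        Multiplicative.ofAdd (l : ZMod p)] = b 2 ^ l * b 1 ^ j * b 0 ^ i := by
    funext m
    fin_cases m <;> simp [b, ← ofAdd_nsmul]
  rw [hs, map_mul, map_mul, map_pow, map_pow, map_pow]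
  change ((ofHom ψ).u 2)^[l] ∘ ((ofHom ψ).u 1)^[j] ∘ ((ofHom ψ).u 0)^[i] = _
  simp only [ofHom, ← Homeomorph.coe_pow_eq_iterate]
  rfl

/-- **Conner–Heller theorem.** If a finite group `G` acts freely and continuously on a
finite CW complex `X` homotopy equivalent to a product of two spheres `S^{n₁} × S^{n₂}`
(`n₁, n₂ ≥ 1`), then `G` contains no subgroup isomorphic to `(ℤ/p)³` for any prime `p`,
i.e. the rank of `G` is at most `2`. -/
theorem rank_le_two_of_free_action_on_product_of_two_spheres
    (G : Type) [Group G] [Finite G] (n₁ n₂ : ℕ) (hn₁ : 1 ≤ n₁) (hn₂ : 1 ≤ n₂)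
    (X : Type) [TopologicalSpace X] (hX : IsFiniteCW X)
    (e : Nonempty (ContinuousMap.HomotopyEquiv X (Sph n₁ × Sph n₂)))
    (φ : G →* (X ≃ₜ X))
    (hfree : ∀ (g : G) (x : X), φ g x = x → g = 1)
    (p : ℕ) (hp : p.Prime) :
    ¬ ∃ f : (Fin 3 → Multiplicative (ZMod p)) →* G, Function.Injective f := by
  rintro ⟨f, hf⟩
  have : Fact p.Prime := ⟨hp⟩
  obtain ⟨e⟩ := e
  obtain ⟨n, hX⟩ := hX
  obtain ⟨hc, ht⟩ := hX.compactSpace_and_t2Space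
  have hne : (Set.univ : Set X).Nonempty := by
    obtain ⟨a, ha⟩ := NormedSpace.sphere_nonempty
      (x := (0 : EuclideanSpace ℝ (Fin (n₁ + 1)))) (r := 1) |>.2 zero_le_one
    obtain ⟨b, hb⟩ := NormedSpace.sphere_nonempty
      (x := (0 : EuclideanSpace ℝ (Fin (n₂ + 1)))) (r := 1) |>.2 zero_le_one
    exact ⟨e.invFun (⟨a, ha⟩, ⟨b, hb⟩), trivial⟩
  let S := Translations.ofHom (φ.comp f)
  have hS : S.Free := by
    intro x i j l h
    rw [Translations.ofHom_word] at h
    have h1 := hf ((hfree _ _ h).trans f.map_one.symm)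
    simp only [← ZMod.natCast_eq_zero_iff]
    exact ⟨congrFun h1 0, congrFun h1 1, congrFun h1 2⟩
  obtain ⟨c, hcoc, hc⟩ := Cochain.exists_generates_of_homotopyEquiv (k := ZMod p) e
  let T := S.germs (A := Set.univ) (fun _ => Set.mapsTo_univ _ _) (ZMod p)
  let q := (Cochain.null (ZMod p) (Set.univ : Set X)).mkQ
  have hD (g) : T.D (q g) = q (Cochain.d (ZMod p) X g) := rfl
  refine T.false_of_acyclic (by simp) (fun i => q (c i)) ?_
    ⟨q (Cochain.unit (ZMod p) X), ?_, ?_⟩ fun K _ _ a ha => hS.acyclic S (ZMod p) ha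
  · intro g hg
    obtain ⟨g, rfl⟩ := Submodule.mkQ_surjective _ g
    have hg' := hc (Cochain.mem_cocycles.2 ((Submodule.Quotient.mk_eq_zero _).1 hg))
    obtain ⟨s, hs, t, ht, rfl⟩ := Submodule.mem_sup.1 hg'
    obtain ⟨l, rfl⟩ := (Submodule.mem_span_range_iff_exists_fun _).1 hs
    obtain ⟨w, hw⟩ := Cochain.mem_coboundaries.1 ht
    refine ⟨l, q w, ?_⟩
    have hw' : q t = q (Cochain.d (ZMod p) X w) := (Submodule.Quotient.eq _).2 hw
    change q _ = _
    rw [hD, ← hw', map_add, map_sum]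
    simp only [map_smul]
  · rw [hD, Cochain.d_unit, map_zero]
  · intro w hw
    obtain ⟨w, rfl⟩ := Submodule.mkQ_surjective _ w
    exact Cochain.unit_not_mem_coboundaries hne
      (Cochain.mem_coboundaries.2 ⟨w, (Submodule.Quotient.eq _).1 hw.symm⟩)
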